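/- arXiv:2605.04398 — 2 statements merged into one kernel-verified Lean document; each statement's English description precedes it below -/
import Mathlib

section
/- Let d ≥ 3, let K be a convex body contained in an affine chart of ℝP^d, let H ⊂ ℝP^d be a hyperplane which is not a support hyperplane of K, and let p₁, p₂ be two distinct interior points of K with p₁, p₂ ∉ H. Suppose that for every (d−2)-dimensional projective plane l ⊂ H there exists a harmonic homology Φ_G^τ with hyperplane G and center τ such that l ⊂ G, τ ∈ H, and Φ_G^τ(aff{p₁, l} ∩ K) = aff{p₂, l} ∩ K. Let h := L(p₁,p₂) ∩ H and let g be the point on the line L(p₁,p₂) with [p₁,p₂; g,h] = −1. Then g is a pole of K with polar H. -/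
noncomputable section

open Set Module

/-- The vector space `ℝ^{d+1}` whose projectivization is `ℝP^d`. -/
abbrev PV (d : ℕ) : Type := Fin (d + 1) → ℝ

/-- Real projective `d`-space `ℝP^d`. -/
abbrev RP (d : ℕ) : Type := Projectivization ℝ (PV d)

/-- The affine chart embedding of `ℝ^d` into `ℝP^d` determined by a linear
change of coordinates `e` of `ℝ^{d+1}`. -/
def chartMap {d : ℕ} (e : PV d ≃ₗ[ℝ] PV d) (x : Fin d → ℝ) : RP d :=
  Projectivization.mk ℝ (e (Fin.snoc x 1)) <| by
    rw [ne_eq, LinearEquiv.map_eq_zero_iff]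
    intro h
    have h1 := congrFun h (Fin.last d)
    simp [Fin.snoc_last] at h1

/-- The set of points of `ℝP^d` lying in (the projectivization of) a linear subspace `W`. -/
def projSet {d : ℕ} (W : Submodule ℝ (PV d)) : Set (RP d) :=
  {x : RP d | x.submodule ≤ W}

/-- The projective line through two points, as a set of points of `ℝP^d`. -/
def projLine {d : ℕ} (A B : RP d) : Set (RP d) :=
  {x : RP d | x.submodule ≤ A.submodule ⊔ B.submodule}

/-- The projective span `aff {p, l}` of a point `p` and the projective subspace
corresponding to the linear subspace `W`. -/
def projSpan {d : ℕ} (p : RP d) (W : Submodule ℝ (PV d)) : Set (RP d) :=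
  {x : RP d | x.submodule ≤ W ⊔ p.submodule}

/-- Four collinear points of `ℝP^d` are harmonic, `[A,B;P,Q] = -1`:  there are
representatives `a, b` of `A, B` such that `a + b` represents `P` and `a - b`
represents `Q`. -/
def HarmonicQuad {d : ℕ} (A B P Q : RP d) : Prop :=
  ∃ (a b : PV d) (ha : a ≠ 0) (hb : b ≠ 0) (hab : a + b ≠ 0) (hab' : a - b ≠ 0),
    A = Projectivization.mk ℝ a ha ∧ B = Projectivization.mk ℝ b hb ∧
      P = Projectivization.mk ℝ (a + b) hab ∧ Q = Projectivization.mk ℝ (a - b) hab'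

/-- `g` is a pole, with polar the set `H`, of a convex body with boundary `bdK`:
every line through `g` meeting the boundary in two points `A ≠ B` and meeting `H`
in a point `q` satisfies `[A,B;g,q] = -1`. -/
def IsPoleOf {d : ℕ} (bdK : Set (RP d)) (g : RP d) (H : Set (RP d)) : Prop :=
  ∀ A B q : RP d, A ∈ bdK → B ∈ bdK → A ≠ B →
    g ∈ projLine A B → q ∈ projLine A B → q ∈ H → HarmonicQuad A B g q

/-- `Φ` is the harmonic homology of `ℝP^d` with hyperplane `G` and center `τ`:
it is induced by a linear involution which is the identity on a linear hyperplane
representing `G` and is `-1` on the line representing `τ`. -/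
def IsHarmonicHomology {d : ℕ} (Φ : RP d → RP d) (G : Set (RP d)) (τ : RP d) : Prop :=
  ∃ (σ : PV d ≃ₗ[ℝ] PV d) (W : Submodule ℝ (PV d)) (t : PV d) (ht : t ≠ 0),
    Module.finrank ℝ W = d ∧ G = projSet W ∧ τ = Projectivization.mk ℝ t ht ∧ t ∉ W ∧
      (∀ v ∈ W, σ v = v) ∧ σ t = -t ∧
      ∀ (v : PV d) (hv : v ≠ 0), ∃ hv' : σ v ≠ 0,
        Φ (Projectivization.mk ℝ v hv) = Projectivization.mk ℝ (σ v) hv'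

/-- The boundary of the convex body `chartMap e '' K₀` of `ℝP^d`, i.e. the image of
the boundary of `K₀ ⊆ ℝ^d` under the affine chart embedding. -/
def chartFrontier {d : ℕ} (e : PV d ≃ₗ[ℝ] PV d) (K₀ : Set (Fin d → ℝ)) : Set (RP d) :=
  chartMap e '' frontier K₀

/-- The closed Euclidean unit ball of `ℝ^d`. -/
def euclUnitBall (d : ℕ) : Set (Fin d → ℝ) := {x : Fin d → ℝ | ∑ i, x i ^ 2 ≤ 1}

/-- A subset of `ℝ^d` is an ellipsoid if it is the image of the closed Euclidean
unit ball under an invertible affine map. -/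
def IsEllipsoidIn (d : ℕ) (S : Set (Fin d → ℝ)) : Prop :=
  ∃ T : (Fin d → ℝ) ≃ᵃ[ℝ] (Fin d → ℝ), S = T '' euclUnitBall d

/-- A subset of `ℝP^d` is an ellipsoid if, in some affine chart containing it, it is
the image of the closed Euclidean unit ball under an invertible affine map. -/
def IsProjEllipsoid {d : ℕ} (K : Set (RP d)) : Prop :=
  ∃ (e : PV d ≃ₗ[ℝ] PV d) (S : Set (Fin d → ℝ)), IsEllipsoidIn d S ∧ K = chartMap e '' S

/-- `H` is a support hyperplane of the convex body `chartMap e '' K₀`: it meets the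
body but misses its interior. -/
def IsSupportHyperplane {d : ℕ} (e : PV d ≃ₗ[ℝ] PV d) (K₀ : Set (Fin d → ℝ))
    (H : Set (RP d)) : Prop :=
  (H ∩ chartMap e '' K₀).Nonempty ∧ H ∩ chartMap e '' interior K₀ = ∅

/-- The relative boundary of the section of the convex body `chartMap e '' K₀` by the
projective plane corresponding to the linear subspace `W`. -/
def sectionFrontier {d : ℕ} (e : PV d ≃ₗ[ℝ] PV d) (K₀ : Set (Fin d → ℝ))
    (W : Submodule ℝ (PV d)) : Set (RP d) :=
  chartMap e '' intrinsicFrontier ℝ (chartMap e ⁻¹' projSet W ∩ K₀)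

/-- `p` is a false pole of the convex body `chartMap e '' K₀` with respect to `H`:
`p` is not a pole with respect to `H`, and for every projective 2-plane `Π` through `p`
the section `Π ∩ K` has a pole whose corresponding polar is `Π ∩ H`. -/
def IsFalsePole {d : ℕ} (e : PV d ≃ₗ[ℝ] PV d) (K₀ : Set (Fin d → ℝ)) (p : RP d)
    (H : Set (RP d)) : Prop :=
  ¬ IsPoleOf (chartFrontier e K₀) p H ∧
    ∀ W : Submodule ℝ (PV d), Module.finrank ℝ W = 3 → p.submodule ≤ W →
      ∃ q : RP d, q.submodule ≤ W ∧ IsPoleOf (sectionFrontier e K₀ W) q (projSet W ∩ H)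

set_option linter.unusedSectionVars false



section AffinePart

variable {E : Type*} [NormedAddCommGroup E] [NormedSpace ℝ E]

/-- gauge of `K` seen from the point `p` -/
noncomputable def ngauge (K : Set E) (p v : E) : ℝ := gauge {z | p + z ∈ K} v

theorem ng_convex {K : Set E} (hK : Convex ℝ K) (p : E) : Convex ℝ {z | p + z ∈ K} :=
  hK.translate_preimage_right p

theorem ng_nhds {K : Set E} {p : E} (hp : p ∈ interior K) : {z | p + z ∈ K} ∈ nhds (0 : E) := by
  have h1 : K ∈ nhds (p + 0) := by simpa using mem_interior_iff_mem_nhds.1 hp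
  have h2 : ContinuousAt (fun z : E => p + z) 0 := by fun_prop
  exact h2 h1

theorem ng_continuous {K : Set E} (hK : Convex ℝ K) {p : E} (hp : p ∈ interior K) :
    Continuous (ngauge K p) :=
  continuous_gauge (ng_convex hK p) (ng_nhds hp)

theorem ng_smul (K : Set E) (p v : E) {r : ℝ} (hr : 0 ≤ r) :
    ngauge K p (r • v) = r * ngauge K p v := by
  unfold ngauge
  simpa using gauge_smul_of_nonneg (s := {z | p + z ∈ K}) hr v

theorem ng_closed {K : Set E} (hc : IsCompact K) (p : E) : IsClosed {z | p + z ∈ K} :=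
  hc.isClosed.preimage (by fun_prop : Continuous fun z : E => p + z)

theorem ng_le_one {K : Set E} (hK : Convex ℝ K) (hc : IsCompact K) {p : E}
    (hp : p ∈ interior K) (v : E) : ngauge K p v ≤ 1 ↔ p + v ∈ K := by
  unfold ngauge
  rw [gauge_le_one_iff_mem_closure (ng_convex hK p) (ng_nhds hp), (ng_closed hc p).closure_eq]
  rfl

theorem ng_eq_one {K : Set E} (hK : Convex ℝ K) {p : E}
    (hp : p ∈ interior K) (v : E) : ngauge K p v = 1 ↔ p + v ∈ frontier K := by
  unfold ngauge
  rw [gauge_eq_one_iff_mem_frontier (ng_convex hK p) (ng_nhds hp)]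
  have : {z | p + z ∈ K} = (Homeomorph.addLeft p) ⁻¹' K := by ext; simp
  rw [this, ← Homeomorph.preimage_frontier]
  rfl

theorem ng_lower {K : Set E} (hc : IsCompact K) {p : E}
    (hp : p ∈ interior K) : ∃ ε > 0, ∀ v, ε * ‖v‖ ≤ ngauge K p v := by
  obtain ⟨R, hR⟩ := hc.isBounded.subset_closedBall p
  have hR0 : 0 < max R 1 := by positivity
  refine ⟨(max R 1)⁻¹, by positivity, fun v => ?_⟩
  have := le_gauge_of_subset_closedBall (s := {z | p + z ∈ K}) (r := max R 1)
    (absorbent_nhds_zero (ng_nhds hp)) hR0.le (x := v) (by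
      intro z hz
      have := hR hz
      simp [Metric.mem_closedBall, dist_eq_norm] at this ⊢
      left; exact this)
  rw [div_eq_inv_mul] at this
  exact this

theorem ng_pos {K : Set E} (hc : IsCompact K) {p : E}
    (hp : p ∈ interior K) {v : E} (hv : v ≠ 0) : 0 < ngauge K p v := by
  obtain ⟨ε, h0, h⟩ := ng_lower hc hp
  have := norm_pos_iff.2 hv
  exact lt_of_lt_of_le (by positivity) (h v)

theorem ng_mem_end {K : Set E} (hK : Convex ℝ K) (hc : IsCompact K) {p : E}
    (hp : p ∈ interior K) {v : E} (hv : v ≠ 0) : p + (ngauge K p v)⁻¹ • v ∈ K := by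
  have h := ng_pos hc hp hv
  rw [← ng_le_one hK hc hp, ng_smul _ _ _ (by positivity), inv_mul_cancel₀ h.ne']

theorem ng_le_end {K : Set E} (hK : Convex ℝ K) (hc : IsCompact K) {p : E}
    (hp : p ∈ interior K) {v : E} (hv : v ≠ 0) {r : ℝ} (hr : p + r • v ∈ K) :
    r ≤ (ngauge K p v)⁻¹ := by
  have h := ng_pos hc hp hv
  rcases le_or_gt r 0 with h0 | h0
  · exact h0.trans (by positivity)
  · rw [← ng_le_one hK hc hp, ng_smul _ _ _ h0.le] at hr
    rw [← one_div, le_div_iff₀ h]; exact hr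

/-- parallel chords through `p` and `q` of direction `v` are translates of each other -/
def ChordEq (K : Set E) (p q v : E) : Prop :=
  ∃ c : ℝ, ∀ r : ℝ, p + r • v ∈ K ↔ q + (r + c) • v ∈ K

theorem chord_shift {K : Set E} (hK : Convex ℝ K) (hc : IsCompact K) {p q : E}
    (hp : p ∈ interior K) (hq : q ∈ interior K) {v : E} (hv : v ≠ 0) {c : ℝ}
    (h : ∀ r : ℝ, p + r • v ∈ K ↔ q + (r + c) • v ∈ K) :
    (ngauge K q v)⁻¹ = (ngauge K p v)⁻¹ + c := by
  apply le_antisymm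
  · have h1 := ng_mem_end hK hc hq hv
    have h2 := (h ((ngauge K q v)⁻¹ - c)).2 (by simpa using h1)
    have := ng_le_end hK hc hp hv h2
    linarith
  · exact ng_le_end hK hc hq hv ((h _).1 (ng_mem_end hK hc hp hv))

theorem chord_sum {K : Set E} (hK : Convex ℝ K) (hc : IsCompact K) {p q : E}
    (hp : p ∈ interior K) (hq : q ∈ interior K) {v : E} (hv : v ≠ 0) (h : ChordEq K p q v) :
    (ngauge K p v)⁻¹ + (ngauge K p (-v))⁻¹ = (ngauge K q v)⁻¹ + (ngauge K q (-v))⁻¹ := by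
  obtain ⟨c, h⟩ := h
  have h1 := chord_shift hK hc hp hq hv h
  have h2 := chord_shift hK hc hp hq (neg_ne_zero.2 hv) (c := -c) (by
    intro r
    have := h (-r)
    rw [smul_neg, smul_neg, ← neg_smul, ← neg_smul, this]
    ring_nf)
  rw [h1, h2]; ring

/-- `w` is a good direction -/
def GoodDir (K : Set E) (p q w : E) : Prop := ngauge K p w = ngauge K q (-w)

theorem good_neg {K : Set E} (hK : Convex ℝ K) (hc : IsCompact K) {p q : E}
    (hp : p ∈ interior K) (hq : q ∈ interior K) {v : E} (hv : v ≠ 0) (h : ChordEq K p q v) :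
    GoodDir K p q (-v) ↔ GoodDir K p q v := by
  have := chord_sum hK hc hp hq hv h
  unfold GoodDir
  rw [neg_neg]
  constructor
  · intro h1
    rw [h1] at this
    apply inv_injective; linarith
  · intro h1
    rw [h1] at this
    apply inv_injective; linarith

theorem good_smul {K : Set E} {p q v : E} {r : ℝ} (hr : 0 < r) :
    GoodDir K p q (r • v) ↔ GoodDir K p q v := by
  unfold GoodDir
  rw [← smul_neg, ng_smul _ _ _ hr.le, ng_smul _ _ _ hr.le]
  exact mul_right_inj' hr.ne'

theorem good_step {K : Set E} (hK : Convex ℝ K) (hc : IsCompact K) {p q : E}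
    (hp : p ∈ interior K) (hq : q ∈ interior K) {w : E} (hw : w ≠ 0)
    (hw' : w + ngauge K p w • (p - q) ≠ 0)
    (h : ChordEq K p q (w + ngauge K p w • (p - q))) :
    GoodDir K p q w ↔ GoodDir K p q (w + ngauge K p w • (p - q)) := by
  rw [← good_neg hK hc hp hq hw' h]
  set N := ngauge K p w with hN
  have hN0 : 0 < N := ng_pos hc hp hw
  set w' := w + N • (p - q) with hw'def
  have key : ∀ (s : E) (z : E), s ∈ interior K →
      (ngauge K s z = N ↔ s + N⁻¹ • z ∈ frontier K) := by
    intro s z hs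
    rw [← ng_eq_one hK hs, ng_smul _ _ _ (by positivity)]
    constructor
    · intro h; rw [h]; field_simp
    · intro h; field_simp at h; exact h
  have e1 : q + N⁻¹ • w' = p + N⁻¹ • w := by
    rw [hw'def, smul_add, smul_smul, inv_mul_cancel₀ hN0.ne']; module
  have e2 : p + N⁻¹ • (-w') = q + N⁻¹ • (-w) := by
    rw [hw'def, smul_neg, smul_add, smul_smul, inv_mul_cancel₀ hN0.ne']; module
  have h1 : ngauge K q w' = N := by
    rw [key q w' hq, e1, ← key p w hp]
  unfold GoodDir
  rw [neg_neg, h1, key p _ hp, e2, ← key q _ hq, ← hN]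
  exact eq_comm

theorem exists_lower_bound {w b : E} (hw : w ∉ Submodule.span ℝ {b}) :
    ∃ δ > 0, ∀ c : ℝ, δ ≤ ‖w + c • b‖ := by
  have hcl : IsClosed (Submodule.span ℝ {b} : Set E) := Submodule.closed_of_finiteDimensional _
  have hne : (Submodule.span ℝ {b} : Set E).Nonempty := ⟨0, Submodule.zero_mem _⟩
  refine ⟨Metric.infDist w (Submodule.span ℝ {b} : Set E),
    (hcl.notMem_iff_infDist_pos hne).1 hw, fun c => ?_⟩
  have := Metric.infDist_le_dist_of_mem (x := w) (y := -(c • b))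
    (s := (Submodule.span ℝ {b} : Set E))
    (Submodule.neg_mem _ (Submodule.smul_mem _ _ (Submodule.mem_span_singleton_self b)))
  simpa [dist_eq_norm] using this

theorem add_smul_notMem {w b : E} (hw : w ∉ Submodule.span ℝ {b}) (c : ℝ) :
    w + c • b ∉ Submodule.span ℝ {b} := by
  intro h
  exact hw ((Submodule.add_mem_iff_left _ (Submodule.smul_mem _ _
    (Submodule.mem_span_singleton_self b))).1 h)

theorem ne_zero_of_notMem {w b : E} (hw : w ∉ Submodule.span ℝ {b}) : w ≠ 0 := by
  rintro rfl; exact hw (Submodule.zero_mem _)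

theorem good_iter {K : Set E} (hK : Convex ℝ K) (hc : IsCompact K) {p q : E}
    (hp : p ∈ interior K) (hq : q ∈ interior K) (l : Submodule ℝ E) (hb : p - q ∈ l)
    (h : ∀ v ∈ l, v ≠ 0 → ChordEq K p q v) {w : E} (hwl : w ∈ l)
    (hw : w ∉ Submodule.span ℝ {p - q}) :
    ∃ c : ℕ → ℝ, Filter.Tendsto c Filter.atTop Filter.atTop ∧
      ∀ n, GoodDir K p q w ↔ GoodDir K p q (w + c n • (p - q)) := by
  obtain ⟨δ, hδ, hδ'⟩ := exists_lower_bound hw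
  obtain ⟨ε, hε, hε'⟩ := ng_lower hc hp
  let c : ℕ → ℝ := fun n => Nat.rec 0 (fun _ x => x + ngauge K p (w + x • (p - q))) n
  have hcs : ∀ n, c (n + 1) = c n + ngauge K p (w + c n • (p - q)) := fun n => rfl
  have hlow : ∀ n : ℕ, n * (ε * δ) ≤ c n := by
    intro n
    induction n with
    | zero => simp [c]
    | succ n ih =>
      rw [hcs]
      have h1 := hε' (w + c n • (p - q))
      have h2 : ε * δ ≤ ε * ‖w + c n • (p - q)‖ := by gcongr; exact hδ' _
      push_cast
      linarith
  refine ⟨c, ?_, ?_⟩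
  · refine Filter.tendsto_atTop_mono hlow ?_
    exact Filter.Tendsto.atTop_mul_const (by positivity) tendsto_natCast_atTop_atTop
  · intro n
    induction n with
    | zero => simp [c]
    | succ n ih =>
      rw [ih]
      have e : w + c (n + 1) • (p - q) =
          (w + c n • (p - q)) + ngauge K p (w + c n • (p - q)) • (p - q) := by
        rw [hcs]; module
      have hne : w + c (n + 1) • (p - q) ≠ 0 := ne_zero_of_notMem (add_smul_notMem hw _)
      have hmem : w + c (n + 1) • (p - q) ∈ l := l.add_mem hwl (l.smul_mem _ hb)
      rw [e] at hne hmem ⊢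
      exact good_step hK hc hp hq (ne_zero_of_notMem (add_smul_notMem hw _)) hne (h _ hmem hne)

theorem tendsto_dir (w b : E) {c : ℕ → ℝ} (hc : Filter.Tendsto c Filter.atTop Filter.atTop) :
    Filter.Tendsto (fun n => b + (c n)⁻¹ • w) Filter.atTop (nhds b) := by
  have h1 : Filter.Tendsto (fun n => (c n)⁻¹) Filter.atTop (nhds 0) :=
    tendsto_inv_atTop_zero.comp hc
  simpa using tendsto_const_nhds.add (h1.smul_const w)

theorem good_rescale {K : Set E} {p q w : E} {c : ℝ} (hc : 0 < c) :
    GoodDir K p q (w + c • (p - q)) ↔ GoodDir K p q ((p - q) + c⁻¹ • w) := by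
  rw [← good_smul (r := c) (v := (p - q) + c⁻¹ • w) hc, smul_add, smul_smul,
    mul_inv_cancel₀ hc.ne', one_smul, add_comm]

theorem good_closed {K : Set E} (hK : Convex ℝ K) {p q : E}
    (hp : p ∈ interior K) (hq : q ∈ interior K) : IsClosed {w | GoodDir K p q w} :=
  isClosed_eq (ng_continuous hK hp) ((ng_continuous hK hq).comp continuous_neg)

theorem good_axis {K : Set E} (hK : Convex ℝ K) (hc : IsCompact K) {p q : E}
    (hp : p ∈ interior K) (hq : q ∈ interior K) (hpq : p ≠ q) (l : Submodule ℝ E)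
    (hb : p - q ∈ l)
    (h : ∀ v ∈ l, v ≠ 0 → ChordEq K p q v) {e : E} (hel : e ∈ l)
    (he : e ∉ Submodule.span ℝ {p - q}) : GoodDir K p q (p - q) := by
  have hb0 : p - q ≠ 0 := sub_ne_zero.2 hpq
  set b := p - q with hbdef
  let et : ℝ → E := fun t => t • b + (1 - t ^ 2) • e
  have hetc : Continuous et := by fun_prop
  let F : ℝ → ℝ := fun t => ngauge K p (et t) - ngauge K q (-(et t))
  have hF : Continuous F := ((ng_continuous hK hp).comp hetc).sub
    ((ng_continuous hK hq).comp hetc.neg)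
  have h1 : et 1 = b := by simp [et]
  have h2 : et (-1) = -b := by simp [et]
  have hs := chord_sum hK hc hp hq hb0 (h b hb hb0)
  have hnb : -b ≠ 0 := neg_ne_zero.2 hb0
  have a1 := ng_pos hc hp hb0
  have a2 := ng_pos hc hp hnb
  have a3 := ng_pos hc hq hb0
  have a4 := ng_pos hc hq hnb
  have hzero : ∃ t ∈ Icc (-1 : ℝ) 1, F t = 0 := by
    have hsub := intermediate_value_uIcc (a := (-1 : ℝ)) (b := 1) hF.continuousOn
    rw [uIcc_of_le (by norm_num : (-1 : ℝ) ≤ 1)] at hsub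
    have h0 : (0 : ℝ) ∈ uIcc (F (-1)) (F 1) := by
      simp only [F, h1, h2, neg_neg]
      rw [mem_uIcc]
      rcases le_total (ngauge K p b) (ngauge K q (-b)) with hle | hle
      · right
        refine ⟨by linarith, ?_⟩
        have := inv_anti₀ a1 hle
        have h3 : (ngauge K p (-b))⁻¹ ≤ (ngauge K q b)⁻¹ := by linarith
        have := (inv_le_inv₀ a2 a3).1 h3
        linarith
      · left
        refine ⟨?_, by linarith⟩
        have := inv_anti₀ a4 hle
        have h3 : (ngauge K q b)⁻¹ ≤ (ngauge K p (-b))⁻¹ := by linarith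
        have := (inv_le_inv₀ a3 a2).1 h3
        linarith
    obtain ⟨t, ht, hFt⟩ := hsub h0
    exact ⟨t, ht, hFt⟩
  obtain ⟨t, ht, hFt⟩ := hzero
  have hg : GoodDir K p q (et t) := sub_eq_zero.1 hFt
  by_cases ht1 : t = 1
  · rwa [ht1, h1] at hg
  by_cases ht2 : t = -1
  · rw [ht2, h2] at hg
    exact (good_neg hK hc hp hq hb0 (h b hb hb0)).1 hg
  have ht3 : 1 - t ^ 2 ≠ 0 := by
    have : (1 - t) * (1 + t) ≠ 0 := mul_ne_zero (by grind) (by grind)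
    intro h; apply this; linarith
  have hmem : et t ∉ Submodule.span ℝ {b} := by
    intro hm
    have := (Submodule.add_mem_iff_right _ (Submodule.smul_mem _ t
      (Submodule.mem_span_singleton_self b))).1 hm
    exact he ((Submodule.smul_mem_iff _ ht3).1 this)
  obtain ⟨c, hct, hc2⟩ := good_iter hK hc hp hq l hb h
    (l.add_mem (l.smul_mem _ hb) (l.smul_mem _ hel) : et t ∈ l) hmem
  have := (good_closed hK hp hq).mem_of_tendsto (tendsto_dir (et t) b hct) (by
    filter_upwards [hct.eventually_gt_atTop 0] with n hn
    exact (good_rescale hn).1 ((hc2 n).1 hg))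
  exact this

theorem good_all {K : Set E} (hK : Convex ℝ K) (hc : IsCompact K) {p q : E}
    (hp : p ∈ interior K) (hq : q ∈ interior K) (hpq : p ≠ q)
    (h : ∀ v : E, v ≠ 0 → ChordEq K p q v) 
    (hnear : ∀ᶠ w in nhds (p - q), GoodDir K p q w) (w : E) : GoodDir K p q w := by
  have hb0 : p - q ≠ 0 := sub_ne_zero.2 hpq
  have hgb : GoodDir K p q (p - q) := hnear.self_of_nhds
  by_cases hw : w ∈ Submodule.span ℝ {p - q}
  · obtain ⟨r, rfl⟩ := Submodule.mem_span_singleton.1 hw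
    rcases lt_trichotomy r 0 with hr | hr | hr
    · have : r • (p - q) = (-r) • (-(p - q)) := by module
      rw [this, good_smul (by linarith), good_neg hK hc hp hq hb0 (h _ hb0)]
      exact hgb
    · simp [hr, GoodDir, ngauge]
    · rw [good_smul hr]; exact hgb
  · obtain ⟨c, hct, hc2⟩ := good_iter hK hc hp hq ⊤ trivial (fun v _ => h v)
      (Submodule.mem_top : w ∈ ⊤) hw
    have h1 := (tendsto_dir w (p - q) hct).eventually hnear
    obtain ⟨n, hn1, hn2⟩ := (h1.and (hct.eventually_gt_atTop 0)).exists
    exact (hc2 n).2 ((good_rescale hn2).2 hn1)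

end AffinePart


section AffinePart2

variable {E : Type*} [NormedAddCommGroup E] [NormedSpace ℝ E]

/-- the sections of `K` through `a` and `-a` parallel to `l` differ by the translation `u - 2a` -/
def SecTr (K : Set E) (a : E) (l : Submodule ℝ E) (u : E) : Prop :=
  u ∈ l ∧ ∀ z ∈ l, a + z ∈ K ↔ -a + z + u ∈ K

theorem secTr_unique {K : Set E} (hc : IsCompact K) {a : E} (ha : a ∈ K) {l : Submodule ℝ E}
    {u u' : E} (h : SecTr K a l u) (h' : SecTr K a l u') : u = u' := by
  have hd : u - u' ∈ l := l.sub_mem h.1 h'.1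
  have key : ∀ n : ℕ, a + (n : ℝ) • (u - u') ∈ K := by
    intro n
    induction n with
    | zero => simpa using ha
    | succ n ih =>
      have h1 := (h.2 _ (l.smul_mem _ hd)).1 ih
      have hm : ((n + 1 : ℕ) : ℝ) • (u - u') ∈ l := l.smul_mem _ hd
      refine (h'.2 _ hm).2 ?_
      convert h1 using 1
      push_cast; module
  by_contra hne
  have hpos : 0 < ‖u - u'‖ := norm_pos_iff.2 (sub_ne_zero.2 hne)
  obtain ⟨R, hR⟩ := hc.isBounded.subset_closedBall a
  obtain ⟨n, hn⟩ := exists_nat_gt (R / ‖u - u'‖)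
  have := hR (key n)
  simp [Metric.mem_closedBall, dist_eq_norm, norm_smul] at this
  rw [div_lt_iff₀ hpos] at hn
  linarith

theorem mem_sup_span {m : Submodule ℝ E} {e z : E} :
    z ∈ m ⊔ Submodule.span ℝ {e} ↔ ∃ w ∈ m, ∃ s : ℝ, w + s • e = z := by
  rw [Submodule.mem_sup]
  constructor
  · rintro ⟨w, hw, y, hy, rfl⟩
    obtain ⟨s, rfl⟩ := Submodule.mem_span_singleton.1 hy
    exact ⟨w, hw, s, rfl⟩
  · rintro ⟨w, hw, s, rfl⟩
    exact ⟨w, hw, _, Submodule.smul_mem _ _ (Submodule.mem_span_singleton_self e), rfl⟩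

/-- shrinking towards an interior point -/
theorem shrink_interior {K : Set E} (hK : Convex ℝ K) {p y : E} (hp : p ∈ interior K)
    (hy : p + y ∈ K) {ε : ℝ} (h0 : 0 < ε) (h1 : ε ≤ 1) : p + (1 - ε) • y ∈ interior K := by
  have := hK.combo_interior_self_mem_interior hp hy h0 (sub_nonneg.2 h1) (by ring)
  convert this using 1
  module

theorem tendsto_shrink (x y : E) :
    Filter.Tendsto (fun ε : ℝ => x + (1 - ε) • y) (nhdsWithin 0 (Ioi 0)) (nhds (x + y)) := by
  have : Continuous (fun ε : ℝ => x + (1 - ε) • y) := by fun_prop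
  have h := this.tendsto 0
  simp only [sub_zero, one_smul] at h
  exact h.mono_left nhdsWithin_le_nhds

theorem secTr_iff_weak {K : Set E} (hK : Convex ℝ K) (hc : IsCompact K) {a : E}
    (ha : a ∈ interior K) (ha' : -a ∈ interior K) {l : Submodule ℝ E} {u : E} (hu : u ∈ l) :
    SecTr K a l u ↔ (∀ z ∈ l, a + z ∈ interior K → -a + z + u ∈ K) ∧
      (∀ z ∈ l, -a + z + u ∈ interior K → a + z ∈ K) := by
  constructor
  · intro h
    exact ⟨fun z hz h1 => (h.2 z hz).1 (interior_subset h1),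
      fun z hz h1 => (h.2 z hz).2 (interior_subset h1)⟩
  · rintro ⟨h1, h2⟩
    have hev : ∀ᶠ ε : ℝ in nhdsWithin 0 (Ioi 0), 0 < ε ∧ ε ≤ 1 := by
      have h3 : ∀ᶠ ε : ℝ in nhdsWithin 0 (Ioi 0), 0 < ε := eventually_mem_nhdsWithin
      have h4 : ∀ᶠ ε : ℝ in nhdsWithin 0 (Ioi 0), ε ≤ 1 :=
        nhdsWithin_le_nhds (Iic_mem_nhds (by norm_num))
      exact h3.and h4
    refine ⟨hu, fun z hz => ⟨fun h => ?_, fun h => ?_⟩⟩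
    · have ht := tendsto_shrink (-a + u) z
      have : -a + u + z ∈ K := hc.isClosed.mem_of_tendsto ht (by
        filter_upwards [hev] with ε hε
        have := h1 _ (l.smul_mem (1 - ε) hz) (shrink_interior hK ha h hε.1 hε.2)
        convert this using 1; abel)
      convert this using 1; abel
    · have h' : -a + (z + u) ∈ K := by convert h using 1; abel
      have ht := tendsto_shrink (a - u) (z + u)
      have : a - u + (z + u) ∈ K := hc.isClosed.mem_of_tendsto ht (by
        filter_upwards [hev] with ε hε
        have h3 := shrink_interior hK ha' h' hε.1 hε.2
        have := h2 ((1 - ε) • (z + u) - u) (l.sub_mem (l.smul_mem _ (l.add_mem hz hu)) hu)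
          (by convert h3 using 1; abel)
        convert this using 1; abel)
      convert this using 1; abel

variable [FiniteDimensional ℝ E]

theorem pencil_step {K : Set E} (hK : Convex ℝ K) (hc : IsCompact K) {a : E}
    (ha : a ∈ interior K) (ha' : -a ∈ interior K) {m : Submodule ℝ E} {e : E}
    (ham : a ∉ m) (he : e ∉ m ⊔ Submodule.span ℝ {a})
    (hP : ∀ t : ℝ, ∃ u, SecTr K a (m ⊔ Submodule.span ℝ {t • a + (1 - t ^ 2) • e}) u) :
    ∃ t : ℝ, ∃ u ∈ m, SecTr K a (m ⊔ Submodule.span ℝ {t • a + (1 - t ^ 2) • e}) u := by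
  obtain ⟨β, hβe, hβ⟩ := Submodule.exists_le_ker_of_notMem he
  have hβm : ∀ x ∈ m, β x = 0 := fun x hx => hβ (Submodule.mem_sup_left hx)
  have hβa : β a = 0 := hβ (Submodule.mem_sup_right (Submodule.mem_span_singleton_self a))
  have ham2 : a ∉ m ⊔ Submodule.span ℝ {e} := by
    intro h
    obtain ⟨w, hw, s, hs⟩ := mem_sup_span.1 h
    have : s * β e = 0 := by
      have := congrArg β hs
      simpa [hβm w hw, hβa] using this
    have hs0 : s = 0 := by simpa [hβe] using this
    rw [hs0] at hs; simp at hs; exact ham (hs ▸ hw)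
  obtain ⟨α, hαa, hα⟩ := Submodule.exists_le_ker_of_notMem ham2
  have hαm : ∀ x ∈ m, α x = 0 := fun x hx => hα (Submodule.mem_sup_left hx)
  have hαe : α e = 0 := hα (Submodule.mem_sup_right (Submodule.mem_span_singleton_self e))
  have hαc : Continuous α := α.continuous_of_finiteDimensional
  have hβc : Continuous β := β.continuous_of_finiteDimensional
  let et : ℝ → E := fun t => t • a + (1 - t ^ 2) • e
  have hetc : Continuous et := by fun_prop
  let lt : ℝ → Submodule ℝ E := fun t => m ⊔ Submodule.span ℝ {et t}
  have hetl : ∀ t, et t ∈ lt t := fun t =>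
    Submodule.mem_sup_right (Submodule.mem_span_singleton_self _)
  -- the sign functional
  let sg : ℝ → E → ℝ := fun t u => t * (α u / α a) + (1 - t ^ 2) * (β u / β e)
  have hsg : ∀ t w s, w ∈ m → sg t (w + s • et t) = s * (t ^ 2 + (1 - t ^ 2) ^ 2) := by
    intro t w s hw
    simp only [sg, et, map_add, map_smul, hαm w hw, hβm w hw, hαe, hβa, smul_eq_mul]
    field_simp
    ring
  have hpos : ∀ t : ℝ, 0 < t ^ 2 + (1 - t ^ 2) ^ 2 := by
    intro t
    nlinarith [sq_nonneg (t ^ 2 - 1 / 2)]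
  -- membership as a closed condition
  have hmem : ∀ t u, u ∈ lt t ↔ u - (sg t u / (t ^ 2 + (1 - t ^ 2) ^ 2)) • et t ∈ m := by
    intro t u
    constructor
    · intro h
      obtain ⟨w, hw, s, rfl⟩ := mem_sup_span.1 h
      rw [hsg t w s hw, mul_div_assoc, div_self (hpos t).ne']
      simpa using hw
    · intro h
      have := (lt t).add_mem (Submodule.mem_sup_left h : _ ∈ lt t)
        ((lt t).smul_mem (sg t u / (t ^ 2 + (1 - t ^ 2) ^ 2)) (hetl t))
      simpa using this
  have hmcl : IsClosed (m : Set E) := Submodule.closed_of_finiteDimensional _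
  have hsgc : Continuous fun x : ℝ × E => sg x.1 x.2 := by
    have h1 : Continuous fun x : ℝ × E => α x.2 := hαc.comp continuous_snd
    have h2 : Continuous fun x : ℝ × E => β x.2 := hβc.comp continuous_snd
    simp only [sg]
    fun_prop
  have hVcl : IsClosed {x : ℝ × E | SecTr K a (lt x.1) x.2} := by
    have hU : IsClosed {x : ℝ × E | x.2 ∈ lt x.1} := by
      simp only [hmem]
      refine hmcl.preimage (f := fun x : ℝ × E =>
        x.2 - (sg x.1 x.2 / (x.1 ^ 2 + (1 - x.1 ^ 2) ^ 2)) • et x.1) ?_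
      have : Continuous fun x : ℝ × E => sg x.1 x.2 / (x.1 ^ 2 + (1 - x.1 ^ 2) ^ 2) :=
        hsgc.div (by fun_prop) (fun x => (hpos x.1).ne')
      fun_prop
    have hA : IsClosed {x : ℝ × E | ∀ w ∈ m, ∀ s : ℝ,
        a + (w + s • et x.1) ∈ interior K → -a + (w + s • et x.1) + x.2 ∈ K} := by
      simp only [ofPred_forall]
      refine isClosed_iInter fun w => isClosed_iInter fun hw => isClosed_iInter fun s => ?_
      have : {x : ℝ × E | a + (w + s • et x.1) ∈ interior K →
          -a + (w + s • et x.1) + x.2 ∈ K} =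
          {x : ℝ × E | a + (w + s • et x.1) ∈ interior K}ᶜ ∪
          {x : ℝ × E | -a + (w + s • et x.1) + x.2 ∈ K} := by
        ext x; simp [imp_iff_not_or]
      rw [this]
      refine IsClosed.union (IsOpen.isClosed_compl ?_) ?_
      · exact isOpen_interior.preimage (by fun_prop :
          Continuous fun x : ℝ × E => a + (w + s • et x.1))
      · exact hc.isClosed.preimage (by fun_prop :
          Continuous fun x : ℝ × E => -a + (w + s • et x.1) + x.2)
    have hB : IsClosed {x : ℝ × E | ∀ w ∈ m, ∀ s : ℝ,
        -a + (w + s • et x.1) + x.2 ∈ interior K → a + (w + s • et x.1) ∈ K} := by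
      simp only [ofPred_forall]
      refine isClosed_iInter fun w => isClosed_iInter fun hw => isClosed_iInter fun s => ?_
      have : {x : ℝ × E | -a + (w + s • et x.1) + x.2 ∈ interior K →
          a + (w + s • et x.1) ∈ K} =
          {x : ℝ × E | -a + (w + s • et x.1) + x.2 ∈ interior K}ᶜ ∪
          {x : ℝ × E | a + (w + s • et x.1) ∈ K} := by
        ext x; simp [imp_iff_not_or]
      rw [this]
      refine IsClosed.union (IsOpen.isClosed_compl ?_) ?_
      · exact isOpen_interior.preimage (by fun_prop :
          Continuous fun x : ℝ × E => -a + (w + s • et x.1) + x.2)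
      · exact hc.isClosed.preimage (by fun_prop :
          Continuous fun x : ℝ × E => a + (w + s • et x.1))
    convert hU.inter (hA.inter hB) using 1
    ext ⟨t, u⟩
    simp only [mem_ofPred_eq, mem_inter_iff]
    constructor
    · intro h
      refine ⟨h.1, ?_, ?_⟩
      · intro w hw s
        exact ((secTr_iff_weak hK hc ha ha' h.1).1 h).1 _ (mem_sup_span.2 ⟨w, hw, s, rfl⟩)
      · intro w hw s
        exact ((secTr_iff_weak hK hc ha ha' h.1).1 h).2 _ (mem_sup_span.2 ⟨w, hw, s, rfl⟩)
    · rintro ⟨h1, h2, h3⟩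
      refine (secTr_iff_weak hK hc ha ha' h1).2 ⟨?_, ?_⟩
      · intro z hz
        obtain ⟨w, hw, s, rfl⟩ := mem_sup_span.1 hz
        exact h2 w hw s
      · intro z hz
        obtain ⟨w, hw, s, rfl⟩ := mem_sup_span.1 hz
        exact h3 w hw s
  have hcptI : IsCompact (Icc (-1 : ℝ) 1 ×ˢ ((fun x => a + x) '' K)) :=
    isCompact_Icc.prod (hc.image (by fun_prop))
  let Vp : Set (ℝ × E) := {x | SecTr K a (lt x.1) x.2 ∧ 0 ≤ sg x.1 x.2}
  let Vm : Set (ℝ × E) := {x | SecTr K a (lt x.1) x.2 ∧ sg x.1 x.2 ≤ 0}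
  have hVp : IsClosed Vp := hVcl.inter (isClosed_le continuous_const hsgc)
  have hVm : IsClosed Vm := hVcl.inter (isClosed_le hsgc continuous_const)
  have hub : ∀ t u, SecTr K a (lt t) u → u ∈ (fun x => a + x) '' K := by
    intro t u h
    have := (h.2 0 (Submodule.zero_mem _)).1 (by simpa using interior_subset ha)
    exact ⟨-a + 0 + u, this, by simp⟩
  have hTp : IsClosed (Prod.fst '' ((Icc (-1 : ℝ) 1 ×ˢ ((fun x => a + x) '' K)) ∩ Vp)) :=
    ((hcptI.inter_right hVp).image continuous_fst).isClosed
  have hTm : IsClosed (Prod.fst '' ((Icc (-1 : ℝ) 1 ×ˢ ((fun x => a + x) '' K)) ∩ Vm)) :=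
    ((hcptI.inter_right hVm).image continuous_fst).isClosed
  have h2a : ∀ t, et t = a ∨ et t = -a → SecTr K a (lt t) ((2 : ℝ) • a) := by
    intro t ht
    have : a ∈ lt t := by
      rcases ht with ht | ht
      · rw [← ht]; exact hetl t
      · have := (lt t).neg_mem (hetl t)
        rwa [ht, neg_neg] at this
    refine ⟨(lt t).smul_mem _ this, fun z _ => ?_⟩
    have e : -a + z + (2 : ℝ) • a = a + z := by module
    rw [e]
  have hi1 : et 1 = a := by simp [et]
  have hi2 : et (-1) = -a := by simp [et]
  have hconn := isPreconnected_closed_iff.1 (isPreconnected_Icc (a := (-1 : ℝ)) (b := 1))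
    _ _ hTp hTm (by
      intro t ht
      obtain ⟨u, hu⟩ := hP t
      rcases le_total 0 (sg t u) with h | h
      · left; exact ⟨(t, u), ⟨⟨ht, hub t u hu⟩, hu, h⟩, rfl⟩
      · right; exact ⟨(t, u), ⟨⟨ht, hub t u hu⟩, hu, h⟩, rfl⟩)
    (by
      refine ⟨1, by norm_num, (1, (2 : ℝ) • a), ⟨⟨by norm_num, ?_⟩, ?_, ?_⟩, rfl⟩
      · exact hub _ _ (h2a 1 (Or.inl hi1))
      · exact h2a 1 (Or.inl hi1)
      · have := hsg 1 0 2 m.zero_mem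
        rw [hi1, zero_add] at this
        simp only [this]; norm_num)
    (by
      refine ⟨-1, by norm_num, (-1, (2 : ℝ) • a), ⟨⟨by norm_num, ?_⟩, ?_, ?_⟩, rfl⟩
      · exact hub _ _ (h2a (-1) (Or.inr hi2))
      · exact h2a (-1) (Or.inr hi2)
      · have := hsg (-1) 0 (-2) m.zero_mem
        rw [hi2, zero_add, smul_neg, neg_smul, neg_neg] at this
        simp only [this]; norm_num)
  obtain ⟨t, -, ⟨⟨t1, u1⟩, ⟨-, h1, h1'⟩, rfl⟩, ⟨⟨t2, u2⟩, ⟨-, h2, h2'⟩, ht2⟩⟩ := hconn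
  simp only at ht2 h1 h2 h1' h2'
  subst ht2
  have hu : u1 = u2 := secTr_unique hc (interior_subset ha) h1 h2
  subst hu
  refine ⟨t2, u1, ?_, h1⟩
  have := (hmem t2 u1).1 h1.1
  rwa [le_antisymm h2' h1', zero_div, zero_smul, sub_zero] at this

theorem finrank_sup_span {m : Submodule ℝ E} {e : E} (he : e ∉ m) :
    finrank ℝ (m ⊔ Submodule.span ℝ {e} : Submodule ℝ E) = finrank ℝ m + 1 := by
  have h := Submodule.finrank_sup_add_finrank_inf_eq m (Submodule.span ℝ {e})
  have h0 : e ≠ 0 := by rintro rfl; exact he m.zero_mem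
  have h1 : m ⊓ Submodule.span ℝ {e} = ⊥ := by
    rw [eq_bot_iff]
    rintro x ⟨hx1, hx2⟩
    obtain ⟨s, rfl⟩ := Submodule.mem_span_singleton.1 hx2
    by_cases hs : s = 0
    · simp [hs]
    · exact absurd ((Submodule.smul_mem_iff _ hs).1 hx1) he
  rw [h1, finrank_bot, finrank_span_singleton h0] at h
  simpa using h

theorem exists_pencil {K : Set E} (hK : Convex ℝ K) (hc : IsCompact K) {a : E}
    (ha : a ∈ interior K) (ha' : -a ∈ interior K) {k : ℕ}
    (hP : ∀ l : Submodule ℝ E, finrank ℝ l = k + 1 → ∃ u, SecTr K a l u)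
    (hk : k + 2 ≤ finrank ℝ E) (m : Submodule ℝ E) (hm : finrank ℝ m = k) (ham : a ∉ m) :
    ∃ l : Submodule ℝ E, finrank ℝ l = k + 1 ∧ m ≤ l ∧ ∃ u ∈ m, SecTr K a l u := by
  by_cases hex : ∃ e, e ∉ m ⊔ Submodule.span ℝ {a}
  · obtain ⟨e, he⟩ := hex
    have hne : ∀ t : ℝ, t • a + (1 - t ^ 2) • e ∉ m := by
      intro t ht
      by_cases h1 : 1 - t ^ 2 = 0
      · rw [h1, zero_smul, add_zero] at ht
        have : t ≠ 0 := by rintro rfl; norm_num at h1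
        exact ham ((Submodule.smul_mem_iff _ this).1 ht)
      · apply he
        have h2 : (1 - t ^ 2) • e ∈ m ⊔ Submodule.span ℝ {a} :=
          mem_sup_span.2 ⟨_, ht, -t, by module⟩
        exact (Submodule.smul_mem_iff _ h1).1 h2
    obtain ⟨t, u, hu, h⟩ := pencil_step hK hc ha ha' ham he (fun t => hP _ (by
      rw [finrank_sup_span (hne t), hm]))
    exact ⟨_, by rw [finrank_sup_span (hne t), hm], le_sup_left, u, hu, h⟩
  · push Not at hex
    exfalso
    have : m ⊔ Submodule.span ℝ {a} = ⊤ := by rw [eq_top_iff]; intro x _; exact hex x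
    have h2 := finrank_sup_span ham
    rw [this, finrank_top] at h2
    omega

theorem secTr_of_mem {K : Set E} {a : E} {m : Submodule ℝ E} (ham : a ∈ m) :
    SecTr K a m ((2 : ℝ) • a) := by
  refine ⟨m.smul_mem _ ham, fun z _ => ?_⟩
  have e : -a + z + (2 : ℝ) • a = a + z := by module
  rw [e]

theorem secTr_all {K : Set E} (hK : Convex ℝ K) (hc : IsCompact K) {a : E}
    (ha : a ∈ interior K) (ha' : -a ∈ interior K) {n : ℕ} (hn : finrank ℝ E = n + 1)
    (hP : ∀ l : Submodule ℝ E, finrank ℝ l = n → ∃ u, SecTr K a l u) (j : ℕ) (hj : j ≤ n) :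
    ∀ l : Submodule ℝ E, finrank ℝ l = n - j → ∃ u, SecTr K a l u := by
  induction j with
  | zero => simpa using hP
  | succ j ih =>
    intro m hm
    by_cases ham : a ∈ m
    · exact ⟨_, secTr_of_mem ham⟩
    · have ih' := ih (by omega)
      rw [show n - j = (n - (j + 1)) + 1 by omega] at ih'
      obtain ⟨l, -, hml, u, hu, h⟩ := exists_pencil hK hc ha ha' ih' (by omega) m hm ham
      exact ⟨u, hu, fun z hz => h.2 z (hml hz)⟩

theorem affine_main {K : Set E} (hK : Convex ℝ K) (hc : IsCompact K) {a : E} (ha0 : a ≠ 0)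
    (ha : a ∈ interior K) (ha' : -a ∈ interior K) {n : ℕ} (hn : finrank ℝ E = n + 1) (hn2 : 2 ≤ n)
    (hP : ∀ l : Submodule ℝ E, finrank ℝ l = n → ∃ u, SecTr K a l u) :
    ∀ x ∈ K, -x ∈ K := by
  have hP2 := secTr_all hK hc ha ha' hn hP (n - 2) (by omega)
  rw [show n - (n - 2) = 1 + 1 by omega] at hP2
  have hP1 := secTr_all hK hc ha ha' hn hP (n - 1) (by omega)
  rw [show n - (n - 1) = 1 by omega] at hP1
  have hchord : ∀ v : E, v ≠ 0 → ChordEq K a (-a) v := by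
    intro v hv
    obtain ⟨u, hu, h⟩ := hP1 (Submodule.span ℝ {v}) (finrank_span_singleton hv)
    obtain ⟨c, rfl⟩ := Submodule.mem_span_singleton.1 hu
    refine ⟨c, fun r => ?_⟩
    rw [h (r • v) (Submodule.smul_mem _ _ (Submodule.mem_span_singleton_self v)), add_smul,
      add_assoc]
  have haa : a ≠ -a := by
    intro h
    apply ha0
    have : (2 : ℝ) • a = 0 := by rw [two_smul]; nth_rewrite 2 [h]; simp
    simpa using this
  have hb : a - -a = (2 : ℝ) • a := by module
  have hspan : Submodule.span ℝ {a - -a} = Submodule.span ℝ {a} := by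
    rw [hb]
    exact Submodule.span_singleton_smul_eq (IsUnit.mk0 _ two_ne_zero) a
  -- a direction off the axis
  have hdich : ∀ v : E, v ∉ Submodule.span ℝ {a} →
      GoodDir K a (-a) v ∨ ngauge K a v = ngauge K (-a) v := by
    intro v hv
    have hv0 : v ≠ 0 := ne_zero_of_notMem hv
    have hav : a ∉ Submodule.span ℝ {v} := by
      intro h
      obtain ⟨r, hr⟩ := Submodule.mem_span_singleton.1 h
      have hr0 : r ≠ 0 := by rintro rfl; simp at hr; exact ha0 hr.symm
      apply hv
      rw [Submodule.mem_span_singleton]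
      exact ⟨r⁻¹, by rw [← hr, smul_smul, inv_mul_cancel₀ hr0, one_smul]⟩
    obtain ⟨l, hl, hml, u, hu, h⟩ := exists_pencil hK hc ha ha' hP2 (by omega)
      (Submodule.span ℝ {v}) (finrank_span_singleton hv0) hav
    have hvl : v ∈ l := hml (Submodule.mem_span_singleton_self v)
    obtain ⟨c, rfl⟩ := Submodule.mem_span_singleton.1 hu
    -- gauge seen from `a - u` and from `-a` agree on `l`
    by_cases hc0 : c = 0
    · right
      subst hc0
      have hset : ∀ r : ℝ, a + r • v ∈ K ↔ -a + (r + 0) • v ∈ K := by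
        intro r
        have := h.2 _ (l.smul_mem r hvl)
        simpa using this
      have := chord_shift hK hc ha ha' hv0 hset
      rw [add_zero] at this
      exact (inv_injective this).symm
    · left
      set u := c • v with hudef
      have hu0 : u ≠ 0 := smul_ne_zero hc0 hv0
      have hq : a - u ∈ interior K := by
        -- a point slightly beyond `a - u` is still in `K`
        have hev : ∀ᶠ ε : ℝ in nhdsWithin 0 (Ioi 0), -a - ε • u ∈ K := by
          have hcont : Continuous fun ε : ℝ => -a - ε • u := by fun_prop
          have h1 : ∀ᶠ ε : ℝ in nhds 0, -a - ε • u ∈ interior K :=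
            hcont.continuousAt.eventually (isOpen_interior.mem_nhds (by simpa using ha'))
          filter_upwards [nhdsWithin_le_nhds h1] with ε hε
          exact interior_subset hε
        obtain ⟨ε, hε, hε0⟩ := (hev.and eventually_mem_nhdsWithin).exists
        have hε0 : 0 < ε := hε0
        have h2 : a + (-(1 + ε)) • u ∈ K := by
          refine (h.2 _ (l.smul_mem _ h.1)).2 ?_
          convert hε using 1
          module
        have h3 := shrink_interior hK ha h2 (ε := ε / (1 + ε)) (by positivity)
          (by rw [div_le_one (by positivity)]; linarith)
        convert h3 using 1
        have : (1 - ε / (1 + ε)) * (-(1 + ε)) = -1 := by field_simp; ring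
        rw [smul_smul, this]; module
      have hsame : ∀ z ∈ l, ngauge K (a - u) z = ngauge K (-a) z := by
        intro z hz
        by_cases hz0 : z = 0
        · simp [hz0, ngauge]
        have hset : ∀ r : ℝ, (a - u) + r • z ∈ K ↔ -a + (r + 0) • z ∈ K := by
          intro r
          have := h.2 _ (l.sub_mem (l.smul_mem r hz) h.1)
          have e1 : a + (r • z - u) = (a - u) + r • z := by abel
          have e2 : -a + (r • z - u) + u = -a + (r + 0) • z := by rw [add_zero]; abel
          rw [e1, e2] at this
          exact this
        have := chord_shift hK hc hq ha' hz0 hset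
        rw [add_zero] at this
        exact (inv_injective this).symm
      have hchord2 : ∀ w ∈ l, w ≠ 0 → ChordEq K a (a - u) w := by
        intro w hw hw0
        obtain ⟨c', hc'⟩ := hchord w hw0
        refine ⟨c', fun r => ?_⟩
        rw [hc' r]
        have := h.2 _ (l.sub_mem (l.smul_mem (r + c') hw) h.1)
        have e1 : a + ((r + c') • w - u) = (a - u) + (r + c') • w := by abel
        have e2 : -a + ((r + c') • w - u) + u = -a + (r + c') • w := by abel
        rw [e1, e2] at this
        exact this.symm
      have hau : a - (a - u) = u := by abel
      -- a vector in `l` off the line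
      have hex : ∃ e ∈ l, e ∉ Submodule.span ℝ {a - (a - u)} := by
        by_contra hcon
        push Not at hcon
        have h1 := Submodule.finrank_mono (show l ≤ _ from fun x hx => hcon x hx)
        rw [hau, finrank_span_singleton hu0, hl] at h1
        omega
      obtain ⟨e, hel, he⟩ := hex
      have hg := good_axis hK hc ha hq (by
        intro h; apply hu0; rw [← hau, ← h, sub_self]) l (by rw [hau]; exact h.1) hchord2 hel he
      have hg2 : GoodDir K a (-a) u := by
        unfold GoodDir at hg ⊢
        rw [hau] at hg
        rw [hg, hsame _ (l.neg_mem h.1)]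
      rcases lt_or_gt_of_ne hc0 with hneg | hpos
      · have : u = (-c) • (-v) := by rw [hudef]; module
        rw [this, good_smul (by linarith), good_neg hK hc ha ha' hv0 (hchord v hv0)] at hg2
        exact hg2
      · rw [hudef, good_smul hpos] at hg2
        exact hg2
  -- near the axis the second alternative fails
  have hne_axis : ngauge K a (a - -a) ≠ ngauge K (-a) (a - -a) := by
    intro heq
    have hb0 : a - -a ≠ 0 := sub_ne_zero.2 haa
    have := chord_shift hK hc ha ha' hb0 (c := 1) (by
      intro r
      have e : -a + (r + 1) • (a - -a) = a + r • (a - -a) := by module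
      rw [e])
    rw [heq] at this
    linarith
  have hnear1 : ∀ᶠ w in nhds (a - -a), ngauge K a w ≠ ngauge K (-a) w :=
    (isOpen_ne_fun (ng_continuous hK ha) (ng_continuous hK ha')).mem_nhds hne_axis
  have hgb : GoodDir K a (-a) (a - -a) := by
    have hex : ∃ e, e ∉ Submodule.span ℝ {a - -a} := by
      by_contra hcon
      push Not at hcon
      have h1 := Submodule.finrank_mono (show (⊤ : Submodule ℝ E) ≤ _ from fun x _ => hcon x)
      rw [finrank_span_singleton (sub_ne_zero.2 haa), finrank_top] at h1
      omega
    obtain ⟨e, he⟩ := hex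
    exact good_axis hK hc ha ha' haa ⊤ trivial (fun v _ => hchord v) trivial he
  have hnear : ∀ᶠ w in nhds (a - -a), GoodDir K a (-a) w := by
    have hpos1 : ∀ᶠ w in nhds (a - -a), w ≠ -(a - -a) := by
      refine isOpen_ne.mem_nhds ?_
      intro h
      have : (4 : ℝ) • a = 0 := by
        have : (4 : ℝ) • a = (a - -a) - (-(a - -a)) := by module
        rw [this, ← h, sub_self]
      exact ha0 (by simpa using this)
    filter_upwards [hnear1] with w hw
    by_cases hws : w ∈ Submodule.span ℝ {a}
    · rw [← hspan] at hws
      obtain ⟨r, rfl⟩ := Submodule.mem_span_singleton.1 hws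
      have hb0 : a - -a ≠ 0 := sub_ne_zero.2 haa
      rcases lt_trichotomy r 0 with hr | hr | hr
      · have : r • (a - -a) = (-r) • (-(a - -a)) := by module
        rw [this, good_smul (by linarith), good_neg hK hc ha ha' hb0 (hchord _ hb0)]
        exact hgb
      · simp [hr, GoodDir, ngauge]
      · rw [good_smul hr]; exact hgb
    · exact (hdich w hws).resolve_right hw
  intro x hx
  have hg := good_all hK hc ha ha' haa hchord hnear (x - a)
  have h1 : ngauge K a (x - a) ≤ 1 := (ng_le_one hK hc ha _).2 (by simpa using hx)
  rw [hg, ng_le_one hK hc ha'] at h1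
  convert h1 using 1
  abel

end AffinePart2


section ConePart

variable {V : Type*} [NormedAddCommGroup V] [NormedSpace ℝ V] [FiniteDimensional ℝ V]

/-- a proper convex cone `C` (without apex) with interior cone `Ci` -/
structure ConeData (C Ci : Set V) (lam : V →ₗ[ℝ] ℝ) : Prop where
  sub : Ci ⊆ C
  smulC : ∀ r : ℝ, 0 < r → ∀ v ∈ C, r • v ∈ C
  smulI : ∀ r : ℝ, 0 < r → ∀ v ∈ Ci, r • v ∈ Ci
  addC : ∀ v ∈ C, ∀ w ∈ C, v + w ∈ C
  addI : ∀ v ∈ C, ∀ w ∈ Ci, v + w ∈ Ci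
  opn : IsOpen Ci
  pos : ∀ v ∈ C, 0 < lam v
  cls : IsClosed (C ∪ {0})
  cpt : ∀ χ : V →ₗ[ℝ] ℝ, (∀ v ∈ C, 0 < χ v) → IsCompact {v | v ∈ C ∧ χ v = 1}

variable {C Ci : Set V} {lam : V →ₗ[ℝ] ℝ}

theorem ConeData.recess (D : ConeData C Ci lam) {v n : V} (h : ∀ k : ℕ, v + (k : ℝ) • n ∈ C) :
    n ∈ C ∨ n = 0 := by
  have h1 : ∀ k : ℕ, ((1 : ℝ) / ((k : ℝ) + 1)) • v + n ∈ C ∪ {0} := by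
    intro k
    left
    have hk : (0 : ℝ) < (k : ℝ) + 1 := by positivity
    have := D.smulC (1 / ((k : ℝ) + 1)) (by positivity) _ (h (k + 1))
    rw [smul_add, smul_smul] at this
    push_cast at this
    rwa [one_div_mul_cancel hk.ne', one_smul] at this
  have h2 : Filter.Tendsto (fun k : ℕ => ((1 : ℝ) / ((k : ℝ) + 1)) • v + n) Filter.atTop
      (nhds ((0 : ℝ) • v + n)) :=
    (tendsto_one_div_add_atTop_nhds_zero_nat.smul_const v).add_const n
  have h3 := D.cls.mem_of_tendsto h2 (Filter.Eventually.of_forall h1)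
  simpa [or_comm] using h3

theorem ConeData.ne_neg (D : ConeData C Ci lam) {v : V} (h : v ∈ C) (h' : -v ∈ C) : False := by
  have h1 := D.pos _ h
  have h2 := D.pos _ h'
  rw [map_neg] at h2
  linarith

/-- the line through `v` in a direction with `lam = 0` leaves `C` -/
theorem ConeData.exists_exit (D : ConeData C Ci lam) {v n : V} (hn : n ≠ 0) {S : Set V}
    (hl : ∀ t : ℝ, v + t • n ≠ 0) (hn0 : n ∉ C) (hn1 : v ∈ C) (hS : IsOpen S) :
    ∃ t : ℝ, v + t • n ∈ C ∧ v + t • n ∉ S ∨ v + t • n ∈ S ∧ v + t • n ∉ C := by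
  by_contra hcon
  push Not at hcon
  have hcont : Continuous (fun t : ℝ => v + t • n) := by fun_prop
  have hT : IsClosed {t : ℝ | v + t • n ∈ C} := by
    have : {t : ℝ | v + t • n ∈ C} = (fun t : ℝ => v + t • n) ⁻¹' (C ∪ {0}) := by
      ext t
      simp [hl t]
    rw [this]
    exact D.cls.preimage hcont
  have hT' : IsOpen {t : ℝ | v + t • n ∈ C} := by
    have : {t : ℝ | v + t • n ∈ C} = (fun t : ℝ => v + t • n) ⁻¹' S := by
      ext t
      exact ⟨(hcon t).1, (hcon t).2⟩
    rw [this]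
    exact hS.preimage hcont
  rcases isClopen_iff.1 ⟨hT, hT'⟩ with h | h
  · have : (0 : ℝ) ∈ {t : ℝ | v + t • n ∈ C} := by simpa using hn1
    rw [h] at this
    exact this
  · have : ∀ k : ℕ, v + (k : ℝ) • n ∈ C := by
      intro k
      have : (k : ℝ) ∈ {t : ℝ | v + t • n ∈ C} := by rw [h]; trivial
      exact this
    rcases D.recess this with h | h
    · exact hn0 h
    · exact hn h

theorem ker_inf_finrank {W : Submodule ℝ V} {ψ : V →ₗ[ℝ] ℝ} {c : V} (hc : c ∈ W) (hψ : ψ c ≠ 0) :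
    finrank ℝ (W ⊓ LinearMap.ker ψ : Submodule ℝ V) + 1 = finrank ℝ W := by
  have h0 : ψ.domRestrict W ≠ 0 := by
    intro h
    apply hψ
    have := LinearMap.congr_fun h ⟨c, hc⟩
    simpa using this
  have h1 := Module.Dual.finrank_ker_add_one_of_ne_zero (f := ψ.domRestrict W) h0
  have h2 : (LinearMap.ker (ψ.domRestrict W)).map W.subtype = W ⊓ LinearMap.ker ψ := by
    ext x
    simp [LinearMap.mem_ker, and_comm]
  rw [← h2, Submodule.finrank_map_subtype_eq]
  exact h1

theorem exists_ker_vec {W : Submodule ℝ V} (hW : 2 ≤ finrank ℝ W) (ψ : V →ₗ[ℝ] ℝ) :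
    ∃ n ∈ W, n ≠ 0 ∧ ψ n = 0 := by
  have h1 : LinearMap.ker (ψ.domRestrict W) ≠ ⊥ := by
    apply LinearMap.ker_ne_bot_of_finrank_lt
    simp
    omega
  obtain ⟨x, hx, hx0⟩ := Submodule.exists_mem_ne_zero_of_ne_bot h1
  refine ⟨x, x.2, by simpa using hx0, by simpa using hx⟩

theorem ConeData.exists_support (D : ConeData C Ci lam) {W : Submodule ℝ V}
    (hW : 2 ≤ finrank ℝ W) {c : V} (hcW : c ∈ W) (hc : c ∈ Ci) :
    ∃ b ∈ C, ∃ l : Submodule ℝ V, l ≤ W ∧ finrank ℝ l + 1 = finrank ℝ W ∧ b ∈ l ∧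
      ∀ x ∈ l, x ∉ Ci := by
  obtain ⟨n, hnW, hn0, hnl⟩ := exists_ker_vec hW lam
  have hlam : ∀ t : ℝ, lam (c + t • n) = lam c := by intro t; simp [hnl]
  have hcpos := D.pos c (D.sub hc)
  obtain ⟨t, ht⟩ := D.exists_exit (v := c) hn0 (S := Ci)
    (fun t h0 => by have := hlam t; rw [h0, map_zero] at this; linarith)
    (fun h => by have := D.pos n h; linarith) (D.sub hc) D.opn
  have ht : c + t • n ∈ C ∧ c + t • n ∉ Ci := by
    rcases ht with h | h
    · exact h
    · exact absurd (D.sub h.1) h.2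
  set b := c + t • n with hb
  have hbW : b ∈ W := W.add_mem hcW (W.smul_mem _ hnW)
  have hconv : Convex ℝ {x : W | (x : V) ∈ Ci} := by
    rw [convex_iff_forall_pos]
    intro x hx y hy r s hr hs _
    exact D.addI _ (D.sub (D.smulI r hr _ hx)) _ (D.smulI s hs _ hy)
  have hopn : IsOpen {x : W | (x : V) ∈ Ci} := D.opn.preimage continuous_subtype_val
  obtain ⟨f, hf⟩ := geometric_hahn_banach_open_point (x := (⟨b, hbW⟩ : W)) hconv hopn ht.2
  set b' : W := ⟨b, hbW⟩
  set c' : W := ⟨c, hcW⟩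
  have key : ∀ r ε : ℝ, 0 < r → 0 < ε → r * (f b' + ε * f c') < f b' := by
    intro r ε hr hε
    have := hf (r • (b' + ε • c')) (D.smulI r hr _ (D.addI _ ht.1 _ (D.smulI ε hε _ hc)))
    simpa [mul_add] using this
  have hcb : f c' < f b' := hf c' hc
  have hfb : f b' = 0 := by
    by_contra hne
    rcases lt_or_gt_of_ne hne with h | h
    · have h2 := key (1/4) (1/ (1 + |f c'|) * (-f b')) (by norm_num)
        (mul_pos (by positivity) (by linarith))
      have h3 : 1 / (1 + |f c'|) * (-f b') * f c' ≥ f b' := by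
        have h4 : 1 / (1 + |f c'|) * f c' ≥ -1 := by
          rw [ge_iff_le, div_mul_eq_mul_div, one_mul, le_div_iff₀ (by positivity)]
          have := neg_abs_le (f c'); linarith
        nlinarith
      linarith
    · have h2 := key 2 (1/ (2 * (1 + |f c'|)) * f b') (by norm_num)
        (mul_pos (by positivity) (by linarith))
      have h3 : 1 / (2 * (1 + |f c'|)) * f b' * f c' ≥ -(1/2) * f b' := by
        have h4 : 1 / (2 * (1 + |f c'|)) * f c' ≥ -(1/2) := by
          rw [ge_iff_le, div_mul_eq_mul_div, one_mul, le_div_iff₀ (by positivity)]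
          have := neg_abs_le (f c'); linarith
        nlinarith
      linarith
  have hf0 : (f : W →ₗ[ℝ] ℝ) ≠ 0 := by
    intro h0
    have h1 := LinearMap.congr_fun h0 c'
    have : f c' = 0 := by simpa using h1
    rw [hfb] at hcb
    linarith
  refine ⟨b, ht.1, (LinearMap.ker (f : W →ₗ[ℝ] ℝ)).map W.subtype, Submodule.map_subtype_le _ _, ?_,
    ?_, ?_⟩
  · rw [Submodule.finrank_map_subtype_eq]
    exact Module.Dual.finrank_ker_add_one_of_ne_zero (f := (f : W →ₗ[ℝ] ℝ)) hf0
  · exact ⟨b', by simpa using hfb, rfl⟩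
  · rintro _ ⟨x, hx, rfl⟩ hxi
    have h1 := hf x hxi
    have h2 : f x = 0 := by simpa using hx
    rw [hfb, h2] at h1
    exact lt_irrefl _ h1

/-- case A: `H` separates `P1` and `P2` in the chart -/
theorem ConeData.caseA (D : ConeData C Ci lam) {W : Submodule ℝ V}
    (hW : 2 ≤ finrank ℝ W) {P1 P2 : V} (h1 : P1 ∈ Ci) (h2 : -P2 ∈ Ci) (h12 : P1 - P2 ∈ W)
    (hZ : ∀ l : Submodule ℝ V, l ≤ W → finrank ℝ l + 1 = finrank ℝ W → ∃ u ∈ l, ∀ z ∈ l,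
      (P1 + z ∈ C ∨ -(P1 + z) ∈ C) ↔ (P2 + z + u ∈ C ∨ -(P2 + z + u) ∈ C)) : False := by
  have hc : P1 - P2 ∈ Ci := by
    rw [sub_eq_add_neg]; exact D.addI _ (D.sub h1) _ h2
  obtain ⟨b, hb, l, hlW, hlf, hbl, hl⟩ := D.exists_support hW h12 hc
  obtain ⟨u, hu, hZ⟩ := hZ l hlW hlf
  have key : ∀ s : ℝ, 0 < s → -(P2 + s • b + u) ∈ C := by
    intro s hs
    have := (hZ (s • b) (l.smul_mem _ hbl)).1 (Or.inl (D.addC _ (D.sub h1) _ (D.smulC s hs _ hb)))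
    rcases this with h | h
    · exfalso
      have h3 := D.addI _ h _ h2
      refine hl (s • b + u) (l.add_mem (l.smul_mem _ hbl) hu) ?_
      convert h3 using 1
      abel
    · exact h
  have hbp := D.pos b hb
  have h3 := D.pos _ (key ((|lam P2 + lam u| + 1) / lam b) (by positivity))
  simp only [map_neg, map_add, map_smul, smul_eq_mul] at h3
  rw [div_mul_cancel₀ _ hbp.ne'] at h3
  have := neg_abs_le (lam P2 + lam u)
  linarith

theorem ConeData.bdd (D : ConeData C Ci lam) (χ : V →ₗ[ℝ] ℝ) :
    ∃ M : ℝ, 0 ≤ M ∧ ∀ v ∈ C, |χ v| ≤ M * lam v := by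
  have hc := D.cpt lam D.pos
  obtain ⟨M, hM⟩ := hc.exists_bound_of_continuousOn
    (χ.continuous_of_finiteDimensional.continuousOn)
  refine ⟨max M 0, le_max_right _ _, fun v hv => ?_⟩
  have hp := D.pos v hv
  have h1 := hM ((lam v)⁻¹ • v) ⟨D.smulC _ (by positivity) _ hv, by
    rw [map_smul, smul_eq_mul, inv_mul_cancel₀ hp.ne']⟩
  rw [map_smul, smul_eq_mul, Real.norm_eq_abs, abs_mul, abs_of_pos (inv_pos.2 hp),
    inv_mul_le_iff₀ hp] at h1
  calc |χ v| ≤ lam v * M := h1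
    _ ≤ lam v * max M 0 := by gcongr; exact le_max_left _ _
    _ = _ := mul_comm _ _

theorem ConeData.exists_psi (D : ConeData C Ci lam) {x : V} (hx : x ≠ 0) :
    ∃ ψ : V →ₗ[ℝ] ℝ, (∀ v ∈ C, 0 < ψ v) ∧ ψ x ≠ 0 := by
  by_cases h : lam x = 0
  · obtain ⟨χ, hχ⟩ := Module.Projective.exists_dual_ne_zero ℝ hx
    obtain ⟨M, hM, hb⟩ := D.bdd χ
    refine ⟨(M + 1) • lam + χ, fun v hv => ?_, ?_⟩
    · have h1 := D.pos v hv
      have h2 := neg_abs_le (χ v)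
      have h3 := hb v hv
      simp only [LinearMap.add_apply, LinearMap.smul_apply, smul_eq_mul]
      linarith
    · simpa [h] using hχ
  · exact ⟨lam, D.pos, h⟩

/-- case B with sign -/
theorem ConeData.caseB' (D : ConeData C Ci lam) {W : Submodule ℝ V}
    (hW : 3 ≤ finrank ℝ W) {P1 P2 : V} (h2 : P2 ∈ Ci) (h12 : P1 - P2 ∈ W)
    {ψ : V →ₗ[ℝ] ℝ} (hψ : ∀ v ∈ C, 0 < ψ v) (hψ12 : 0 < ψ (P1 - P2)) {c0 : V} (hc0 : c0 ∈ Ci)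
    (hc0W : c0 ∈ W)
    (hZ : ∃ u ∈ W ⊓ LinearMap.ker ψ, ∀ z ∈ W ⊓ LinearMap.ker ψ,
      (P1 + z ∈ C ∨ -(P1 + z) ∈ C) ↔ (P2 + z + u ∈ C ∨ -(P2 + z + u) ∈ C)) : False := by
  have hcp := hψ _ (D.sub hc0)
  set l := W ⊓ LinearMap.ker ψ with hl
  have hlf : finrank ℝ l + 1 = finrank ℝ W := ker_inf_finrank hc0W hcp.ne'
  obtain ⟨u, hu, hZ⟩ := hZ
  set c := (ψ (P1 - P2) / ψ c0) • c0 with hc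
  have hcI : c ∈ Ci := D.smulI _ (by positivity) _ hc0
  set y := c - (P1 - P2) with hy
  have hyl : y ∈ l := by
    refine ⟨W.sub_mem (W.smul_mem _ hc0W) h12, ?_⟩
    change ψ y = 0
    rw [hy, map_sub, hc, map_smul, smul_eq_mul, div_mul_cancel₀ _ hcp.ne', sub_self]
  have hlC : ∀ x ∈ l, x ∉ C := by
    intro x hx hxC
    have := hψ x hxC
    rw [hx.2] at this
    exact lt_irrefl _ this
  -- membership for points over `P2`
  have hP2 : ∀ z ∈ l, -(P2 + z) ∉ C := by
    intro z hz h
    refine hlC (-z) (l.neg_mem hz) ?_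
    have := D.addC _ h _ (D.sub h2)
    convert this using 1
    abel
  have hP1 : ∀ z ∈ l, -(P1 + z) ∉ C := by
    intro z hz h
    have h3 := D.addC _ h _ (D.sub (D.addI _ (D.sub hcI) _ h2))
    refine hlC (y - z) (l.sub_mem hyl hz) ?_
    convert h3 using 1
    rw [hy]
    abel
  have hZ' : ∀ z ∈ l, P1 + z ∈ C ↔ P2 + z + u ∈ C := by
    intro z hz
    have := hZ z hz
    have h4 : -(P2 + z + u) ∉ C := by
      rw [add_assoc]; exact hP2 _ (l.add_mem hz hu)
    simpa [hP1 z hz, h4, -neg_add_rev] using this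
  have hstep : ∀ z ∈ l, P2 + z ∈ C → P1 + (z + y) ∈ Ci := by
    intro z hz h
    have := D.addI _ h _ hcI
    convert this using 1
    rw [hy]; abel
  have hiter : ∀ k : ℕ, P2 + (k : ℝ) • (y + u) ∈ C := by
    intro k
    induction k with
    | zero => simpa using D.sub h2
    | succ k ih =>
      have hkl : (k : ℝ) • (y + u) ∈ l := l.smul_mem _ (l.add_mem hyl hu)
      have h3 := (hZ' _ (l.add_mem hkl hyl)).1 (D.sub (hstep _ hkl ih))
      convert h3 using 1
      push_cast
      rw [add_smul, one_smul]
      abel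
  have hw : y + u = 0 := by
    rcases D.recess hiter with h | h
    · exact absurd h (hlC _ (l.add_mem hyl hu))
    · exact h
  obtain ⟨n, hnl, hn0, -⟩ := exists_ker_vec (W := l) (by omega) lam
  obtain ⟨t, ht⟩ := D.exists_exit (v := P2) (n := n) hn0 (S := {v | v + c ∈ Ci})
    (fun t h0 => by
      have h3 := congrArg ψ h0
      have h5 : ψ n = 0 := hnl.2
      rw [map_add, map_smul, h5, map_zero, smul_zero, add_zero] at h3
      have := hψ _ (D.sub h2)
      linarith) (hlC n hnl) (D.sub h2) (D.opn.preimage (by fun_prop))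
  rcases ht with ⟨h3, h4⟩ | ⟨h3, h4⟩
  · exact h4 (D.addI _ h3 _ hcI)
  · apply h4
    have h5 : P1 + (t • n + y) ∈ C := by
      convert D.sub h3 using 1
      rw [hy]; abel
    have h6 := (hZ' _ (l.add_mem (l.smul_mem _ hnl) hyl)).1 h5
    convert h6 using 1
    rw [add_assoc P2, add_assoc, hw, add_zero]

theorem ConeData.caseB (D : ConeData C Ci lam) {W : Submodule ℝ V}
    (hW : 3 ≤ finrank ℝ W) {P1 P2 : V} (h1 : P1 ∈ Ci) (h2 : P2 ∈ Ci) (h12 : P1 - P2 ∈ W)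
    (hne : P1 ≠ P2) {c0 : V} (hc0 : c0 ∈ Ci) (hc0W : c0 ∈ W)
    (hZ : ∀ l : Submodule ℝ V, l ≤ W → finrank ℝ l + 1 = finrank ℝ W → ∃ u ∈ l, ∀ z ∈ l,
      (P1 + z ∈ C ∨ -(P1 + z) ∈ C) ↔ (P2 + z + u ∈ C ∨ -(P2 + z + u) ∈ C)) : False := by
  obtain ⟨ψ, hψ, hψ12⟩ := D.exists_psi (sub_ne_zero.2 hne)
  have hcp := hψ _ (D.sub hc0)
  obtain ⟨u, hu, hZ⟩ := hZ (W ⊓ LinearMap.ker ψ) inf_le_left (ker_inf_finrank hc0W hcp.ne')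
  rcases lt_or_gt_of_ne hψ12 with h | h
  · refine D.caseB' hW (P1 := P2) (P2 := P1) h1 (by simpa using W.neg_mem h12) hψ ?_ hc0 hc0W
      ⟨-u, Submodule.neg_mem _ hu, fun z hz => ?_⟩
    · rw [← neg_sub, map_neg]; linarith
    · have := hZ (z - u) (Submodule.sub_mem _ hz hu)
      rw [show P1 + z + -u = P1 + (z - u) by abel, this, show P2 + (z - u) + u = P2 + z by abel]
  · exact D.caseB' hW h2 h12 hψ h hc0 hc0W ⟨u, hu, hZ⟩

end ConePart


section ConePart2

variable {V : Type*} [NormedAddCommGroup V] [NormedSpace ℝ V] [FiniteDimensional ℝ V]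
variable {C Ci : Set V} {lam : V →ₗ[ℝ] ℝ}

theorem ConeData.caseII (D : ConeData C Ci lam) {W : Submodule ℝ V} {n : ℕ}
    (hn : finrank ℝ W = n + 1) (hn2 : 2 ≤ n) {P1 P2 : V} (h1 : P1 ∈ Ci) (h2 : P2 ∈ Ci)
    (hne : P1 ≠ P2) {φ : V →ₗ[ℝ] ℝ} (hφW : ∀ v, φ v = 0 ↔ v ∈ W) (hφ : ∀ v ∈ C, 0 < φ v)
    (hφ1 : φ P1 = 1) (hφ2 : φ P2 = 1)
    (hZ : ∀ l : Submodule ℝ V, l ≤ W → finrank ℝ l + 1 = finrank ℝ W → ∃ u ∈ l, ∀ z ∈ l,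
      (P1 + z ∈ C ∨ -(P1 + z) ∈ C) ↔ (P2 + z + u ∈ C ∨ -(P2 + z + u) ∈ C)) :
    ∀ z ∈ W, (1 / 2 : ℝ) • (P1 + P2) + z ∈ C → (1 / 2 : ℝ) • (P1 + P2) - z ∈ C := by
  set gg := (1 / 2 : ℝ) • (P1 + P2) with hgg
  have hφg : φ gg = 1 := by rw [hgg, map_smul, map_add, hφ1, hφ2]; norm_num
  have haW : (1 / 2 : ℝ) • (P1 - P2) ∈ W := by
    rw [← hφW, map_smul, map_sub, hφ1, hφ2]; simp
  set a : W := ⟨(1 / 2 : ℝ) • (P1 - P2), haW⟩ with ha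
  have hga : gg + (a : V) = P1 := by
    rw [hgg, ha]; module
  have hga' : gg + ((-a : W) : V) = P2 := by
    rw [hgg, ha]; simp only [Submodule.coe_neg]; module
  have hnn : ∀ v, φ v = 1 → -v ∉ C := by
    intro v hv h
    have := hφ _ h
    rw [map_neg, hv] at this
    linarith
  set K : Set W := {z : W | gg + (z : V) ∈ C} with hK
  have hconv : Convex ℝ K := by
    rw [convex_iff_forall_pos]
    intro x hx y hy r s hr hs hrs
    have := D.addC _ (D.smulC r hr _ hx) _ (D.smulC s hs _ hy)
    change gg + ((r • x + s • y : W) : V) ∈ C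
    convert this using 1
    simp only [Submodule.coe_add, Submodule.coe_smul]
    have : gg = (r + s) • gg := by rw [hrs, one_smul]
    nth_rewrite 1 [this]
    module
  have hcpt : IsCompact K := by
    have hemb : Topology.IsClosedEmbedding (fun z : W => gg + (z : V)) :=
      (Homeomorph.addLeft gg).isClosedEmbedding.comp
        (W.closed_of_finiteDimensional.isClosedEmbedding_subtypeVal)
    have := hemb.isCompact_preimage (D.cpt φ hφ)
    convert this using 1
    ext z
    have : φ (gg + (z : V)) = 1 := by rw [map_add, hφg, (hφW z).2 z.2, add_zero]
    simp [hK, hφg, (hφW z).2 z.2]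
  have hopen : {z : W | gg + (z : V) ∈ Ci} ⊆ interior K := by
    apply interior_maximal
    · intro z hz; exact D.sub hz
    · exact D.opn.preimage (by fun_prop)
  have hP : ∀ l : Submodule ℝ W, finrank ℝ l = n → ∃ u, SecTr K a l u := by
    intro l hl
    obtain ⟨u, ⟨u', hu', rfl⟩, hu⟩ := hZ (l.map W.subtype) (Submodule.map_subtype_le _ _)
      (by rw [Submodule.finrank_map_subtype_eq, hl, hn])
    refine ⟨u', hu', fun z hz => ?_⟩
    have := hu z ⟨z, hz, rfl⟩
    have e1 : φ (P1 + (z : V)) = 1 := by rw [map_add, hφ1, (hφW z).2 z.2, add_zero]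
    have e2 : φ (P2 + (z : V) + (u' : V)) = 1 := by
      rw [map_add, map_add, hφ2, (hφW z).2 z.2, (hφW u').2 u'.2]; simp
    have i1 := hnn _ e1
    have i2 := hnn _ e2
    simp only [Submodule.subtype_apply, i1, i2, or_false] at this
    change gg + ((a + z : W) : V) ∈ C ↔ gg + ((-a + z + u' : W) : V) ∈ C
    rw [Submodule.coe_add, ← add_assoc, hga, Submodule.coe_add, Submodule.coe_add, ← add_assoc,
      ← add_assoc, hga']
    exact this
  have ha0 : a ≠ 0 := by
    intro h0
    apply hne
    have : gg + (a : V) = gg + ((-a : W) : V) := by rw [h0]; simp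
    rwa [hga, hga'] at this
  have hmain := affine_main hconv hcpt ha0 (hopen (by change gg + (a : V) ∈ Ci; rwa [hga]))
    (hopen (by change gg + ((-a : W) : V) ∈ Ci; rwa [hga'])) hn hn2 hP
  intro z hz hzC
  have := hmain ⟨z, hz⟩ hzC
  change gg + ((-⟨z, hz⟩ : W) : V) ∈ C at this
  rw [sub_eq_add_neg]
  exact this

/-- the final harmonic computation, vector version -/
theorem ConeData.opp (D : ConeData C Ci lam) {φ : V →ₗ[ℝ] ℝ} {gg zA zB : V} (hφ1 : φ gg = 1)
    (hg : gg ∈ Ci) (hA : φ zA = 0) (hB : φ zB = 0)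
    (hzA : gg + zA ∈ C) (hzB : gg + zB ∈ C) (hzA' : gg + zA ∉ Ci) (hzB' : gg + zB ∉ Ci)
    (hsA : gg - zA ∈ C) (hsB : gg - zB ∈ C)
    (hne : zA ≠ zB) {α β : ℝ} (hαβ : gg = α • (gg + zA) + β • (gg + zB)) : zB = -zA := by
  have hsum : α + β = 1 := by
    have := congrArg φ hαβ
    simp [hφ1, hA, hB] at this
    linarith
  have h0 : α • zA + β • zB = 0 := by
    have h3 : gg = (α + β) • gg + (α • zA + β • zB) := by
      nth_rewrite 1 [hαβ]
      module
    rw [hsum, one_smul] at h3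
    simpa using h3
  -- scaling lemma
  have hsc : ∀ z, gg + z ∈ C → ∀ s : ℝ, 0 ≤ s → s < 1 → gg + s • z ∈ Ci := by
    intro z hz s hs hs1
    rcases hs.eq_or_lt with rfl | hs
    · simpa using hg
    · have := D.addI _ (D.smulC s hs _ hz) _ (D.smulI (1 - s) (by linarith) _ hg)
      convert this using 1
      module
  have hsc' : ∀ z, gg + z ∈ C → gg - z ∈ C → ∀ s : ℝ, |s| < 1 → gg + s • z ∈ Ci := by
    intro z hz hz' s hs
    rcases le_total 0 s with h | h
    · exact hsc z hz s h (by rwa [abs_of_nonneg h] at hs)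
    · have := hsc (-z) (by rwa [← sub_eq_add_neg]) (-s) (by linarith)
        (by rwa [abs_of_nonpos h] at hs)
      simpa using this
  have hzA0 : zA ≠ 0 := by rintro rfl; apply hzA'; simpa using hg
  have hzB0 : zB ≠ 0 := by rintro rfl; apply hzB'; simpa using hg
  have hβ : β ≠ 0 := by
    rintro rfl
    have : α = 1 := by linarith
    rw [this] at h0
    apply hzA0
    simpa using h0
  have hα : α ≠ 0 := by
    rintro rfl
    have : β = 1 := by linarith
    rw [this] at h0
    apply hzB0
    simpa using h0
  have hBk : zB = (-(α / β)) • zA := by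
    have : β⁻¹ • (α • zA + β • zB) = 0 := by rw [h0, smul_zero]
    rw [smul_add, smul_smul, smul_smul, inv_mul_cancel₀ hβ, one_smul] at this
    rw [eq_neg_of_add_eq_zero_right this, ← neg_smul]
    congr 1
    field_simp
  set k := -(α / β) with hk
  have hk0 : k ≠ 0 := by
    rw [hk]; exact neg_ne_zero.2 (div_ne_zero hα hβ)
  have hAk : zA = k⁻¹ • zB := by rw [hBk, smul_smul, inv_mul_cancel₀ hk0, one_smul]
  rcases lt_trichotomy |k| 1 with h | h | h
  · exact absurd (by rw [hBk]; exact hsc' zA hzA hsA k h) hzB'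
  · rcases abs_eq (zero_le_one) |>.1 h with h | h
    · rw [h, one_smul] at hBk
      exact absurd hBk.symm hne
    · rw [h] at hBk
      simpa using hBk
  · exact absurd (by rw [hAk]; exact hsc' zB hzB hsB k⁻¹ (by
      rw [abs_inv]; exact inv_lt_one_of_one_lt₀ h)) hzA'

end ConePart2


section Concrete

variable {d : ℕ}

/-- the homogeneous lift of a point of the chart -/
def liftC (e : PV d ≃ₗ[ℝ] PV d) (x : Fin d → ℝ) : PV d := e (Fin.snoc x 1)

/-- the height functional of the chart -/
def lamC (e : PV d ≃ₗ[ℝ] PV d) : PV d →ₗ[ℝ] ℝ :=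
  (LinearMap.proj (Fin.last d)) ∘ₗ (e.symm : PV d →ₗ[ℝ] PV d)

/-- chart coordinates of a vector -/
def coordC (e : PV d ≃ₗ[ℝ] PV d) (v : PV d) : Fin d → ℝ :=
  fun i => e.symm v i.castSucc / lamC e v

/-- cone over a subset of the chart -/
def coneC (e : PV d ≃ₗ[ℝ] PV d) (S : Set (Fin d → ℝ)) : Set (PV d) :=
  {v | 0 < lamC e v ∧ coordC e v ∈ S}

theorem lamC_lift (e : PV d ≃ₗ[ℝ] PV d) (x : Fin d → ℝ) : lamC e (liftC e x) = 1 := by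
  simp [lamC, liftC]

theorem coordC_lift (e : PV d ≃ₗ[ℝ] PV d) (x : Fin d → ℝ) {r : ℝ} (hr : r ≠ 0) :
    coordC e (r • liftC e x) = x := by
  funext i
  rw [coordC, map_smul, map_smul, lamC_lift]
  simp [liftC, hr]

theorem lift_coordC (e : PV d ≃ₗ[ℝ] PV d) {v : PV d} (hv : lamC e v ≠ 0) :
    v = lamC e v • liftC e (coordC e v) := by
  apply e.symm.injective
  rw [map_smul]
  funext i
  refine Fin.lastCases ?_ (fun j => ?_) i
  · simp [liftC, lamC]
  · simp [liftC, coordC, mul_div_cancel₀ _ hv]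

theorem mem_coneC_iff (e : PV d ≃ₗ[ℝ] PV d) (S : Set (Fin d → ℝ)) (v : PV d) :
    v ∈ coneC e S ↔ ∃ r : ℝ, 0 < r ∧ ∃ x ∈ S, v = r • liftC e x := by
  constructor
  · rintro ⟨h, hv⟩
    exact ⟨_, h, _, hv, lift_coordC e h.ne'⟩
  · rintro ⟨r, hr, x, hx, rfl⟩
    refine ⟨by rw [map_smul, lamC_lift]; simpa using hr, by rwa [coordC_lift e x hr.ne']⟩

theorem lift_mem_coneC (e : PV d ≃ₗ[ℝ] PV d) {S : Set (Fin d → ℝ)} {x : Fin d → ℝ} (hx : x ∈ S) :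
    liftC e x ∈ coneC e S := (mem_coneC_iff e S _).2 ⟨1, one_pos, x, hx, (one_smul _ _).symm⟩

theorem continuous_liftC (e : PV d ≃ₗ[ℝ] PV d) : Continuous (liftC e) := by
  have h1 : Continuous (e : PV d →ₗ[ℝ] PV d) := LinearMap.continuous_of_finiteDimensional _
  exact h1.comp (Continuous.finSnoc continuous_id continuous_const)

theorem liftC_combo (e : PV d ≃ₗ[ℝ] PV d) (x y : Fin d → ℝ) {r s : ℝ} (h : r + s = 1) :
    liftC e (r • x + s • y) = r • liftC e x + s • liftC e y := by
  unfold liftC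
  rw [← map_smul, ← map_smul, ← map_add]
  congr 1
  funext i
  refine Fin.lastCases ?_ (fun j => ?_) i
  · simp [h]
  · simp

theorem isOpen_coneC (e : PV d ≃ₗ[ℝ] PV d) {S : Set (Fin d → ℝ)} (hS : IsOpen S) :
    IsOpen (coneC e S) := by
  have hl : Continuous (lamC e) := LinearMap.continuous_of_finiteDimensional _
  have he : Continuous (e.symm : PV d →ₗ[ℝ] PV d) := LinearMap.continuous_of_finiteDimensional _
  have h1 : IsOpen {v : PV d | 0 < lamC e v} := isOpen_lt continuous_const hl
  have h2 : ContinuousOn (coordC e) {v : PV d | 0 < lamC e v} := by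
    rw [continuousOn_pi]
    intro i
    refine ContinuousOn.div ?_ hl.continuousOn (fun v hv => ne_of_gt hv)
    exact ((continuous_apply i.castSucc).comp he).continuousOn
  exact h2.isOpen_inter_preimage h1 hS

theorem coneData (e : PV d ≃ₗ[ℝ] PV d) {K₀ : Set (Fin d → ℝ)} (hconv : Convex ℝ K₀)
    (hcpt : IsCompact K₀) : ConeData (coneC e K₀) (coneC e (interior K₀)) (lamC e) where
  sub := fun v hv => ⟨hv.1, interior_subset hv.2⟩
  smulC := by
    intro r hr v hv
    rw [mem_coneC_iff] at hv ⊢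
    obtain ⟨s, hs, x, hx, rfl⟩ := hv
    exact ⟨r * s, by positivity, x, hx, smul_smul _ _ _⟩
  smulI := by
    intro r hr v hv
    rw [mem_coneC_iff] at hv ⊢
    obtain ⟨s, hs, x, hx, rfl⟩ := hv
    exact ⟨r * s, by positivity, x, hx, smul_smul _ _ _⟩
  addC := by
    intro v hv w hw
    rw [mem_coneC_iff] at hv hw ⊢
    obtain ⟨r, hr, x, hx, rfl⟩ := hv
    obtain ⟨s, hs, y, hy, rfl⟩ := hw
    have hrs : r / (r + s) + s / (r + s) = 1 := by field_simp
    refine ⟨r + s, by positivity, (r / (r + s)) • x + (s / (r + s)) • y,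
      hconv hx hy (by positivity) (by positivity) hrs, ?_⟩
    rw [liftC_combo e x y hrs, smul_add, smul_smul, smul_smul, mul_div_cancel₀ _ (by positivity),
      mul_div_cancel₀ _ (by positivity)]
  addI := by
    intro v hv w hw
    rw [mem_coneC_iff] at hv hw ⊢
    obtain ⟨r, hr, x, hx, rfl⟩ := hv
    obtain ⟨s, hs, y, hy, rfl⟩ := hw
    have hrs : r / (r + s) + s / (r + s) = 1 := by field_simp
    refine ⟨r + s, by positivity, (r / (r + s)) • x + (s / (r + s)) • y,
      hconv.combo_self_interior_mem_interior hx hy (by positivity) (by positivity) hrs, ?_⟩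
    rw [liftC_combo e x y hrs, smul_add, smul_smul, smul_smul, mul_div_cancel₀ _ (by positivity),
      mul_div_cancel₀ _ (by positivity)]
  opn := isOpen_coneC e isOpen_interior
  pos := fun v hv => hv.1
  cls := by
    obtain ⟨M, hM⟩ := hcpt.exists_bound_of_continuousOn (continuous_liftC e).continuousOn
    have hl : Continuous (lamC e) := LinearMap.continuous_of_finiteDimensional _
    have hF : IsClosed {v : PV d | ‖v‖ ≤ max M 0 * lamC e v} :=
      isClosed_le continuous_norm (continuous_const.mul hl)
    have hF0 : IsClosed {v : PV d | 0 ≤ lamC e v} := isClosed_le continuous_const hl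
    have hsub : coneC e K₀ ∪ {0} ⊆ {v : PV d | ‖v‖ ≤ max M 0 * lamC e v} := by
      rintro v (hv | hv)
      · obtain ⟨r, hr, x, hx, rfl⟩ := (mem_coneC_iff e _ _).1 hv
        have h1 := (hM x hx).trans (le_max_left M 0)
        simp only [Set.mem_ofPred_eq, map_smul, lamC_lift, smul_eq_mul, mul_one, norm_smul,
          Real.norm_eq_abs, abs_of_pos hr]
        nlinarith
      · rw [hv]; simp
    have hsub0 : coneC e K₀ ∪ {0} ⊆ {v : PV d | 0 ≤ lamC e v} := by
      rintro v (hv | hv)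
      · exact hv.1.le
      · rw [hv]; simp
    refine isClosed_of_closure_subset fun v hv => ?_
    have h1 : ‖v‖ ≤ max M 0 * lamC e v := closure_minimal hsub hF hv
    have h2 : 0 ≤ lamC e v := closure_minimal hsub0 hF0 hv
    rcases h2.eq_or_lt with h | h
    · right
      rw [← h, mul_zero] at h1
      simpa using h1
    · left
      refine ⟨h, ?_⟩
      by_contra hc
      have hU := isOpen_coneC e hcpt.isClosed.isOpen_compl
      obtain ⟨w, hw, hw'⟩ := mem_closure_iff.1 hv _ hU ⟨h, hc⟩
      rcases hw' with hw' | hw'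
      · exact hw.2 hw'.2
      · have := hw.1
        rw [hw', map_zero] at this
        exact lt_irrefl _ this
  cpt := by
    intro χ hχ
    have hχc : Continuous χ := LinearMap.continuous_of_finiteDimensional _
    have h1 : ContinuousOn (fun x => (χ (liftC e x))⁻¹ • liftC e x) K₀ := by
      refine ContinuousOn.smul (ContinuousOn.inv₀ (f := fun x => χ (liftC e x)) ?_ ?_)
        (continuous_liftC e).continuousOn
      · exact (hχc.comp (continuous_liftC e)).continuousOn
      · intro x hx
        exact (hχ _ (lift_mem_coneC e hx)).ne'
    suffices hset : {v | v ∈ coneC e K₀ ∧ χ v = 1} =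
        (fun x => (χ (liftC e x))⁻¹ • liftC e x) '' K₀ by
      rw [hset]
      exact hcpt.image_of_continuousOn h1
    ext v
    constructor
    · rintro ⟨hv, hv1⟩
      obtain ⟨r, hr, x, hx, rfl⟩ := (mem_coneC_iff e _ _).1 hv
      refine ⟨x, hx, ?_⟩
      rw [map_smul, smul_eq_mul] at hv1
      simp only
      rw [← eq_inv_of_mul_eq_one_left hv1]
    · rintro ⟨x, hx, rfl⟩
      have hp := hχ _ (lift_mem_coneC e hx)
      refine ⟨(mem_coneC_iff e _ _).2 ⟨_, inv_pos.2 hp, x, hx, rfl⟩, ?_⟩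
      rw [map_smul, smul_eq_mul, inv_mul_cancel₀ hp.ne']

theorem mk_mem_chart_iff (e : PV d ≃ₗ[ℝ] PV d) (S : Set (Fin d → ℝ)) {v : PV d} (hv : v ≠ 0) :
    Projectivization.mk ℝ v hv ∈ chartMap e '' S ↔ v ∈ coneC e S ∨ -v ∈ coneC e S := by
  constructor
  · rintro ⟨x, hx, h⟩
    obtain ⟨a, ha⟩ := (Projectivization.mk_eq_mk_iff' ℝ _ _ _ _).1 h.symm
    change a • liftC e x = v at ha
    have ha0 : a ≠ 0 := by
      rintro rfl
      apply hv
      rw [← ha, zero_smul]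
    rcases lt_or_gt_of_ne ha0 with h | h
    · right
      exact (mem_coneC_iff e S _).2 ⟨-a, by linarith, x, hx, by rw [← ha, neg_smul]⟩
    · left
      exact (mem_coneC_iff e S _).2 ⟨a, h, x, hx, ha.symm⟩
  · rintro (h | h)
    · obtain ⟨r, hr, x, hx, hvx⟩ := (mem_coneC_iff e S _).1 h
      refine ⟨x, hx, ((Projectivization.mk_eq_mk_iff' ℝ _ _ _ _).2 ⟨r, ?_⟩).symm⟩
      exact hvx.symm
    · obtain ⟨r, hr, x, hx, hvx⟩ := (mem_coneC_iff e S _).1 h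
      refine ⟨x, hx, ((Projectivization.mk_eq_mk_iff' ℝ _ _ _ _).2 ⟨-r, ?_⟩).symm⟩
      change -r • liftC e x = v
      rw [neg_smul, ← hvx, neg_neg]

theorem mk_sub_le {v : PV d} (hv : v ≠ 0) (W : Submodule ℝ (PV d)) :
    (Projectivization.mk ℝ v hv).submodule ≤ W ↔ v ∈ W := by
  rw [Projectivization.submodule_mk, Submodule.span_singleton_le_iff_mem]

theorem exists_functional {W : Submodule ℝ (PV d)} (hW : finrank ℝ W = d) {x : PV d} (hx : x ∉ W) :
    ∃ χ : PV d →ₗ[ℝ] ℝ, χ x = 1 ∧ ∀ v, χ v = 0 ↔ v ∈ W := by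
  obtain ⟨f, hf, hle⟩ := Submodule.exists_le_ker_of_notMem hx
  have hf0 : f ≠ 0 := by rintro rfl; simp at hf
  have h1 := Module.Dual.finrank_ker_add_one_of_ne_zero (f := f) hf0
  have h2 : W = LinearMap.ker f := by
    apply Submodule.eq_of_le_of_finrank_eq hle
    simp at h1
    omega
  refine ⟨(f x)⁻¹ • f, by simp [hf], fun v => ?_⟩
  rw [h2]
  simp [hf]

theorem translation (e : PV d ≃ₗ[ℝ] PV d) (K₀ : Set (Fin d → ℝ)) {WH : Submodule ℝ (PV d)}
    {P1 P2 : PV d} (h1 : P1 ≠ 0) (h2 : P2 ≠ 0) {φ : PV d →ₗ[ℝ] ℝ}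
    (hφ : ∀ v, φ v = 0 ↔ v ∈ WH) (hφ1 : φ P1 = 1) (hφ2 : φ P2 = 1) (hP1 : P1 ∈ coneC e K₀)
    {l : Submodule ℝ (PV d)} (hl : l ≤ WH)
    (hyp : ∃ (Φ : RP d → RP d) (G : Set (RP d)) (τ : RP d),
        IsHarmonicHomology Φ G τ ∧ projSet l ⊆ G ∧ τ ∈ projSet WH ∧
          Φ '' (projSpan (Projectivization.mk ℝ P1 h1) l ∩ chartMap e '' K₀) =
            projSpan (Projectivization.mk ℝ P2 h2) l ∩ chartMap e '' K₀) :
    ∃ u ∈ l, ∀ z ∈ l, (P1 + z ∈ coneC e K₀ ∨ -(P1 + z) ∈ coneC e K₀) ↔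
      (P2 + z + u ∈ coneC e K₀ ∨ -(P2 + z + u) ∈ coneC e K₀) := by
  obtain ⟨Φ, G, τ, ⟨σ, W, t, ht, hWf, rfl, rfl, htW, hσW, hσt, hΦ⟩, hlG, htH, himg⟩ := hyp
  have htWH : t ∈ WH := (mk_sub_le ht WH).1 htH
  have hlW : l ≤ W := by
    intro x hx
    by_cases hx0 : x = 0
    · rw [hx0]; exact W.zero_mem
    · exact (mk_sub_le hx0 W).1 (hlG ((mk_sub_le hx0 l).2 hx))
  have hφσ : ∀ v, φ (σ v) = φ v := by
    intro v
    obtain ⟨χ, hχt, hχ⟩ := exists_functional hWf htW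
    have hw : v - χ v • t ∈ W := by
      rw [← hχ, map_sub, map_smul, hχt]; simp
    have h3 := hσW _ hw
    rw [map_sub, map_smul, hσt] at h3
    have h4 := congrArg φ h3
    rw [map_sub, map_sub, map_smul, map_smul, map_neg, (hφ t).2 htWH] at h4
    simpa using h4
  have hz0 : ∀ z ∈ l, φ z = 0 := fun z hz => (hφ z).2 (hl hz)
  have hne1 : ∀ z ∈ l, P1 + z ≠ 0 := by
    intro z hz h0
    have := congrArg φ h0
    rw [map_add, hφ1, hz0 z hz, map_zero] at this
    norm_num at this
  have hne2 : ∀ z ∈ l, P2 + z ≠ 0 := by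
    intro z hz h0
    have := congrArg φ h0
    rw [map_add, hφ2, hz0 z hz, map_zero] at this
    norm_num at this
  have hsp : ∀ (P : PV d) (hP : P ≠ 0), ∀ z ∈ l, ∀ (hPz : P + z ≠ 0),
      Projectivization.mk ℝ (P + z) hPz ∈ projSpan (Projectivization.mk ℝ P hP) l := by
    intro P hP z hz hPz
    refine (mk_sub_le hPz _).2 ?_
    rw [Projectivization.submodule_mk]
    exact Submodule.add_mem _ (Submodule.mem_sup_right (Submodule.mem_span_singleton_self P))
      (Submodule.mem_sup_left hz)
  have hfwd : ∀ z ∈ l, (P1 + z ∈ coneC e K₀ ∨ -(P1 + z) ∈ coneC e K₀) →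
      σ (P1 + z) ∈ l ⊔ Submodule.span ℝ {P2} ∧
        (σ (P1 + z) ∈ coneC e K₀ ∨ -(σ (P1 + z)) ∈ coneC e K₀) := by
    intro z hz hzK
    obtain ⟨hv', hΦv⟩ := hΦ _ (hne1 z hz)
    have h3 : Φ (Projectivization.mk ℝ (P1 + z) (hne1 z hz)) ∈
        projSpan (Projectivization.mk ℝ P2 h2) l ∩ chartMap e '' K₀ := by
      rw [← himg]
      exact ⟨_, ⟨hsp P1 h1 z hz _, (mk_mem_chart_iff e K₀ _).2 hzK⟩, rfl⟩
    rw [hΦv] at h3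
    refine ⟨?_, (mk_mem_chart_iff e K₀ _).1 h3.2⟩
    have h4 := (mk_sub_le hv' _).1 h3.1
    rwa [Projectivization.submodule_mk] at h4
  obtain ⟨u, hu, hσP⟩ : ∃ u ∈ l, σ P1 = P2 + u := by
    have h3 := (hfwd 0 l.zero_mem (by left; simpa using hP1)).1
    rw [add_zero] at h3
    obtain ⟨u, hu, w, hw, huw⟩ := Submodule.mem_sup.1 h3
    obtain ⟨c, rfl⟩ := Submodule.mem_span_singleton.1 hw
    have h4 := congrArg φ huw
    rw [hφσ, map_add, hz0 u hu, map_smul, hφ1, hφ2] at h4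
    have hc : c = 1 := by simpa using h4
    refine ⟨u, hu, ?_⟩
    rw [← huw, hc, one_smul, add_comm]
  have hσz : ∀ z ∈ l, σ (P1 + z) = P2 + z + u := by
    intro z hz
    rw [map_add, hσP, hσW z (hlW hz)]
    abel
  refine ⟨u, hu, fun z hz => ⟨fun h => ?_, fun h => ?_⟩⟩
  · rw [← hσz z hz]
    exact (hfwd z hz h).2
  · have hzu : P2 + (z + u) ≠ 0 := hne2 _ (l.add_mem hz hu)
    have h3 : Projectivization.mk ℝ (P2 + (z + u)) hzu ∈
        Φ '' (projSpan (Projectivization.mk ℝ P1 h1) l ∩ chartMap e '' K₀) := by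
      rw [himg]
      refine ⟨hsp P2 h2 _ (l.add_mem hz hu) _, (mk_mem_chart_iff e K₀ _).2 ?_⟩
      rwa [← add_assoc]
    obtain ⟨x, hx, hxe⟩ := h3
    induction x using Projectivization.ind with
    | h v hv =>
      obtain ⟨hv', hΦv⟩ := hΦ v hv
      rw [hΦv] at hxe
      obtain ⟨r, hr⟩ := (Projectivization.mk_eq_mk_iff' ℝ _ _ _ _).1 hxe.symm
      rw [← add_assoc, ← hσz z hz, ← map_smul] at hr
      have h5 := σ.injective hr
      rw [← mk_mem_chart_iff e K₀ (hne1 z hz)]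
      have h6 : Projectivization.mk ℝ (P1 + z) (hne1 z hz) = Projectivization.mk ℝ v hv :=
        (Projectivization.mk_eq_mk_iff' ℝ _ _ _ _).2 ⟨r, h5⟩
      rw [h6]
      exact hx.2

theorem mem_projLine_mk {v a b : PV d} (hv : v ≠ 0) (ha : a ≠ 0) (hb : b ≠ 0)
    (h : Projectivization.mk ℝ v hv ∈
      projLine (Projectivization.mk ℝ a ha) (Projectivization.mk ℝ b hb)) :
    ∃ α β : ℝ, v = α • a + β • b := by
  have h1 := (mk_sub_le hv _).1 h
  rw [Projectivization.submodule_mk, Projectivization.submodule_mk] at h1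
  obtain ⟨x, hx, y, hy, hxy⟩ := Submodule.mem_sup.1 h1
  obtain ⟨α, rfl⟩ := Submodule.mem_span_singleton.1 hx
  obtain ⟨β, rfl⟩ := Submodule.mem_span_singleton.1 hy
  exact ⟨α, β, hxy.symm⟩

/-- normalized representative of a boundary point -/
theorem frontier_rep (e : PV d ≃ₗ[ℝ] PV d) {K₀ : Set (Fin d → ℝ)} (hcpt : IsCompact K₀)
    {φ : PV d →ₗ[ℝ] ℝ} (hφ : ∀ v ∈ coneC e K₀, 0 < φ v) {A : RP d}
    (hA : A ∈ chartFrontier e K₀) :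
    ∃ (v : PV d) (hv : v ≠ 0), A = Projectivization.mk ℝ v hv ∧ v ∈ coneC e K₀ ∧
      v ∉ coneC e (interior K₀) ∧ φ v = 1 := by
  obtain ⟨x, hx, rfl⟩ := hA
  have hxK : x ∈ K₀ := hcpt.isClosed.frontier_subset hx
  have hp := hφ _ (lift_mem_coneC e hxK)
  have hr : (φ (liftC e x))⁻¹ ≠ 0 := inv_ne_zero hp.ne'
  have h1 : φ ((φ (liftC e x))⁻¹ • liftC e x) = 1 := by
    rw [map_smul, smul_eq_mul, inv_mul_cancel₀ hp.ne']
  have h0 : (φ (liftC e x))⁻¹ • liftC e x ≠ 0 := by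
    intro h
    rw [h, map_zero] at h1
    norm_num at h1
  refine ⟨(φ (liftC e x))⁻¹ • liftC e x, h0, ?_, ?_, ?_, h1⟩
  · refine ((Projectivization.mk_eq_mk_iff' ℝ _ _ _ _).2 ⟨_, rfl⟩).symm
  · exact (mem_coneC_iff e _ _).2 ⟨_, inv_pos.2 hp, x, hxK, rfl⟩
  · rintro ⟨-, h⟩
    rw [coordC_lift e x hr] at h
    exact hx.2 h

/-- representatives of a harmonic quadruple with the first one in the interior cone -/
theorem harmonic_reps (e : PV d ≃ₗ[ℝ] PV d) (S : Set (Fin d → ℝ)) {p₁ p₂ g h : RP d}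
    (hgh : HarmonicQuad p₁ p₂ g h) (hp₁ : p₁ ∈ chartMap e '' S) :
    ∃ (a b : PV d) (ha : a ≠ 0) (hb : b ≠ 0) (hab : a + b ≠ 0) (hab' : a - b ≠ 0),
      p₁ = Projectivization.mk ℝ a ha ∧ p₂ = Projectivization.mk ℝ b hb ∧
      g = Projectivization.mk ℝ (a + b) hab ∧ h = Projectivization.mk ℝ (a - b) hab' ∧
      a ∈ coneC e S := by
  obtain ⟨a, b, ha, hb, hab, hab', rfl, rfl, rfl, rfl⟩ := hgh
  rcases (mk_mem_chart_iff e S ha).1 hp₁ with h | h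
  · exact ⟨a, b, ha, hb, hab, hab', rfl, rfl, rfl, rfl, h⟩
  · refine ⟨-a, -b, neg_ne_zero.2 ha, neg_ne_zero.2 hb, ?_, ?_, ?_, ?_, ?_, ?_, h⟩
    · rw [← neg_add]; exact neg_ne_zero.2 hab
    · rw [neg_sub_neg, ← neg_sub]; exact neg_ne_zero.2 hab'
    · exact (Projectivization.mk_eq_mk_iff' ℝ _ _ _ _).2 ⟨-1, by simp⟩
    · exact (Projectivization.mk_eq_mk_iff' ℝ _ _ _ _).2 ⟨-1, by simp⟩
    · exact (Projectivization.mk_eq_mk_iff' ℝ _ _ _ _).2 ⟨-1, by module⟩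
    · exact (Projectivization.mk_eq_mk_iff' ℝ _ _ _ _).2 ⟨-1, by module⟩

end Concrete


theorem pole_of_harmonic_homologies {d : ℕ} (hd : 3 ≤ d)
    -- `K` is a convex body lying in an affine chart of `ℝP^d`
    (e : PV d ≃ₗ[ℝ] PV d) (K₀ : Set (Fin d → ℝ))
    (hconv : Convex ℝ K₀) (hcpt : IsCompact K₀) (hint : (interior K₀).Nonempty)
    (K : Set (RP d)) (hK : K = chartMap e '' K₀)
    -- `H` is a hyperplane of `ℝP^d` which is not a support hyperplane of `K`
    (H : Set (RP d)) (WH : Submodule ℝ (PV d)) (hWH : Module.finrank ℝ WH = d)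
    (hH : H = projSet WH) (hsupp : ¬ IsSupportHyperplane e K₀ H)
    -- `p₁ ≠ p₂` are interior points of `K` not lying on `H`
    (p₁ p₂ : RP d) (hp₁ : p₁ ∈ chartMap e '' interior K₀)
    (hp₂ : p₂ ∈ chartMap e '' interior K₀) (hne : p₁ ≠ p₂)
    (hp₁H : p₁ ∉ H) (hp₂H : p₂ ∉ H)
    -- for every `(d-2)`-dimensional projective plane `l ⊆ H` there is a harmonic
    -- homology with hyperplane `G ⊇ l` and center `τ ∈ H` mapping `aff{p₁,l} ∩ K`
    -- onto `aff{p₂,l} ∩ K`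
    (hyp : ∀ Wl : Submodule ℝ (PV d), Module.finrank ℝ Wl = d - 1 → projSet Wl ⊆ H →
      ∃ (Φ : RP d → RP d) (G : Set (RP d)) (τ : RP d),
        IsHarmonicHomology Φ G τ ∧ projSet Wl ⊆ G ∧ τ ∈ H ∧
          Φ '' (projSpan p₁ Wl ∩ K) = projSpan p₂ Wl ∩ K)
    -- `h = L(p₁,p₂) ∩ H` and `g` is the point of `L(p₁,p₂)` with `[p₁,p₂;g,h] = -1`
    (h g : RP d) (hhline : h ∈ projLine p₁ p₂) (hhH : h ∈ H)
    (hgline : g ∈ projLine p₁ p₂) (hgh : HarmonicQuad p₁ p₂ g h) :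
    IsPoleOf (chartFrontier e K₀) g H := by
  subst hK hH
  obtain ⟨a, b, ha, hb, hab, hab', rfl, rfl, rfl, rfl, haI⟩ :=
    harmonic_reps e (interior K₀) hgh hp₁
  have D := coneData e hconv hcpt
  have habW : a - b ∈ WH := (mk_sub_le hab' WH).1 hhH
  have haW : a ∉ WH := fun h' => hp₁H ((mk_sub_le ha WH).2 h')
  obtain ⟨φ, hφa, hφ⟩ := exists_functional hWH haW
  have hφb : φ b = 1 := by
    have := (hφ _).2 habW
    rw [map_sub, hφa] at this
    linarith
  have hneab : a ≠ b := sub_ne_zero.1 hab'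
  have hZ : ∀ l : Submodule ℝ (PV d), l ≤ WH → finrank ℝ l + 1 = finrank ℝ WH →
      ∃ u ∈ l, ∀ z ∈ l, (a + z ∈ coneC e K₀ ∨ -(a + z) ∈ coneC e K₀) ↔
        (b + z + u ∈ coneC e K₀ ∨ -(b + z + u) ∈ coneC e K₀) := by
    intro l hl hlf
    exact translation e K₀ ha hb hφ hφa hφb (D.sub haI) hl
      (hyp l (by omega) (fun x hx => le_trans hx hl))
  have hbI : b ∈ coneC e (interior K₀) := by
    rcases (mk_mem_chart_iff e _ hb).1 hp₂ with h' | h'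
    · exact h'
    · exact (D.caseA (by omega) haI h' habW hZ).elim
  have hmiss : ∀ c ∈ coneC e (interior K₀), c ∉ WH := fun c hc hcW =>
    D.caseB (by omega) haI hbI habW hneab hc hcW hZ
  have hmiss' : ∀ c ∈ coneC e K₀, c ∉ WH := by
    intro c hc hcW
    apply hsupp
    have hc0 : c ≠ 0 := by
      rintro rfl
      have := D.pos _ hc
      simp at this
    refine ⟨⟨Projectivization.mk ℝ c hc0, (mk_sub_le hc0 WH).2 hcW,
      (mk_mem_chart_iff e _ hc0).2 (Or.inl hc)⟩, ?_⟩
    rw [Set.eq_empty_iff_forall_notMem]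
    rintro x ⟨hx1, hx2⟩
    induction x using Projectivization.ind with
    | h v hv =>
      have hvW : v ∈ WH := (mk_sub_le hv WH).1 hx1
      rcases (mk_mem_chart_iff e _ hv).1 hx2 with h' | h'
      · exact hmiss _ h' hvW
      · exact hmiss _ h' (WH.neg_mem hvW)
  have hpos : ∀ v ∈ coneC e K₀, 0 < φ v := by
    intro v hv
    by_contra hcon
    rcases (not_lt.1 hcon).eq_or_lt with h' | h'
    · exact hmiss' v hv ((hφ v).1 h')
    · refine hmiss' (a + (-(φ v))⁻¹ • v)
        (D.addC _ (D.sub haI) _ (D.smulC _ (inv_pos.2 (by linarith)) _ hv)) ((hφ _).1 ?_)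
      rw [map_add, map_smul, hφa, smul_eq_mul, inv_neg, neg_mul, inv_mul_cancel₀ h'.ne]
      norm_num
  have hsym := D.caseII (W := WH) (n := d - 1) (by omega) (by omega) haI hbI hneab hφ hpos hφa hφb hZ
  set gg : PV d := (1 / 2 : ℝ) • (a + b) with hgg
  have hgI : gg ∈ coneC e (interior K₀) :=
    D.smulI _ (by norm_num) _ (D.addI _ (D.sub haI) _ hbI)
  have hφg : φ gg = 1 := by rw [hgg, map_smul, map_add, hφa, hφb]; norm_num
  intro A B q hA hB hAB hgl hql hqH
  obtain ⟨vA, hvA, rfl, hAC, hAI, hAφ⟩ := frontier_rep e hcpt hpos hA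
  obtain ⟨vB, hvB, rfl, hBC, hBI, hBφ⟩ := frontier_rep e hcpt hpos hB
  have hvne : vA ≠ vB := by
    rintro rfl
    exact hAB rfl
  obtain ⟨α, β, hαβ⟩ := mem_projLine_mk hab hvA hvB hgl
  have eA : gg + (vA - gg) = vA := by abel
  have eB : gg + (vB - gg) = vB := by abel
  have fA : φ (vA - gg) = 0 := by rw [map_sub, hAφ, hφg, sub_self]
  have fB : φ (vB - gg) = 0 := by rw [map_sub, hBφ, hφg, sub_self]
  have hopp := D.opp (φ := φ) (gg := gg) (zA := vA - gg) (zB := vB - gg) hφg hgI fA fB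
    (by rwa [eA]) (by rwa [eB]) (by rwa [eA]) (by rwa [eB])
    (hsym _ ((hφ _).1 fA) (by rwa [eA])) (hsym _ ((hφ _).1 fB) (by rwa [eB]))
    (fun h' => hvne (sub_left_injective h')) (α := 1 / 2 * α) (β := 1 / 2 * β)
    (by rw [eA, eB, hgg, hαβ]; module)
  have hsum : vA + vB = a + b := by
    have h1 : vA + vB = (2 : ℝ) • gg := by
      have : vB = gg + -(vA - gg) := by rw [← hopp]; abel
      rw [this]
      module
    rw [h1, hgg, smul_smul]
    norm_num
  refine ⟨vA, vB, hvA, hvB, by rw [hsum]; exact hab, sub_ne_zero.2 hvne, rfl, rfl, ?_, ?_⟩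
  · congr 1
    exact hsum.symm
  · induction q using Projectivization.ind with
    | h w hw =>
      obtain ⟨r, s, hrs⟩ := mem_projLine_mk hw hvA hvB hql
      have hwW : φ w = 0 := (hφ w).2 ((mk_sub_le hw WH).1 hqH)
      have hr : s = -r := by
        rw [hrs, map_add, map_smul, map_smul, hAφ, hBφ] at hwW
        simp at hwW
        linarith
      refine (Projectivization.mk_eq_mk_iff' ℝ _ _ _ _).2 ⟨r, ?_⟩
      rw [hrs, hr]
      module
end
end

section
/- Let d ≥ 3, let K be a convex body contained in an affine chart of ℝP^d, let H ⊂ ℝP^d be a hyperplane which is not a support hyperplane of K, and let p₁, p₂ be two distinct interior points of K with p₁, p₂ ∉ H. Suppose that for every (d−2)-dimensional projective plane l ⊂ H there exists a harmonic homology Φ_G^τ with hyperplane G and center τ such that l ⊂ G, τ ∈ H, and Φ_G^τ(aff{p₁, l} ∩ K) = aff{p₂, l} ∩ K. Then, for each i ∈ {1,2}, the point pᵢ is a false pole of K with respect to the hyperplane H. -/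
noncomputable section

open Set Module

lemma fp_mem_iff_gauge {E : Type*} [NormedAddCommGroup E] [NormedSpace ℝ E] {D : Set E}
    (hc : Convex ℝ D) (hcl : IsClosed D) (h0 : (0:E) ∈ interior D) (x : E) :
    x ∈ D ↔ gauge D x ≤ 1 := by
  rw [gauge_le_one_iff_mem_closure hc (mem_interior_iff_mem_nhds.1 h0), hcl.closure_eq]

lemma fp_gauge_pos {E : Type*} [NormedAddCommGroup E] [NormedSpace ℝ E] {D : Set E}
    (hk : IsCompact D) (h0 : (0:E) ∈ interior D) {x : E} (hx : x ≠ 0) :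
    0 < gauge D x := by
  rw [gauge_pos (absorbent_nhds_zero (mem_interior_iff_mem_nhds.1 h0))]
  · exact hx
  · exact NormedSpace.isVonNBounded_of_isBounded ℝ hk.isBounded

lemma fp_smul_mem {E : Type*} [NormedAddCommGroup E] [NormedSpace ℝ E] {D : Set E}
    (hc : Convex ℝ D) (hk : IsCompact D) (h0 : (0:E) ∈ interior D) {u : E} (hu : u ≠ 0) (s : ℝ) :
    s • u ∈ D ↔ -(gauge D (-u))⁻¹ ≤ s ∧ s ≤ (gauge D u)⁻¹ := by
  have h1 := fp_gauge_pos hk h0 hu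
  have h2 := fp_gauge_pos hk h0 (neg_ne_zero.2 hu)
  rw [fp_mem_iff_gauge hc hk.isClosed h0]
  have i1 := inv_pos.2 h1
  have i2 := inv_pos.2 h2
  rcases le_total 0 s with hs | hs
  · rw [gauge_smul_of_nonneg hs, smul_eq_mul, ← le_div_iff₀ h1, one_div]
    constructor
    · intro h; exact ⟨by linarith, h⟩
    · exact fun h => h.2
  · have : s • u = (-s) • (-u) := by simp
    rw [this, gauge_smul_of_nonneg (by linarith), smul_eq_mul, ← le_div_iff₀ h2, one_div]
    constructor
    · intro h; exact ⟨by linarith, by linarith⟩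
    · intro h; linarith [h.1]

lemma fp_interval_rel {E : Type*} [NormedAddCommGroup E] [NormedSpace ℝ E] {D₁ D₂ : Set E}
    (hc₁ : Convex ℝ D₁) (hk₁ : IsCompact D₁) (h₁ : (0:E) ∈ interior D₁)
    (hc₂ : Convex ℝ D₂) (hk₂ : IsCompact D₂) (h₂ : (0:E) ∈ interior D₂)
    {u : E} (hu : u ≠ 0) (s₀ : ℝ) (h : ∀ s : ℝ, s • u ∈ D₁ ↔ (s + s₀) • u ∈ D₂) :
    (gauge D₁ u)⁻¹ + s₀ = (gauge D₂ u)⁻¹ ∧ -(gauge D₁ (-u))⁻¹ + s₀ = -(gauge D₂ (-u))⁻¹ := by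
  have a1 := inv_pos.2 (fp_gauge_pos hk₁ h₁ hu)
  have a2 := inv_pos.2 (fp_gauge_pos hk₁ h₁ (neg_ne_zero.2 hu))
  have b1 := inv_pos.2 (fp_gauge_pos hk₂ h₂ hu)
  have b2 := inv_pos.2 (fp_gauge_pos hk₂ h₂ (neg_ne_zero.2 hu))
  simp only [fp_smul_mem hc₁ hk₁ h₁ hu, fp_smul_mem hc₂ hk₂ h₂ hu] at h
  have e1 := (h (gauge D₁ u)⁻¹).1 ⟨by linarith, le_rfl⟩
  have e2 := (h (-(gauge D₁ (-u))⁻¹)).1 ⟨le_rfl, by linarith⟩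
  have e3 := (h ((gauge D₂ u)⁻¹ - s₀)).2 (by constructor <;> linarith)
  have e4 := (h (-(gauge D₂ (-u))⁻¹ - s₀)).2 (by constructor <;> linarith)
  constructor <;> linarith [e1.1, e1.2, e2.1, e2.2, e3.1, e3.2, e4.1, e4.2]

/-- Planar lemma. -/
lemma fp_planar {D : Set (ℝ × ℝ)} (hc : Convex ℝ D) (hk : IsCompact D) {a : ℝ} (ha : 0 < a)
    (h0 : (0 : ℝ × ℝ) ∈ interior D) (h1 : ((a, 0) : ℝ × ℝ) ∈ interior D)
    (hyp : ∀ α : ℝ, ∃ s₀ : ℝ, ∀ s : ℝ, s • ((α, 1) : ℝ × ℝ) ∈ D ↔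
      ((a, 0) : ℝ × ℝ) + (s + s₀) • ((α, 1) : ℝ × ℝ) ∈ D) (t : ℝ) :
    ((a - t, 0) : ℝ × ℝ) ∈ D → ((t, 0) : ℝ × ℝ) ∈ D := by
  set p : ℝ × ℝ := (a, 0) with hp
  set D' : Set (ℝ × ℝ) := (fun x => p + x) ⁻¹' D with hD'
  have hc' : Convex ℝ D' := hc.translate_preimage_right p
  have hk' : IsCompact D' := (Homeomorph.addLeft p).isCompact_preimage.2 hk
  have h1' : (0 : ℝ × ℝ) ∈ interior D' := by
    rw [mem_interior_iff_mem_nhds] at h1 ⊢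
    apply ContinuousAt.preimage_mem_nhds (by fun_prop)
    simpa using h1
  have cg : Continuous (gauge D) := continuous_gauge hc (mem_interior_iff_mem_nhds.1 h0)
  have cg' : Continuous (gauge D') := continuous_gauge hc' (mem_interior_iff_mem_nhds.1 h1')
  let F : ℝ × ℝ → ℝ := fun x => gauge D x - gauge D' (-x)
  have cF : Continuous F := by fun_prop
  have hFs : ∀ (s : ℝ) (x : ℝ × ℝ), 0 ≤ s → F (s • x) = s * F x := by
    intro s x hs
    simp only [F, ← smul_neg, gauge_smul_of_nonneg hs, smul_eq_mul]
    ring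
  -- consequences of the translation relation
  have key : ∀ (u : ℝ × ℝ), u ≠ 0 → (∃ s₀ : ℝ, ∀ s : ℝ, s • u ∈ D ↔ (s + s₀) • u ∈ D') →
      (gauge D u)⁻¹ - (gauge D' (-u))⁻¹ = (gauge D' u)⁻¹ - (gauge D (-u))⁻¹ := by
    rintro u hu ⟨s₀, h⟩
    have := fp_interval_rel hc hk h0 hc' hk' h1' hu s₀ h
    linarith [this.1, this.2]
  have he : ((1, 0) : ℝ × ℝ) ≠ 0 := by simp
  have hu : ∀ α : ℝ, ((α, 1) : ℝ × ℝ) ≠ 0 := by intro α; simp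
  have keye := key (1, 0) he ⟨-a, fun s => by simp [hD', hp]⟩
  have keyu : ∀ α : ℝ, _ := fun α => key (α, 1) (hu α) (hyp α)
  have step : ∀ α : ℝ, F (α, 1) = 0 → ∃ β > α, F (β, 1) = 0 := by
    intro α hα
    set u : ℝ × ℝ := (α, 1) with hudef
    have hu0 := hu α
    have k1 := keyu α
    have g1 := fp_gauge_pos hk h0 hu0
    have g2 := fp_gauge_pos hk' h1' hu0
    have hα' : gauge D u = gauge D' (-u) := by simpa [F, sub_eq_zero] using hα
    rw [← hudef, hα', sub_self, eq_comm, sub_eq_zero, inv_inj] at k1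
    set h := (gauge D' u)⁻¹ with hh
    have hpos : 0 < h := inv_pos.2 g2
    refine ⟨α + a / h, by have := div_pos ha hpos; linarith, ?_⟩
    have e1 : h • ((α + a / h, 1) : ℝ × ℝ) = p + h • u := by
      simp only [hp, hudef, Prod.smul_mk, Prod.mk_add_mk, smul_eq_mul]
      ext
      · simp; field_simp; ring
      · simp
    -- `p + h u` is on the frontier of `D`
    have f1 : h • u ∈ frontier D' := by
      rw [← gauge_eq_one_iff_mem_frontier hc' (mem_interior_iff_mem_nhds.1 h1'),
        gauge_smul_of_nonneg hpos.le, smul_eq_mul, hh, inv_mul_cancel₀ g2.ne']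
    have f2 : h • (-u) ∈ frontier D := by
      rw [← gauge_eq_one_iff_mem_frontier hc (mem_interior_iff_mem_nhds.1 h0),
        gauge_smul_of_nonneg hpos.le, smul_eq_mul, hh, ← k1, inv_mul_cancel₀ g2.ne']
    have hfr : frontier D' = (fun x => p + x) ⁻¹' frontier D :=
      ((Homeomorph.addLeft p).preimage_frontier D).symm
    have f1' : p + h • u ∈ frontier D := by rw [hfr] at f1; exact f1
    have f2' : -(p + h • u) ∈ frontier D' := by
      rw [hfr]
      show p + -(p + h • u) ∈ frontier D
      rw [smul_neg] at f2
      simpa using f2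
    have : F (h • ((α + a / h, 1) : ℝ × ℝ)) = 0 := by
      rw [e1]
      simp only [F]
      rw [(gauge_eq_one_iff_mem_frontier hc (mem_interior_iff_mem_nhds.1 h0)).2 f1',
        (gauge_eq_one_iff_mem_frontier hc' (mem_interior_iff_mem_nhds.1 h1')).2 f2', sub_self]
    rw [hFs _ _ hpos.le] at this
    exact (mul_eq_zero.1 this).resolve_left hpos.ne'
  -- signs on the axis
  have p1 := fp_gauge_pos hk h0 he
  have p2 := fp_gauge_pos hk' h1' (neg_ne_zero.2 he)
  have p3 := fp_gauge_pos hk' h1' he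
  have p4 := fp_gauge_pos hk h0 (neg_ne_zero.2 he)
  have hF1 : F (1, 0) = gauge D (1, 0) - gauge D' (-(1, 0)) := rfl
  have hF2 : F (-(1, 0)) = gauge D (-(1, 0)) - gauge D' (1, 0) := by simp [F]
  have sgn1 : 0 < F (1, 0) → F (-(1, 0)) < 0 := by
    intro h
    rw [hF1, sub_pos, ← inv_lt_inv₀ p1 p2] at h
    rw [hF2, sub_neg, ← inv_lt_inv₀ p3 p4]
    linarith
  have sgn2 : F (1, 0) < 0 → 0 < F (-(1, 0)) := by
    intro h
    rw [hF1, sub_neg, ← inv_lt_inv₀ p2 p1] at h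
    rw [hF2, sub_pos, ← inv_lt_inv₀ p4 p3]
    linarith
  have sgn0 : F (1, 0) = 0 → F (-(1, 0)) = 0 := by
    intro h
    rw [hF1, sub_eq_zero] at h
    rw [hF2, sub_eq_zero, ← inv_inj]
    rw [h] at keye
    linarith
  -- asymptotics
  have asym : ∀ c : ℝ, 0 < c * F (1, 0) → c * F (-(1, 0)) < 0 → False := by
    intro c hpos hneg
    have t1 : ∀ᶠ y in nhds (0:ℝ), 0 < c * F (1, y) := by
      have : ContinuousAt (fun y : ℝ => c * F (1, y)) 0 := by fun_prop
      exact this.eventually (lt_mem_nhds hpos)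
    have t2 : ∀ᶠ y in nhds (0:ℝ), c * F (-1, y) < 0 := by
      have : ContinuousAt (fun y : ℝ => c * F (-1, y)) 0 := by fun_prop
      apply this.eventually (gt_mem_nhds _)
      simpa using hneg
    obtain ⟨ε, hε, H⟩ := Metric.eventually_nhds_iff.1 (t1.and t2)
    have big : ∀ A : ℝ, 1 / ε < A → 0 < c * F (A, 1) ∧ c * F (-A, 1) < 0 := by
      intro A hA
      have hA0 : 0 < A := lt_trans (by positivity) hA
      have hd : dist A⁻¹ 0 < ε := by
        rw [Real.dist_eq, sub_zero, abs_of_pos (inv_pos.2 hA0)]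
        rw [one_div] at hA
        exact inv_lt_of_inv_lt₀ hε hA
      obtain ⟨q1, q2⟩ := H hd
      have e1 : ((A, 1) : ℝ × ℝ) = A • ((1, A⁻¹) : ℝ × ℝ) := by simp [hA0.ne']
      have e2 : ((-A, 1) : ℝ × ℝ) = A • ((-1, A⁻¹) : ℝ × ℝ) := by simp [hA0.ne']
      rw [e1, e2, hFs _ _ hA0.le, hFs _ _ hA0.le]
      constructor
      · have := mul_pos hA0 q1; linarith
      · have := mul_neg_of_pos_of_neg hA0 q2; linarith
    set A := 1 / ε + 1 with hA
    have hA0 : 0 < A := by positivity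
    have cG : Continuous (fun α : ℝ => c * F (α, 1)) := by fun_prop
    have ivt := intermediate_value_Icc (show -A ≤ A by linarith) cG.continuousOn
    obtain ⟨α₀, hα₀, hz⟩ := ivt (show (0:ℝ) ∈ _ from
      ⟨(big A (by linarith)).2.le, (big A (by linarith)).1.le⟩)
    have hc0 : c ≠ 0 := by rintro rfl; simp at hpos
    let Z : Set ℝ := Icc (-A) A ∩ (fun α : ℝ => c * F (α, 1)) ⁻¹' {0}
    have hZ : IsCompact Z := isCompact_Icc.inter_right (isClosed_singleton.preimage cG)
    obtain ⟨m, hmZ, hm⟩ := hZ.exists_isGreatest ⟨α₀, hα₀, hz⟩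
    have hm0 : F (m, 1) = 0 := (mul_eq_zero.1 hmZ.2).resolve_left hc0
    obtain ⟨β, hβ, hβ0⟩ := step m hm0
    have hβA : β ≤ A := by
      by_contra hcon
      push Not at hcon
      have := (big β (by linarith)).1
      rw [hβ0] at this
      simp at this
    have : β ∈ Z := ⟨⟨by linarith [hmZ.1.1], hβA⟩, by simp [hβ0]⟩
    have := hm this
    linarith
  have F0 : F (1, 0) = 0 := by
    rcases lt_trichotomy (F (1, 0)) 0 with h | h | h
    · exact (asym (-1) (by linarith) (by linarith [sgn2 h])).elim
    · exact h
    · exact (asym 1 (by linarith) (by linarith [sgn1 h])).elim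
  have F0' := sgn0 F0
  have Ft : F (t, 0) = 0 := by
    rcases le_total 0 t with ht | ht
    · have : ((t, 0) : ℝ × ℝ) = t • ((1, 0) : ℝ × ℝ) := by simp
      rw [this, hFs _ _ ht, F0, mul_zero]
    · have : ((t, 0) : ℝ × ℝ) = (-t) • (-(1, 0) : ℝ × ℝ) := by simp
      rw [this, hFs _ _ (by linarith), F0', mul_zero]
  intro hmem
  rw [fp_mem_iff_gauge hc hk.isClosed h0]
  have : -((t, 0) : ℝ × ℝ) ∈ D' := by
    simp only [hD', hp, mem_preimage]
    simpa [sub_eq_add_neg] using hmem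
  rw [fp_mem_iff_gauge hc' hk'.isClosed h1'] at this
  have h3 : gauge D (t, 0) - gauge D' (-(t, 0)) = 0 := Ft
  linarith

lemma fp_perturb {V : Type*} [NormedAddCommGroup V] [NormedSpace ℝ V] [FiniteDimensional ℝ V]
    {S : Set V} (hS : IsCompact S) (f : V →ₗ[ℝ] ℝ) (hf : ∀ y ∈ S, 0 < f y) {v : V} (hv : v ≠ 0) :
    ∃ n : V →ₗ[ℝ] ℝ, n v ≠ 0 ∧ ∀ y ∈ S, 0 < n y := by
  by_cases hfv : f v = 0
  swap
  · exact ⟨f, hfv, hf⟩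
  obtain ⟨ψ, hψ, -⟩ := Submodule.exists_le_ker_of_notMem (p := (⊥ : Submodule ℝ V)) (v := v)
    (by simpa using hv)
  have cf : Continuous f := f.continuous_of_finiteDimensional
  have cψ : Continuous ψ := ψ.continuous_of_finiteDimensional
  rcases S.eq_empty_or_nonempty with rfl | hne
  · exact ⟨ψ, hψ, by simp⟩
  obtain ⟨y₀, hy₀, hmin⟩ := hS.exists_isMinOn hne cf.continuousOn
  obtain ⟨y₁, hy₁, hmax⟩ := hS.exists_isMaxOn hne cψ.abs.continuousOn
  have hm := hf y₀ hy₀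
  set m := f y₀ with hmdef
  set M := |ψ y₁| with hM
  have hM0 : 0 ≤ M := abs_nonneg _
  have hδ : 0 < m / (M + 1) := by positivity
  refine ⟨f + (m / (M + 1)) • ψ, ?_, ?_⟩
  · simp [hfv, hψ, hδ.ne']
  · intro y hy
    have h1 : m ≤ f y := hmin hy
    have h2 : |ψ y| ≤ M := hmax hy
    have h3 : -M ≤ ψ y := (abs_le.1 h2).1
    have h4 : m / (M + 1) * (-M) ≤ m / (M + 1) * ψ y := mul_le_mul_of_nonneg_left h3 hδ.le
    have h5 : m + m / (M + 1) * (-M) = m / (M + 1) := by field_simp; ring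
    simp only [LinearMap.add_apply, LinearMap.smul_apply, smul_eq_mul]
    linarith

lemma fp_symm_aux {V : Type*} [NormedAddCommGroup V] [NormedSpace ℝ V] [FiniteDimensional ℝ V]
    {B : Set V} (hc : Convex ℝ B) (hk : IsCompact B) {v : V}
    (h0 : (0 : V) ∈ interior B) (hv : v ∈ interior B)
    (hyp : ∀ n : V →ₗ[ℝ] ℝ, n ≠ 0 → ∃ w, n w = n v ∧ ∀ x, n x = 0 → (x ∈ B ↔ x + w ∈ B))
    (n k : V →ₗ[ℝ] ℝ) (hn : 0 < n v) (hkv : k v = 0) (hk0 : k ≠ 0) (t : ℝ)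
    (ht : ∃ x ∈ B, n x = n v - t ∧ k x = 0) : ∃ x ∈ B, n x = t ∧ k x = 0 := by
  let π : V →ₗ[ℝ] ℝ × ℝ := n.prod k
  have hπ : ∀ x, π x = (n x, k x) := fun x => rfl
  obtain ⟨z, hz⟩ : ∃ z, k z ≠ 0 := by
    by_contra hcon
    push Not at hcon
    exact hk0 (LinearMap.ext hcon)
  have hsurj : Function.Surjective π := by
    rintro ⟨a, b⟩
    refine ⟨(b / k z) • z + ((a - b / k z * n z) / n v) • v, ?_⟩
    simp only [hπ, map_add, map_smul, smul_eq_mul, hkv]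
    ext
    · simp; field_simp; ring
    · simp [hkv]; field_simp
  have hcont : Continuous π := π.continuous_of_finiteDimensional
  have hopen : IsOpenMap π := π.isOpenMap_of_finiteDimensional hsurj
  have hDi : ∀ x ∈ interior B, π x ∈ interior (π '' B) := fun x hx =>
    hopen.image_interior_subset B ⟨x, hx, rfl⟩
  have e0 : π 0 = 0 := map_zero π
  have ev : π v = (n v, 0) := by simp [hπ, hkv]
  have key := fp_planar (D := π '' B) (hc.linear_image π) (hk.image hcont) (a := n v) hn
    (by rw [← e0]; exact hDi 0 h0) (by rw [← ev]; exact hDi v hv) ?_ t ?_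
  · obtain ⟨x, hx, hxe⟩ := key
    simp only [hπ, Prod.mk.injEq] at hxe
    exact ⟨x, hx, hxe⟩
  · intro α
    have hν : (n - α • k) ≠ 0 := by
      intro h
      have := LinearMap.congr_fun h v
      simp [hkv] at this
      exact hn.ne' this
    obtain ⟨w, hw, H⟩ := hyp _ hν
    simp only [LinearMap.sub_apply, LinearMap.smul_apply, smul_eq_mul, hkv] at hw
    refine ⟨k w, fun s => ⟨?_, ?_⟩⟩
    · rintro ⟨x, hx, hxe⟩
      simp only [hπ, Prod.smul_mk, smul_eq_mul, Prod.mk.injEq] at hxe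
      refine ⟨x + w, (H x ?_).1 hx, ?_⟩
      · simp only [LinearMap.sub_apply, LinearMap.smul_apply, smul_eq_mul]
        rw [hxe.1, hxe.2]; ring
      · simp only [hπ, Prod.smul_mk, smul_eq_mul, map_add,
          Prod.mk_add_mk, Prod.mk.injEq]
        rw [hxe.1, hxe.2]
        constructor <;> linarith
    · rintro ⟨x, hx, hxe⟩
      simp only [hπ, Prod.smul_mk, smul_eq_mul, Prod.mk_add_mk,
        Prod.mk.injEq] at hxe
      refine ⟨x - w, (H (x - w) ?_).2 (by simpa using hx), ?_⟩
      · simp only [LinearMap.sub_apply, LinearMap.smul_apply, smul_eq_mul, map_sub]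
        rw [hxe.1, hxe.2]; linarith
      · simp only [hπ, Prod.smul_mk, smul_eq_mul, map_sub,
          Prod.mk.injEq]
        rw [hxe.1, hxe.2]
        constructor <;> linarith
  · obtain ⟨x, hx, h1, h2⟩ := ht
    exact ⟨x, hx, by simp [hπ, h1, h2]⟩

/-- The body is symmetric about `v / 2`. -/
lemma fp_symm {V : Type*} [NormedAddCommGroup V] [NormedSpace ℝ V] [FiniteDimensional ℝ V]
    (hdim : 3 ≤ finrank ℝ V)
    {B : Set V} (hc : Convex ℝ B) (hk : IsCompact B) {v : V} (hv0 : v ≠ 0)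
    (h0 : (0 : V) ∈ interior B) (hv : v ∈ interior B)
    (hyp : ∀ n : V →ₗ[ℝ] ℝ, n ≠ 0 → ∃ w, n w = n v ∧ ∀ x, n x = 0 → (x ∈ B ↔ x + w ∈ B))
    (x : V) (hx : x ∈ B) : v - x ∈ B := by
  by_contra hcon
  -- a separating functional that does not vanish at `v`
  obtain ⟨n, hnv, hn⟩ : ∃ n : V →ₗ[ℝ] ℝ, n v ≠ 0 ∧ ∀ y ∈ B, n y < n (v - x) := by
    obtain ⟨f, u, hf, hu⟩ := geometric_hahn_banach_closed_point hc hk.isClosed hcon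
    obtain ⟨n, h1, h2⟩ := fp_perturb (S := (fun y => (v - x) - y) '' B)
      (hk.image (by fun_prop)) f.toLinearMap (by
        rintro _ ⟨y, hy, rfl⟩
        have := (hf y hy).trans hu
        have e : f.toLinearMap ((v - x) - y) = f (v - x) - f y := map_sub f _ _
        rw [e]; linarith) hv0
    refine ⟨n, h1, fun y hy => ?_⟩
    have := h2 _ ⟨y, hy, rfl⟩
    simp only [map_sub] at this ⊢
    linarith
  obtain ⟨k, hk0, hkv, hkx⟩ : ∃ k : V →ₗ[ℝ] ℝ, k ≠ 0 ∧ k v = 0 ∧ k x = 0 := by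
    have hlt : Submodule.span ℝ ({v, x} : Set V) < ⊤ := by
      rw [lt_top_iff_ne_top]
      intro h
      have h1 : finrank ℝ (Submodule.span ℝ ({v, x} : Set V)) ≤ 2 := by
        classical
        have := finrank_span_finset_le_card (R := ℝ) ({v, x} : Finset V)
        simp only [Finset.coe_insert, Finset.coe_singleton] at this
        exact this.trans Finset.card_le_two
      rw [h, finrank_top] at h1
      omega
    obtain ⟨k, hk0, hk⟩ := Submodule.exists_le_ker_of_lt_top _ hlt
    exact ⟨k, hk0, hk (Submodule.subset_span (by simp)), hk (Submodule.subset_span (by simp))⟩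
  rcases lt_or_gt_of_ne hnv with h | h
  · obtain ⟨y, hy, h1, -⟩ := fp_symm_aux hc hk h0 hv hyp (-n) k (by simpa using h) hkv hk0
      ((-n) (v - x)) ⟨x, hx, by simp only [LinearMap.neg_apply, map_sub]; ring, hkx⟩
    have := hn y hy
    simp only [LinearMap.neg_apply] at h1
    linarith
  · obtain ⟨y, hy, h1, -⟩ := fp_symm_aux hc hk h0 hv hyp n k h hkv hk0
      (n (v - x)) ⟨x, hx, by simp, hkx⟩
    have := hn y hy
    linarith

/-- Every section of the body by a proper subspace is centrally symmetric. -/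
lemma fp_section {V : Type*} [NormedAddCommGroup V] [NormedSpace ℝ V] [FiniteDimensional ℝ V]
    {B : Set V} (hc : Convex ℝ B) (hk : IsCompact B) {v : V} (h0 : (0 : V) ∈ interior B)
    (hyp : ∀ n : V →ₗ[ℝ] ℝ, n ≠ 0 → ∃ w, n w = n v ∧ ∀ x, n x = 0 → (x ∈ B ↔ x + w ∈ B))
    (hsym : ∀ x ∈ B, v - x ∈ B) (P : Submodule ℝ V) (hP : P < ⊤) :
    ∃ c ∈ P, ∀ x ∈ B, x ∈ P → (2 : ℝ) • c - x ∈ B := by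
  let D : Set V := {y | ∀ q ∈ B, q ∈ P → y - q ∈ B}
  have hn : ∀ n : V →ₗ[ℝ] ℝ, n ≠ 0 → P ≤ LinearMap.ker n → ∃ y ∈ D, n y = 0 := by
    intro n hn0 hnP
    obtain ⟨w, hw, H⟩ := hyp n hn0
    refine ⟨v - w, ?_, by simp [hw]⟩
    intro q hq hqP
    have := hsym _ ((H q (hnP hqP)).1 hq)
    convert this using 1
    abel
  have hDc : Convex ℝ D := by
    intro y₁ h₁ y₂ h₂ a b ha hb hab q hq hqP
    have := hc (h₁ q hq hqP) (h₂ q hq hqP) ha hb hab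
    convert this using 1
    rw [smul_sub, smul_sub]
    have : q = a • q + b • q := by rw [← add_smul, hab, one_smul]
    nth_rewrite 1 [this]
    abel
  have hDcl : IsClosed D := by
    have : D = ⋂ q ∈ B ∩ P, (fun y => y - q) ⁻¹' B := by
      ext y; simp [D]
    rw [this]
    exact isClosed_biInter fun q _ => hk.isClosed.preimage (by fun_prop)
  have hDk : IsCompact D := by
    refine hk.of_isClosed_subset hDcl ?_
    intro y hy
    simpa using hy 0 (interior_subset h0) P.zero_mem
  by_cases hdis : Disjoint D (P : Set V)
  · exfalso
    obtain ⟨k, hk0, hkP⟩ := Submodule.exists_le_ker_of_lt_top _ hP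
    obtain ⟨y₀, hy₀, -⟩ := hn k hk0 hkP
    obtain ⟨f, u, u', hf, huu, hfP⟩ := geometric_hahn_banach_compact_closed hDc hDk P.convex
      P.closed_of_finiteDimensional hdis
    have hf0 : ∀ x ∈ P, f x = 0 := by
      intro x hx
      by_contra hne
      have := hfP (((u' - 1) / f x) • x) (P.smul_mem _ hx)
      rw [map_smul, smul_eq_mul, div_mul_cancel₀ _ hne] at this
      linarith
    have hu' : u' < 0 := by simpa using hfP 0 P.zero_mem
    have hfy := hf y₀ hy₀
    have hfne : f.toLinearMap ≠ 0 := by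
      intro h
      have : f y₀ = 0 := LinearMap.congr_fun h y₀
      linarith
    obtain ⟨y, hy, hy0⟩ := hn f.toLinearMap hfne (fun x hx => hf0 x hx)
    have h1 := hf y hy
    have h2 : f y = 0 := hy0
    linarith
  · rw [Set.not_disjoint_iff] at hdis
    obtain ⟨y, hy, hyP⟩ := hdis
    refine ⟨(1 / 2 : ℝ) • y, P.smul_mem _ hyP, fun x hx hxP => ?_⟩
    have := hy x hx hxP
    convert this using 2
    rw [smul_smul]; norm_num

lemma fp_interior_of_smul {V : Type*} [NormedAddCommGroup V] [NormedSpace ℝ V]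
    {B : Set V} (hc : Convex ℝ B) {c y : V} (hci : c ∈ interior B) (hy : y ∈ B) {t : ℝ}
    (h0 : 0 ≤ t) (h1 : t < 1) : c + t • (y - c) ∈ interior B := by
  have := hc.combo_interior_self_mem_interior hci hy (a := 1 - t) (b := t) (by linarith) h0 (by ring)
  convert this using 1
  rw [smul_sub, sub_smul, one_smul]
  abel

lemma fp_chord {V : Type*} [NormedAddCommGroup V] [NormedSpace ℝ V]
    {B : Set V} (hc : Convex ℝ B) (P : Submodule ℝ V) {c : V} (hcP : c ∈ P)
    (h0 : (0 : V) ∈ interior B) (hs : ∀ x ∈ B, x ∈ P → (2 : ℝ) • c - x ∈ B)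
    {x y : V} (hx : x ∈ B) (hxP : x ∈ P) (hxi : x ∉ interior B)
    (hy : y ∈ B) (hyP : y ∈ P) (hyi : y ∉ interior B) (hxy : x ≠ y) {β : ℝ}
    (hb : y = c + β • (x - c)) : x + y = (2 : ℝ) • c := by
  have hci : c ∈ interior B := by
    have := fp_interior_of_smul hc h0 (hs 0 (interior_subset h0) P.zero_mem) (t := 1 / 2)
      (by norm_num) (by norm_num)
    simpa [smul_smul] using this
  have main : ∀ {x y : V} {β : ℝ}, x ∈ B → x ∈ P → y ∉ interior B → y = c + β • (x - c) →
      1 ≤ β ∨ β ≤ -1 := by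
    intro x y β hx hxP hyi hb
    by_contra hcon
    push Not at hcon
    apply hyi
    rcases le_total 0 β with h | h
    · rw [hb]; exact fp_interior_of_smul hc hci hx h hcon.1
    · have := fp_interior_of_smul hc hci (hs x hx hxP) (t := -β) (by linarith) (by linarith)
      convert this using 1
      rw [hb, two_smul]
      module
  have hb0 : β ≠ 0 := by
    rintro rfl
    rcases main hx hxP hyi hb with h | h <;> linarith
  have hb' : x = c + β⁻¹ • (y - c) := by
    rw [hb, add_sub_cancel_left, smul_smul, inv_mul_cancel₀ hb0, one_smul]; abel
  have m1 := main hx hxP hyi hb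
  have m2 := main hy hyP hxi hb'
  have hβ : β = -1 := by
    rcases m1 with h | h
    · exfalso
      apply hxy
      have : β = 1 := by
        rcases m2 with h' | h'
        · exact le_antisymm ((one_le_inv₀ (by linarith)).1 h') h
        · have : 0 < β⁻¹ := inv_pos.2 (by linarith)
          linarith
      rw [hb, this]; simp
    · rcases m2 with h' | h'
      · have : β⁻¹ < 0 := inv_lt_zero.2 (by linarith)
        linarith
      · have h3 : β⁻¹ * β = 1 := inv_mul_cancel₀ hb0
        nlinarith
  rw [hb, hβ, two_smul]
  module

/-- An affine chart in linear-algebra form. -/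
structure FPChart (E V : Type*) [AddCommGroup E] [Module ℝ E] [AddCommGroup V] [Module ℝ V] where
  lam : V →ₗ[ℝ] ℝ
  P : V →ₗ[ℝ] E
  i : E →ₗ[ℝ] V
  j0 : V
  lam_i : ∀ y, lam (i y) = 0
  lam_j0 : lam j0 = 1
  P_i : ∀ y, P (i y) = y
  P_j0 : P j0 = 0
  decomp : ∀ x, x = lam x • j0 + i (P x)

namespace FPChart

section alg
variable {E V : Type*} [AddCommGroup E] [Module ℝ E] [AddCommGroup V] [Module ℝ V]
  (ch : FPChart E V)

def j (y : E) : V := ch.j0 + ch.i y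

def kap (x : V) : E := (ch.lam x)⁻¹ • ch.P x

def Kc (S : Set E) (x : V) : Prop := ch.lam x ≠ 0 ∧ ch.kap x ∈ S

def Cp (S : Set E) (x : V) : Prop := 0 < ch.lam x ∧ ch.kap x ∈ S

lemma lam_j (y : E) : ch.lam (ch.j y) = 1 := by simp [j, ch.lam_i, ch.lam_j0]

lemma P_j (y : E) : ch.P (ch.j y) = y := by simp [j, ch.P_i, ch.P_j0]

lemma kap_j (y : E) : ch.kap (ch.j y) = y := by simp [kap, lam_j, P_j]

lemma kap_smul {c : ℝ} (hc : c ≠ 0) (x : V) : ch.kap (c • x) = ch.kap x := by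
  simp only [kap, map_smul, smul_smul, smul_eq_mul, mul_inv]
  congr 1
  field_simp

lemma eq_smul_j {x : V} (h : ch.lam x ≠ 0) : x = ch.lam x • ch.j (ch.kap x) := by
  conv_lhs => rw [ch.decomp x]
  simp only [j, kap, smul_add, map_smul, smul_smul, mul_inv_cancel₀ h, one_smul]

lemma Kc_smul {S : Set E} {c : ℝ} (hc : c ≠ 0) (x : V) : ch.Kc S (c • x) ↔ ch.Kc S x := by
  simp [Kc, ch.kap_smul hc, hc]

lemma Cp_smul {S : Set E} {c : ℝ} (hc : 0 < c) {x : V} (h : ch.Cp S x) : ch.Cp S (c • x) := by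
  refine ⟨?_, ?_⟩
  · simpa using mul_pos hc h.1
  · rw [ch.kap_smul hc.ne']; exact h.2

lemma Cp_j {S : Set E} {y : E} (h : y ∈ S) : ch.Cp S (ch.j y) :=
  ⟨by rw [lam_j]; norm_num, by rwa [kap_j]⟩

lemma Cp_add {S : Set E} (hS : Convex ℝ S) {x y : V} (hx : ch.Cp S x) (hy : ch.Cp S y) :
    ch.Cp S (x + y) := by
  have hx1 := hx.1
  have hy1 := hy.1
  have hs : 0 < ch.lam x + ch.lam y := by linarith
  refine ⟨by simpa using hs, ?_⟩
  have := hS hx.2 hy.2 (a := ch.lam x / (ch.lam x + ch.lam y))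
    (b := ch.lam y / (ch.lam x + ch.lam y)) (by positivity) (by positivity) (by field_simp)
  convert this using 1
  simp only [kap, map_add, smul_add, smul_smul]
  congr 2 <;> field_simp

lemma Cp.Kc {S : Set E} {x : V} (h : ch.Cp S x) : ch.Kc S x := ⟨h.1.ne', h.2⟩

lemma Kc_cases {S : Set E} {x : V} (h : ch.Kc S x) : ch.Cp S x ∨ ch.Cp S (-x) := by
  rcases lt_or_gt_of_ne h.1 with h1 | h1
  · right
    refine ⟨by simpa using h1, ?_⟩
    have : -x = (-1 : ℝ) • x := by simp
    rw [this, ch.kap_smul (by norm_num)]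
    exact h.2
  · exact Or.inl ⟨h1, h.2⟩

lemma apply_Cp {S : Set E} (n : V →ₗ[ℝ] ℝ) {x : V} (h : ch.lam x ≠ 0) :
    n x = ch.lam x * n (ch.j (ch.kap x)) := by
  conv_lhs => rw [ch.eq_smul_j h]
  simp

/-- The translation hypothesis. -/
def Hyp (S : Set E) (φ : V →ₗ[ℝ] ℝ) (p q : V) : Prop :=
  ∀ n : V →ₗ[ℝ] ℝ, (∃ c, φ c = 0 ∧ n c ≠ 0) → ∃ w, φ w = 0 ∧ n w = n (q - p) ∧
    ∀ x, φ x = 1 → n x = n p → (ch.Kc S x ↔ ch.Kc S (x + w))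

lemma Hyp.symm {S : Set E} {φ : V →ₗ[ℝ] ℝ} {p q : V} (h : ch.Hyp S φ p q) : ch.Hyp S φ q p := by
  intro n hn
  obtain ⟨w, h1, h2, h3⟩ := h n hn
  refine ⟨-w, by simp [h1], by simp only [map_neg, h2, map_sub]; ring, fun x hx hnx => ?_⟩
  have := h3 (x + -w) (by simp [hx, h1]) (by simp only [map_add, map_neg, hnx, h2, map_sub]; ring)
  rw [this]
  simp

end alg

section top
variable {E V : Type*} [NormedAddCommGroup E] [NormedSpace ℝ E] [FiniteDimensional ℝ E]
  [NormedAddCommGroup V] [NormedSpace ℝ V] [FiniteDimensional ℝ V]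
  (ch : FPChart E V)

lemma continuous_j : Continuous ch.j := by
  have := ch.i.continuous_of_finiteDimensional
  unfold j
  fun_prop

lemma continuousAt_kap {x : V} (h : ch.lam x ≠ 0) : ContinuousAt ch.kap x := by
  have h1 := ch.lam.continuous_of_finiteDimensional
  have h2 := ch.P.continuous_of_finiteDimensional
  exact (h1.continuousAt.inv₀ h).smul h2.continuousAt

lemma cross_pos_aux {S : Set E} (hS : Convex ℝ S) (hk : IsCompact S) {φ : V →ₗ[ℝ] ℝ} {p q : V}
    (hp : ch.Cp S p) (hφp : φ p = 1) (hφq : φ q = 1)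
    (n : V →ₗ[ℝ] ℝ) (hn : ∀ y ∈ S, 0 < n (ch.j y)) (hv : 0 < n (q - p))
    (hyp : ch.Hyp S φ p q) {y₀ y₁ : E} (h₀ : y₀ ∈ S) (h₁ : y₁ ∈ S)
    (hφ₀ : φ (ch.j y₀) = 0) (hφ₁ : φ (ch.j y₁) = 0) : y₀ = y₁ := by
  obtain ⟨w, hw, hnw, H⟩ := hyp n ⟨q - p, by simp [hφp, hφq], hv.ne'⟩
  have hnC : ∀ x, ch.Cp S x → 0 < n x := fun x hx => by
    rw [ch.apply_Cp (S := S) n hx.1.ne']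
    exact mul_pos hx.1 (hn _ hx.2)
  -- norm bound on the cone
  have cj := ch.continuous_j
  have cn : Continuous n := n.continuous_of_finiteDimensional
  obtain ⟨m, hm, hmin⟩ := hk.exists_isMinOn ⟨y₀, h₀⟩ (cn.comp cj).continuousOn
  obtain ⟨M, hM, hmax⟩ := hk.exists_isMaxOn ⟨y₀, h₀⟩ cj.norm.continuousOn
  have hm0 := hn m hm
  have bound : ∀ x, ch.Cp S x → ‖x‖ ≤ ‖ch.j M‖ / n (ch.j m) * n x := by
    intro x hx
    have e1 : ‖x‖ = ch.lam x * ‖ch.j (ch.kap x)‖ := by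
      conv_lhs => rw [ch.eq_smul_j hx.1.ne']
      rw [norm_smul, Real.norm_eq_abs, abs_of_pos hx.1]
    have e2 := ch.apply_Cp (S := S) n hx.1.ne'
    have h1 : ‖ch.j (ch.kap x)‖ ≤ ‖ch.j M‖ := hmax hx.2
    have h2 : n (ch.j m) ≤ n (ch.j (ch.kap x)) := hmin hx.2
    rw [e1, e2, div_mul_eq_mul_div, le_div_iff₀ hm0]
    have hl := hx.1
    calc ch.lam x * ‖ch.j (ch.kap x)‖ * n (ch.j m) ≤ ch.lam x * ‖ch.j M‖ * n (ch.j (ch.kap x)) := by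
          gcongr
      _ = _ := by ring
  have key : ∀ g, ch.Cp S g → φ g = 0 → n g = n (q - p) → g = w := by
    intro g hg hφg hng
    have it : ∀ k : ℕ, ch.Cp S (p + (k : ℝ) • (g - w)) := by
      intro k
      induction k with
      | zero => simpa using hp
      | succ k ih =>
        have h1 : ch.Kc S (p + ((k + 1 : ℕ) : ℝ) • (g - w)) := by
          rw [H _ (by simp [hφp, hφg, hw]) (by simp [hng, hnw])]
          have := (ch.Cp_add hS ih hg).Kc
          convert this using 1
          push_cast
          module
        rcases ch.Kc_cases h1 with h2 | h2
        · exact h2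
        · exfalso
          have h3 := hnC _ h2
          have h4 := hnC _ hp
          simp only [map_neg, map_add, map_smul, map_sub n g w, hng, hnw, sub_self, smul_zero,
            add_zero] at h3
          linarith
    by_contra hne
    have hpos : 0 < ‖g - w‖ := norm_pos_iff.2 (sub_ne_zero.2 hne)
    set R := ‖ch.j M‖ / n (ch.j m) * n p with hR
    obtain ⟨k, hk⟩ := exists_nat_gt ((R + ‖p‖) / ‖g - w‖)
    rw [div_lt_iff₀ hpos] at hk
    have h1 := bound _ (it k)
    have h2 : n (p + (k : ℝ) • (g - w)) = n p := by simp [hng, hnw]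
    rw [h2] at h1
    have h3 : ‖(k : ℝ) • (g - w)‖ ≤ ‖p + (k : ℝ) • (g - w)‖ + ‖p‖ := by
      have := norm_sub_le (p + (k : ℝ) • (g - w)) p
      simpa using this
    rw [norm_smul, Real.norm_eq_abs, abs_of_nonneg (Nat.cast_nonneg k)] at h3
    linarith
  have gg : ∀ y ∈ S, φ (ch.j y) = 0 → (n (q - p) / n (ch.j y)) • ch.j y = w := by
    intro y hy hφ
    have := hn y hy
    refine key _ (ch.Cp_smul (div_pos hv this) (ch.Cp_j hy)) (by simp [hφ]) ?_
    rw [map_smul, smul_eq_mul, div_mul_cancel₀ _ this.ne']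
  have e := (gg y₀ h₀ hφ₀).trans (gg y₁ h₁ hφ₁).symm
  have e1 := congrArg ch.kap e
  rwa [ch.kap_smul (div_pos hv (hn _ h₀)).ne', ch.kap_smul (div_pos hv (hn _ h₁)).ne', kap_j,
    kap_j] at e1

lemma cross_pos {S : Set E} (hS : Convex ℝ S) (hk : IsCompact S) {φ : V →ₗ[ℝ] ℝ} {p q : V}
    (hp : ch.Cp S p) (hq : ch.Cp S q) (hφp : φ p = 1) (hφq : φ q = 1) (hpq : p ≠ q)
    (hyp : ch.Hyp S φ p q) {y₀ y₁ : E} (h₀ : y₀ ∈ S) (h₁ : y₁ ∈ S)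
    (hφ₀ : φ (ch.j y₀) = 0) (hφ₁ : φ (ch.j y₁) = 0) : y₀ = y₁ := by
  obtain ⟨n, hv, hn⟩ := fp_perturb (hk.image ch.continuous_j) ch.lam (by
    rintro _ ⟨y, -, rfl⟩
    rw [lam_j]; norm_num) (sub_ne_zero.2 hpq.symm)
  have hn' : ∀ y ∈ S, 0 < n (ch.j y) := fun y hy => hn _ ⟨y, hy, rfl⟩
  rcases lt_or_gt_of_ne hv with h | h
  · exact ch.cross_pos_aux hS hk hq hφq hφp n hn' (by rw [map_sub] at h ⊢; linarith) hyp.symm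
      h₀ h₁ hφ₀ hφ₁
  · exact ch.cross_pos_aux hS hk hp hφp hφq n hn' h hyp h₀ h₁ hφ₀ hφ₁

lemma cross_neg {S : Set E} (hS : Convex ℝ S) (hk : IsCompact S) {φ : V →ₗ[ℝ] ℝ} {p q : V}
    (hp : ch.Cp (interior S) p) (hq : ch.Cp (interior S) (-q)) (hφp : φ p = 1)
    (hyp : ch.Hyp S φ p q) {y₀ y₁ : E} (h₀ : y₀ ∈ interior S) (h₁ : y₁ ∈ frontier S)
    (hφ₀ : φ (ch.j y₀) = 0) (hφ₁ : φ (ch.j y₁) = 0) : False := by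
  have h₁S : y₁ ∈ S := hk.isClosed.frontier_subset h₁
  obtain ⟨f, hf⟩ := geometric_hahn_banach_point_open hS.interior isOpen_interior
    (x := y₁) (fun h => h₁.2 h)
  have hf' : ∀ y ∈ S, f y₁ ≤ f y := by
    intro y hy
    have hcl : closure (interior S) = closure S := hS.closure_interior_eq_closure_of_nonempty_interior ⟨y₀, h₀⟩
    have hy' : y ∈ closure (interior S) := by rw [hcl]; exact subset_closure hy
    have : IsClosed {y | f y₁ ≤ f y} := isClosed_le continuous_const f.continuous
    exact closure_minimal (fun z hz => (hf z hz).le) this hy'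
  let n : V →ₗ[ℝ] ℝ := f.toLinearMap ∘ₗ ch.P - f y₁ • ch.lam
  have nj : ∀ y, n (ch.j y) = f y - f y₁ := by
    intro y
    simp [n, P_j, lam_j]
  have hnC : ∀ x, ch.Cp S x → 0 ≤ n x := fun x hx => by
    rw [ch.apply_Cp (S := S) n hx.1.ne', nj]
    exact mul_nonneg hx.1.le (by linarith [hf' _ hx.2])
  have hnI : ∀ x, ch.Cp (interior S) x → 0 < n x := fun x hx => by
    rw [ch.apply_Cp (S := S) n hx.1.ne', nj]
    exact mul_pos hx.1 (by linarith [hf _ hx.2])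
  obtain ⟨w, hw, hnw, H⟩ := hyp n ⟨ch.j y₀, hφ₀, (hnI _ (ch.Cp_j h₀)).ne'⟩
  have hpS : ch.Cp S p := ⟨hp.1, interior_subset hp.2⟩
  have hnq := hnI _ hq
  rw [map_neg] at hnq
  have n1 : n (ch.j y₁) = 0 := by rw [nj]; ring
  have main : ∀ N : ℝ, 0 < N → ch.lam (p + w) + N < 0 := by
    intro N hN
    have c1 : ch.Cp S (p + N • ch.j y₁) := ch.Cp_add hS hpS (ch.Cp_smul hN (ch.Cp_j h₁S))
    have c2 := (H _ (by simp [hφp, hφ₁]) (by simp [n1])).1 c1.Kc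
    rcases ch.Kc_cases c2 with h | h
    · exfalso
      have := hnC _ h
      simp only [map_add, map_smul, n1, hnw, map_sub, smul_zero] at this
      linarith
    · have := h.1
      simp only [map_neg, map_add, map_smul, lam_j, smul_eq_mul] at this ⊢
      linarith
  have := main (|ch.lam (p + w)| + 1) (by positivity)
  have := neg_abs_le (ch.lam (p + w))
  linarith

lemma exit_point {S : Set E} (hS : Convex ℝ S) (hk : IsCompact S) {y₀ u : E} (h₀ : y₀ ∈ interior S)
    (hu : u ≠ 0) : ∃ t : ℝ, 0 < t ∧ y₀ + t • u ∈ frontier S := by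
  set D : Set E := (fun x => y₀ + x) ⁻¹' S with hD
  have hc' : Convex ℝ D := hS.translate_preimage_right y₀
  have hk' : IsCompact D := (Homeomorph.addLeft y₀).isCompact_preimage.2 hk
  have h1' : (0 : E) ∈ interior D := by
    rw [mem_interior_iff_mem_nhds] at h₀ ⊢
    apply ContinuousAt.preimage_mem_nhds (by fun_prop)
    simpa using h₀
  have hg := fp_gauge_pos hk' h1' hu
  refine ⟨(gauge D u)⁻¹, inv_pos.2 hg, ?_⟩
  have hfr : frontier D = (fun x => y₀ + x) ⁻¹' frontier S :=
    ((Homeomorph.addLeft y₀).preimage_frontier S).symm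
  have : (gauge D u)⁻¹ • u ∈ frontier D := by
    rw [← gauge_eq_one_iff_mem_frontier hc' (mem_interior_iff_mem_nhds.1 h1'),
      gauge_smul_of_nonneg (inv_pos.2 hg).le, smul_eq_mul, inv_mul_cancel₀ hg.ne']
  rw [hfr] at this
  exact this

lemma no_cross (hE : 2 ≤ finrank ℝ E) {S : Set E} (hS : Convex ℝ S) (hk : IsCompact S)
    {φ : V →ₗ[ℝ] ℝ} {p q : V}
    (hp : ch.Cp (interior S) p) (hq : ch.Kc (interior S) q) (hφp : φ p = 1) (hφq : φ q = 1)
    (hpq : p ≠ q) (hyp : ch.Hyp S φ p q) {y₀ : E} (h₀ : y₀ ∈ interior S) :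
    φ (ch.j y₀) ≠ 0 := by
  intro hφ₀
  obtain ⟨u, hu, hu0⟩ : ∃ u : E, φ (ch.i u) = 0 ∧ u ≠ 0 := by
    have hr := LinearMap.finrank_range_add_finrank_ker (φ ∘ₗ ch.i)
    have h1 : finrank ℝ (LinearMap.range (φ ∘ₗ ch.i)) ≤ 1 := by
      have := Submodule.finrank_le (LinearMap.range (φ ∘ₗ ch.i))
      simpa using this
    have h2 : LinearMap.ker (φ ∘ₗ ch.i) ≠ ⊥ := by
      intro h
      rw [h, finrank_bot] at hr
      omega
    obtain ⟨u, hu, hu0⟩ := Submodule.exists_mem_ne_zero_of_ne_bot h2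
    exact ⟨u, hu, hu0⟩
  obtain ⟨t, ht, hf⟩ := exit_point hS hk h₀ hu0
  have hφ₁ : φ (ch.j (y₀ + t • u)) = 0 := by
    have : ch.j (y₀ + t • u) = ch.j y₀ + t • ch.i u := by simp [j, add_assoc]
    rw [this]; simp [hφ₀, hu]
  rcases ch.Kc_cases hq with h | h
  · have := ch.cross_pos hS hk ⟨hp.1, interior_subset hp.2⟩ ⟨h.1, interior_subset h.2⟩ hφp hφq hpq
      hyp (interior_subset h₀) (hk.isClosed.frontier_subset hf) hφ₀ hφ₁
    rw [left_eq_add] at this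
    exact (smul_ne_zero ht.ne' hu0) this
  · exact ch.cross_neg hS hk hp h hφp hyp h₀ hf hφ₀ hφ₁

end top
end FPChart

namespace FPChart
section main
variable {E V : Type*} [NormedAddCommGroup E] [NormedSpace ℝ E] [FiniteDimensional ℝ E]
  [NormedAddCommGroup V] [NormedSpace ℝ V] [FiniteDimensional ℝ V]
  (ch : FPChart E V)

/-- The body inside the affine hyperplane `φ = 1`, based at `p`. -/
def body (S : Set E) (φ : V →ₗ[ℝ] ℝ) (p : V) : Set (LinearMap.ker φ) :=
  {z | ch.Cp S (p + (z : V))}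

lemma body_convex {S : Set E} (hS : Convex ℝ S) (φ : V →ₗ[ℝ] ℝ) (p : V) :
    Convex ℝ (ch.body S φ p) := by
  intro x hx y hy a b ha hb hab
  rcases ha.eq_or_lt with rfl | ha
  · rw [zero_add] at hab
    subst hab
    simpa using hy
  rcases hb.eq_or_lt with rfl | hb
  · rw [add_zero] at hab
    subst hab
    simpa using hx
  have := ch.Cp_add hS (ch.Cp_smul ha hx) (ch.Cp_smul hb hy)
  show ch.Cp S _
  convert this using 1
  have h : p = a • p + b • p := by rw [← add_smul, hab, one_smul]
  nth_rewrite 1 [h]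
  simp only [Submodule.coe_add, Submodule.coe_smul, smul_add]
  abel

lemma lam_pos_of {S : Set E} {φ : V →ₗ[ℝ] ℝ} (hφ : ∀ y ∈ S, 0 < φ (ch.j y)) {x : V}
    (h : ch.Kc S x) (hx : 0 < φ x) : ch.Cp S x := by
  refine ⟨?_, h.2⟩
  rw [ch.apply_Cp (S := S) φ h.1] at hx
  exact pos_of_mul_pos_left hx (hφ _ h.2).le

lemma body_compact {S : Set E} (hk : IsCompact S) {φ : V →ₗ[ℝ] ℝ}
    (hφ : ∀ y ∈ S, 0 < φ (ch.j y)) {p : V} (hp : φ p = 1) : IsCompact (ch.body S φ p) := by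
  have cφ : Continuous φ := φ.continuous_of_finiteDimensional
  have cj := ch.continuous_j
  let m : E → V := fun y => (φ (ch.j y))⁻¹ • ch.j y - p
  have hm : ContinuousOn m S := by
    apply ContinuousOn.sub _ continuousOn_const
    apply ContinuousOn.smul _ cj.continuousOn
    exact ContinuousOn.inv₀ (cφ.comp cj).continuousOn fun y hy => (hφ y hy).ne'
  have e : ch.body S φ p = Subtype.val ⁻¹' (m '' S) := by
    ext ⟨z, hz⟩
    have hz' : φ z = 0 := hz
    simp only [body, mem_setOf_eq, mem_preimage, mem_image]
    constructor
    · intro h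
      refine ⟨_, h.2, ?_⟩
      have h1 := ch.apply_Cp (S := S) φ h.1.ne'
      have h2 := ch.eq_smul_j h.1.ne'
      simp only [m]
      rw [sub_eq_iff_eq_add, add_comm z p]
      conv_rhs => rw [h2]
      congr 1
      rw [map_add, hp, hz', add_zero] at h1
      exact inv_eq_of_mul_eq_one_left h1.symm
    · rintro ⟨y, hy, rfl⟩
      simp only [m, add_sub_cancel]
      exact ch.Cp_smul (inv_pos.2 (hφ y hy)) (ch.Cp_j hy)
  rw [e]
  have hcl : IsClosed ((LinearMap.ker φ : Submodule ℝ V) : Set V) :=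
    (LinearMap.ker φ).closed_of_finiteDimensional
  exact hcl.isClosedEmbedding_subtypeVal.isCompact_preimage (hk.image_of_continuousOn hm)

lemma body_interior_of {S : Set E} {φ : V →ₗ[ℝ] ℝ} {p : V} {z : LinearMap.ker φ}
    (h : ch.Cp (interior S) (p + (z : V))) : z ∈ interior (ch.body S φ p) := by
  rw [mem_interior_iff_mem_nhds]
  have cl : Continuous ch.lam := ch.lam.continuous_of_finiteDimensional
  have c1 : ContinuousAt (fun z : LinearMap.ker φ => p + (z : V)) z := by fun_prop
  have c2 : ContinuousAt (fun z : LinearMap.ker φ => ch.kap (p + (z : V))) z :=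
    ContinuousAt.comp (f := fun z : LinearMap.ker φ => p + (z : V)) (g := ch.kap)
      (ch.continuousAt_kap h.1.ne') c1
  have c3 : ContinuousAt (fun z : LinearMap.ker φ => ch.lam (p + (z : V))) z := by fun_prop
  filter_upwards [c2.preimage_mem_nhds (mem_interior_iff_mem_nhds.1 h.2),
    c3.eventually (lt_mem_nhds h.1)] with y h1 h2
  exact ⟨h2, h1⟩

lemma of_body_interior {S : Set E} {φ : V →ₗ[ℝ] ℝ} (hφ : ∀ y ∈ S, 0 < φ (ch.j y))
    {p : V} (hp : φ p = 1) {z : LinearMap.ker φ}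
    (h : z ∈ interior (ch.body S φ p)) : ch.Cp (interior S) (p + (z : V)) := by
  have hzB : z ∈ ch.body S φ p := interior_subset h
  have hz : ch.Cp S (p + (z : V)) := hzB
  refine ⟨hz.1, ?_⟩
  have cφ : Continuous φ := φ.continuous_of_finiteDimensional
  have cj := ch.continuous_j
  rw [mem_interior_iff_mem_nhds, nhds_subtype, Filter.mem_comap] at h
  obtain ⟨U, hU, hUB⟩ := h
  set y := ch.kap (p + (z : V)) with hy
  have hφy : 0 < φ (ch.j y) := hφ _ hz.2
  let m : E → V := fun y => (φ (ch.j y))⁻¹ • ch.j y - p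
  have hm : ContinuousAt m y := by
    apply ContinuousAt.sub _ continuousAt_const
    apply ContinuousAt.smul _ cj.continuousAt
    exact ContinuousAt.inv₀ (cφ.comp cj).continuousAt hφy.ne'
  have hmy : m y = z := by
    have h1 := ch.apply_Cp (S := S) φ hz.1.ne'
    have h2 := ch.eq_smul_j hz.1.ne'
    simp only [m]
    rw [sub_eq_iff_eq_add, add_comm (z : V) p]
    conv_rhs => rw [h2]
    congr 1
    rw [map_add, hp, show φ (z : V) = 0 from z.2, add_zero] at h1
    exact inv_eq_of_mul_eq_one_left h1.symm
  rw [mem_interior_iff_mem_nhds]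
  have c3 : ContinuousAt (fun y => φ (ch.j y)) y := (cφ.comp cj).continuousAt
  rw [← hmy] at hU
  filter_upwards [hm.preimage_mem_nhds hU, c3.eventually (lt_mem_nhds hφy)] with y' h1 h2
  have hk : φ (m y') = 0 := by simp [m, hp, h2.ne']
  have h3 : ch.Cp S (p + m y') := hUB (show (⟨m y', hk⟩ : LinearMap.ker φ) ∈ _ from h1)
  have h4 := h3.2
  simp only [m, add_sub_cancel] at h4
  rwa [ch.kap_smul (inv_pos.2 h2).ne', kap_j] at h4

/-- Main affine result. -/
lemma main_affine {S : Set E} (hS : Convex ℝ S) (hk : IsCompact S) {φ : V →ₗ[ℝ] ℝ}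
    (hdim : 3 ≤ finrank ℝ (LinearMap.ker φ))
    (hφ : ∀ y ∈ S, 0 < φ (ch.j y)) {p q : V} (hp : ch.Cp (interior S) p)
    (hq : ch.Cp (interior S) q) (hφp : φ p = 1) (hφq : φ q = 1) (hpq : p ≠ q)
    (hyp : ch.Hyp S φ p q) :
    (∃ s t : ℝ, 0 < s ∧ 0 < t ∧ s ≠ t ∧
      (ch.Cp S (p - s • (q - p)) ∧ ¬ ch.Cp (interior S) (p - s • (q - p))) ∧
      (ch.Cp S (p + t • (q - p)) ∧ ¬ ch.Cp (interior S) (p + t • (q - p)))) ∧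
    ∀ W : Submodule ℝ V, p ∈ W → finrank ℝ W ≤ finrank ℝ (LinearMap.ker φ) →
      ∃ c ∈ W, φ c = 0 ∧ ∀ x y, x ∈ W → y ∈ W → φ x = 1 → φ y = 1 → ch.Cp S x → ch.Cp S y →
        ¬ ch.Cp (interior S) x → ¬ ch.Cp (interior S) y → x ≠ y →
        (∃ a b : ℝ, p + c = a • x + b • y) → x + y = (2 : ℝ) • (p + c) := by
  set B := ch.body S φ p with hB
  have hBc : Convex ℝ B := ch.body_convex hS φ p
  have hBk : IsCompact B := ch.body_compact hk hφ hφp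
  let v : LinearMap.ker φ := ⟨q - p, by simp [hφp, hφq]⟩
  have hvv : (v : V) = q - p := rfl
  have hv0 : v ≠ 0 := by
    intro h
    have := congrArg Subtype.val h
    exact hpq (sub_eq_zero.1 this).symm
  have h0 : (0 : LinearMap.ker φ) ∈ interior B := ch.body_interior_of (by simpa using hp)
  have hv : v ∈ interior B := ch.body_interior_of (by simpa [hvv] using hq)
  have hKB : ∀ z : LinearMap.ker φ, ch.Kc S (p + (z : V)) ↔ z ∈ B := by
    intro z
    constructor
    · intro h
      refine ch.lam_pos_of hφ h ?_
      rw [map_add, hφp, show φ (z : V) = 0 from z.2]; norm_num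
    · intro h
      exact Cp.Kc ch h
  have hyp' : ∀ n : LinearMap.ker φ →ₗ[ℝ] ℝ, n ≠ 0 →
      ∃ w, n w = n v ∧ ∀ x, n x = 0 → (x ∈ B ↔ x + w ∈ B) := by
    intro n hn
    obtain ⟨n', hn'⟩ := LinearMap.exists_extend n
    have hn'' : ∀ z : LinearMap.ker φ, n' (z : V) = n z := fun z => LinearMap.congr_fun hn' z
    obtain ⟨c, hc⟩ : ∃ c, n c ≠ 0 := by
      by_contra hcon
      push Not at hcon
      exact hn (LinearMap.ext hcon)
    obtain ⟨w, hw, hnw, H⟩ := hyp n' ⟨c, c.2, by rwa [hn'']⟩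
    refine ⟨⟨w, hw⟩, ?_, fun x hx => ?_⟩
    · rw [← hn'', ← hn'']; exact hnw
    · rw [← hKB, ← hKB]
      have := H (p + (x : V)) (by rw [map_add, hφp, show φ (x : V) = 0 from x.2, add_zero])
        (by rw [map_add, hn'', hx, add_zero])
      rw [this, add_assoc]
      rfl
  have hsym := fp_symm hdim hBc hBk hv0 h0 hv hyp'
  constructor
  · have g1 := inv_pos.2 (fp_gauge_pos hBk h0 hv0)
    have g2 := inv_pos.2 (fp_gauge_pos hBk h0 (neg_ne_zero.2 hv0))
    set t := (gauge B v)⁻¹ with ht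
    set s := (gauge B (-v))⁻¹ with hs
    have hmem := fp_smul_mem hBc hBk h0 hv0
    have hint : ∀ r : ℝ, r • v ∈ interior B → -s < r ∧ r < t := by
      intro r hr
      have c1 : ContinuousAt (fun r : ℝ => r • v) r := by fun_prop
      have h1 := c1.preimage_mem_nhds (mem_interior_iff_mem_nhds.1 hr)
      obtain ⟨ε, hε, hball⟩ := Metric.mem_nhds_iff.1 h1
      have a1 : r + ε / 2 ∈ Metric.ball r ε := by
        rw [Metric.mem_ball, Real.dist_eq, add_sub_cancel_left, abs_of_pos (by positivity)]
        linarith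
      have a2 : r - ε / 2 ∈ Metric.ball r ε := by
        rw [Metric.mem_ball, Real.dist_eq, sub_sub_cancel_left, abs_neg, abs_of_pos (by positivity)]
        linarith
      have b1 := (hmem _).1 (hball a1)
      have b2 := (hmem _).1 (hball a2)
      constructor <;> linarith [b1.1, b1.2, b2.1, b2.2]
    have m1 : (-s) • v ∈ B := (hmem _).2 ⟨le_rfl, by linarith⟩
    have m2 : t • v ∈ B := (hmem _).2 ⟨by linarith, le_rfl⟩
    have m3 : 1 + s ≤ t := by
      have := hsym _ m1
      have e : v - (-s) • v = (1 + s) • v := by module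
      rw [e] at this
      exact ((hmem _).1 this).2
    have e1 : p - s • (q - p) = p + (((-s) • v : LinearMap.ker φ) : V) := by
      rw [Submodule.coe_smul, hvv]; module
    have e2 : p + t • (q - p) = p + ((t • v : LinearMap.ker φ) : V) := by
      rw [Submodule.coe_smul, hvv]
    refine ⟨s, t, g2, g1, by linarith, ⟨?_, ?_⟩, ⟨?_, ?_⟩⟩
    · rw [e1]; exact m1
    · rw [e1]; intro h
      exact lt_irrefl _ (hint _ (ch.body_interior_of h)).1
    · rw [e2]; exact m2
    · rw [e2]; intro h
      exact lt_irrefl _ (hint _ (ch.body_interior_of h)).2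
  · intro W hpW hW
    let P : Submodule ℝ (LinearMap.ker φ) := W.comap (LinearMap.ker φ).subtype
    have hP : P < ⊤ := by
      rw [lt_top_iff_ne_top]
      intro h
      have hle : LinearMap.ker φ ≤ W := by
        intro x hx
        have : (⟨x, hx⟩ : LinearMap.ker φ) ∈ P := by rw [h]; trivial
        exact this
      have heq := Submodule.eq_of_le_of_finrank_le hle hW
      rw [← heq] at hpW
      have : φ p = 0 := hpW
      linarith
    obtain ⟨c, hcP, hc⟩ := fp_section hBc hBk h0 hyp' hsym P hP
    refine ⟨c, hcP, c.2, ?_⟩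
    intro x y hx hy hφx hφy hxS hyS hxi hyi hxy ⟨a, b, hab⟩
    let x' : LinearMap.ker φ := ⟨x - p, by simp [hφp, hφx]⟩
    let y' : LinearMap.ker φ := ⟨y - p, by simp [hφp, hφy]⟩
    have ex : p + (x' : V) = x := by simp [x']
    have ey : p + (y' : V) = y := by simp [y']
    have hx'B : x' ∈ B := by show ch.Cp S _; rwa [ex]
    have hy'B : y' ∈ B := by show ch.Cp S _; rwa [ey]
    have hx'i : x' ∉ interior B := fun h => hxi (by rw [← ex]; exact ch.of_body_interior hφ hφp h)
    have hy'i : y' ∉ interior B := fun h => hyi (by rw [← ey]; exact ch.of_body_interior hφ hφp h)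
    have hx'P : x' ∈ P := W.sub_mem hx hpW
    have hy'P : y' ∈ P := W.sub_mem hy hpW
    have hxy' : x' ≠ y' := by
      intro h; apply hxy; rw [← ex, ← ey, h]
    have hab1 : a + b = 1 := by
      have := congrArg φ hab
      simpa [hφp, hφx, hφy, show φ (c : V) = 0 from c.2] using this.symm
    have hcab : c = a • x' + b • y' := by
      apply Subtype.ext
      simp only [Submodule.coe_add, Submodule.coe_smul, x', y']
      have : (c : V) = a • x + b • y - p := by rw [← hab]; abel
      rw [this, smul_sub, smul_sub]
      have h : p = a • p + b • p := by rw [← add_smul, hab1, one_smul]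
      nth_rewrite 1 [h]
      abel
    have res : x' + y' = (2 : ℝ) • c := by
      by_cases hb : b = 0
      · have ha : a = 1 := by linarith
        have : x' = c := by rw [hcab, ha, hb]; simp
        rw [add_comm]
        exact fp_chord hBc P hcP h0 hc hy'B hy'P hy'i hx'B hx'P hx'i hxy'.symm (β := 0)
          (by simp [this])
      · refine fp_chord hBc P hcP h0 hc hx'B hx'P hx'i hy'B hy'P hy'i hxy' (β := -a / b) ?_
        have ha : a = 1 - b := by linarith
        rw [hcab, ha]
        have e1 : x' - ((1 - b) • x' + b • y') = b • (x' - y') := by module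
        rw [e1, smul_smul, div_mul_cancel₀ _ hb]
        module
    have := congrArg Subtype.val res
    simp only [Submodule.coe_add, Submodule.coe_smul] at this
    rw [← ex, ← ey, smul_add, ← this, two_smul]
    abel

end main
end FPChart

/-- The linear-algebra data of the chart given by `e`. -/
def fpch {d : ℕ} (e : PV d ≃ₗ[ℝ] PV d) : FPChart (Fin d → ℝ) (PV d) where
  lam := LinearMap.proj (Fin.last d) ∘ₗ e.symm.toLinearMap
  P := LinearMap.funLeft ℝ ℝ Fin.castSucc ∘ₗ e.symm.toLinearMap
  i := e.toLinearMap ∘ₗ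
    { toFun := fun y => (Fin.snoc y (0 : ℝ) : Fin (d + 1) → ℝ)
      map_add' := by
        intro x y
        ext k
        refine Fin.lastCases ?_ (fun k => ?_) k <;> simp
      map_smul' := by
        intro c y
        ext k
        refine Fin.lastCases ?_ (fun k => ?_) k <;> simp }
  j0 := e (Fin.snoc (0 : Fin d → ℝ) (1 : ℝ) : Fin (d + 1) → ℝ)
  lam_i := by intro y; simp
  lam_j0 := by simp
  P_i := by intro y; ext k; simp [LinearMap.funLeft]
  P_j0 := by ext k; simp [LinearMap.funLeft]
  decomp := by
    intro x
    apply e.symm.injective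
    ext k
    refine Fin.lastCases ?_ (fun k => ?_) k <;> simp [LinearMap.funLeft]

lemma fpch_j {d : ℕ} (e : PV d ≃ₗ[ℝ] PV d) (y : Fin d → ℝ) :
    (fpch e).j y = e (Fin.snoc y (1 : ℝ) : Fin (d + 1) → ℝ) := by
  apply e.symm.injective
  ext k
  refine Fin.lastCases ?_ (fun k => ?_) k <;> simp [FPChart.j, fpch]

lemma fpch_j_ne {d : ℕ} (e : PV d ≃ₗ[ℝ] PV d) (y : Fin d → ℝ) : (fpch e).j y ≠ 0 := by
  intro h
  have := (fpch e).lam_j y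
  rw [h, map_zero] at this
  norm_num at this

lemma fp_chartMap {d : ℕ} (e : PV d ≃ₗ[ℝ] PV d) (y : Fin d → ℝ) :
    chartMap e y = Projectivization.mk ℝ ((fpch e).j y) (fpch_j_ne e y) := by
  unfold chartMap
  congr 1
  exact (fpch_j e y).symm

lemma fp_chartMap_kap {d : ℕ} (e : PV d ≃ₗ[ℝ] PV d) {x : PV d} (hx : x ≠ 0)
    (h : (fpch e).lam x ≠ 0) : Projectivization.mk ℝ x hx = chartMap e ((fpch e).kap x) := by
  rw [fp_chartMap, Projectivization.mk_eq_mk_iff']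
  exact ⟨_, ((fpch e).eq_smul_j h).symm⟩

lemma fp_mk_mem_chart {d : ℕ} (e : PV d ≃ₗ[ℝ] PV d) (S : Set (Fin d → ℝ)) {x : PV d}
    (hx : x ≠ 0) : Projectivization.mk ℝ x hx ∈ chartMap e '' S ↔ (fpch e).Kc S x := by
  constructor
  · rintro ⟨y, hy, h⟩
    rw [fp_chartMap, Projectivization.mk_eq_mk_iff'] at h
    obtain ⟨a, ha⟩ := h
    have ha0 : a ≠ 0 := by
      rintro rfl
      rw [zero_smul] at ha
      exact fpch_j_ne e y ha.symm
    rw [← (fpch e).Kc_smul ha0, ha]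
    exact ((fpch e).Cp_j hy).Kc
  · intro h
    exact ⟨_, h.2, (fp_chartMap_kap e hx h.1).symm⟩

lemma fp_mk_mem_projSet {d : ℕ} (W : Submodule ℝ (PV d)) {x : PV d} (hx : x ≠ 0) :
    Projectivization.mk ℝ x hx ∈ projSet W ↔ x ∈ W := by
  simp [projSet, Projectivization.submodule_mk, Submodule.span_singleton_le_iff_mem]

lemma fp_mk_mem_projSpan {d : ℕ} (W : Submodule ℝ (PV d)) {x p : PV d} (hx : x ≠ 0) (hp : p ≠ 0) :
    Projectivization.mk ℝ x hx ∈ projSpan (Projectivization.mk ℝ p hp) W ↔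
      ∃ u ∈ W, ∃ c : ℝ, u + c • p = x := by
  simp only [projSpan, mem_setOf_eq, Projectivization.submodule_mk,
    Submodule.span_singleton_le_iff_mem, Submodule.mem_sup, Submodule.mem_span_singleton]
  constructor
  · rintro ⟨u, hu, _, ⟨c, rfl⟩, h⟩; exact ⟨u, hu, c, h⟩
  · rintro ⟨u, hu, c, h⟩; exact ⟨u, hu, _, ⟨c, rfl⟩, h⟩

lemma fp_mk_mem_projLine {d : ℕ} {x a b : PV d} (hx : x ≠ 0) (ha : a ≠ 0) (hb : b ≠ 0) :
    Projectivization.mk ℝ x hx ∈ projLine (Projectivization.mk ℝ a ha) (Projectivization.mk ℝ b hb)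
      ↔ ∃ s t : ℝ, s • a + t • b = x := by
  simp only [projLine, mem_setOf_eq, Projectivization.submodule_mk,
    Submodule.span_singleton_le_iff_mem, Submodule.mem_sup, Submodule.mem_span_singleton]
  constructor
  · rintro ⟨_, ⟨s, rfl⟩, _, ⟨t, rfl⟩, h⟩; exact ⟨s, t, h⟩
  · rintro ⟨s, t, h⟩; exact ⟨_, ⟨s, rfl⟩, _, ⟨t, rfl⟩, h⟩

lemma fp_ker_finrank {d : ℕ} {f : PV d →ₗ[ℝ] ℝ} (hf : f ≠ 0) : finrank ℝ (LinearMap.ker f) = d := by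
  have := Module.Dual.finrank_ker_add_one_of_ne_zero (f := f) hf
  simpa using this

lemma fp_eq_ker {d : ℕ} (W : Submodule ℝ (PV d)) (hW : finrank ℝ W = d) {x : PV d} (hx : x ∉ W) :
    ∃ f : PV d →ₗ[ℝ] ℝ, f x ≠ 0 ∧ W = LinearMap.ker f := by
  obtain ⟨f, hf, hle⟩ := Submodule.exists_le_ker_of_notMem hx
  refine ⟨f, hf, Submodule.eq_of_le_of_finrank_eq hle ?_⟩
  rw [hW, fp_ker_finrank]
  rintro rfl
  simp at hf

lemma fp_hyp {d : ℕ} (e : PV d ≃ₗ[ℝ] PV d) (K₀ : Set (Fin d → ℝ)) (φ : PV d →ₗ[ℝ] ℝ)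
    {p q : PV d} (hp0 : p ≠ 0) (hq0 : q ≠ 0) (hp : φ p = 1) (hq : φ q = 1)
    (hpK : (fpch e).Kc K₀ p)
    (hyp : ∀ Wl : Submodule ℝ (PV d), Module.finrank ℝ Wl = d - 1 →
      projSet Wl ⊆ projSet (LinearMap.ker φ) →
      ∃ (Φ : RP d → RP d) (G : Set (RP d)) (τ : RP d),
        IsHarmonicHomology Φ G τ ∧ projSet Wl ⊆ G ∧ τ ∈ projSet (LinearMap.ker φ) ∧
          Φ '' (projSpan (Projectivization.mk ℝ p hp0) Wl ∩ chartMap e '' K₀) =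
            projSpan (Projectivization.mk ℝ q hq0) Wl ∩ chartMap e '' K₀) :
    (fpch e).Hyp K₀ φ p q := by
  rintro n ⟨c₀, hφc, hnc⟩
  have hφ0 : φ ≠ 0 := by rintro rfl; simp at hp
  let n0 : LinearMap.ker φ →ₗ[ℝ] ℝ := n ∘ₗ (LinearMap.ker φ).subtype
  have hn0 : n0 ≠ 0 := by
    intro h
    exact hnc (LinearMap.congr_fun h ⟨c₀, hφc⟩)
  let Wl : Submodule ℝ (PV d) := (LinearMap.ker n0).map (LinearMap.ker φ).subtype
  have hWl : ∀ x, x ∈ Wl ↔ φ x = 0 ∧ n x = 0 := by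
    intro x
    constructor
    · rintro ⟨z, hz, rfl⟩
      exact ⟨z.2, hz⟩
    · rintro ⟨h1, h2⟩
      exact ⟨⟨x, h1⟩, h2, rfl⟩
  have hfr : finrank ℝ Wl = d - 1 := by
    have h1 : finrank ℝ Wl = finrank ℝ (LinearMap.ker n0) :=
      Submodule.finrank_map_subtype_eq _ _
    have h2 := Module.Dual.finrank_ker_add_one_of_ne_zero (f := n0) hn0
    have h3 := fp_ker_finrank hφ0
    omega
  have hsub : projSet Wl ⊆ projSet (LinearMap.ker φ) := by
    intro x hx
    have hle : Wl ≤ LinearMap.ker φ := fun y hy => ((hWl y).1 hy).1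
    exact le_trans hx hle
  obtain ⟨Φ, G, τ, ⟨σ, W, t, ht, hWf, rfl, rfl, htW, hσW, hσt, hΦ⟩, hG, hτ, himg⟩ := hyp Wl hfr hsub
  have hφt : φ t = 0 := (fp_mk_mem_projSet _ ht).1 hτ
  have hσl : ∀ x ∈ Wl, σ x = x := by
    intro x hx
    by_cases hx0 : x = 0
    · rw [hx0, map_zero]
    · exact hσW x ((fp_mk_mem_projSet _ hx0).1 (hG ((fp_mk_mem_projSet _ hx0).2 hx)))
  obtain ⟨ψ, hψt, hψW⟩ := fp_eq_ker W hWf htW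
  have hσφ : ∀ x, φ (σ x) = φ x := by
    intro x
    have h1 : x - (ψ x / ψ t) • t ∈ W := by
      rw [hψW, LinearMap.mem_ker, map_sub, map_smul, smul_eq_mul, div_mul_cancel₀ _ hψt, sub_self]
    have h2 := hσW _ h1
    have h3 := congrArg φ h2
    simpa [hσt, hφt] using h3
  have hσx : ∀ x, φ x = 1 → n x = n p → σ x = x + (σ p - p) := by
    intro x h1 h2
    have h3 := hσl (x - p) ((hWl _).2 ⟨by simp [h1, hp], by simp [h2]⟩)
    rw [map_sub, sub_eq_iff_eq_add] at h3
    rw [h3]; abel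
  have hspan : ∀ x (hx : x ≠ 0) {r : PV d} (hr : r ≠ 0), φ x = 1 → φ r = 1 → n x = n r →
      Projectivization.mk ℝ x hx ∈ projSpan (Projectivization.mk ℝ r hr) Wl := by
    intro x hx r hr h1 h2 h3
    rw [fp_mk_mem_projSpan]
    exact ⟨x - r, (hWl _).2 ⟨by simp [h1, h2], by simp [h3]⟩, 1, by simp⟩
  have hne : ∀ x, φ x = 1 → x ≠ 0 := by
    rintro x h rfl
    simp at h
  have hfwd : ∀ x (hx : x ≠ 0) (hx' : σ x ≠ 0), φ x = 1 → n x = n p → (fpch e).Kc K₀ x →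
      Projectivization.mk ℝ (σ x) hx' ∈
        projSpan (Projectivization.mk ℝ q hq0) Wl ∩ chartMap e '' K₀ := by
    intro x hx hx' h1 h2 h3
    rw [← himg]
    obtain ⟨h', hΦx⟩ := hΦ x hx
    exact ⟨_, ⟨hspan x hx hp0 h1 hp h2, (fp_mk_mem_chart e K₀ hx).2 h3⟩, hΦx⟩
  have hσp1 : φ (σ p) = 1 := by rw [hσφ, hp]
  have hnw : n (σ p - p) = n (q - p) := by
    have h := (hfwd p hp0 (hne _ hσp1) hp rfl hpK).1
    rw [fp_mk_mem_projSpan] at h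
    obtain ⟨u, hu, c, h⟩ := h
    obtain ⟨hu1, hu2⟩ := (hWl u).1 hu
    have hc : c = 1 := by
      have := congrArg φ h
      simpa [hu1, hq, hσp1] using this
    rw [← h, hc]
    simp [hu2]
  refine ⟨σ p - p, by simp [hσφ], hnw, fun x hx hnx => ?_⟩
  have hx0 := hne x hx
  have hs := hσx x hx hnx
  have hσx1 : φ (σ x) = 1 := by rw [hσφ, hx]
  rw [← hs]
  constructor
  · intro hK
    exact (fp_mk_mem_chart e K₀ (hne _ hσx1)).1 (hfwd x hx0 (hne _ hσx1) hx hnx hK).2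
  · intro hK
    have hmem : Projectivization.mk ℝ (σ x) (hne _ hσx1) ∈
        projSpan (Projectivization.mk ℝ q hq0) Wl ∩ chartMap e '' K₀ := by
      refine ⟨hspan _ _ hq0 hσx1 hq ?_, (fp_mk_mem_chart e K₀ _).2 hK⟩
      rw [hs, map_add, hnw, hnx, map_sub]; ring
    rw [← himg] at hmem
    obtain ⟨z, ⟨-, hzK⟩, hz⟩ := hmem
    induction z using Projectivization.ind with
    | h y hy =>
      obtain ⟨h', hΦy⟩ := hΦ y hy
      rw [hΦy, Projectivization.mk_eq_mk_iff'] at hz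
      obtain ⟨a, ha⟩ := hz
      have ha0 : a ≠ 0 := by
        rintro rfl
        rw [zero_smul] at ha
        exact h' ha.symm
      have hyx : a • x = y := by
        apply σ.injective
        rw [map_smul, ha]
      rw [fp_mk_mem_chart, ← hyx, (fpch e).Kc_smul ha0] at hzK
      exact hzK

lemma fp_section_frontier {d : ℕ} (e : PV d ≃ₗ[ℝ] PV d) {K₀ : Set (Fin d → ℝ)} (hk : IsCompact K₀)
    (W : Submodule ℝ (PV d)) {A : RP d} (hA : A ∈ sectionFrontier e K₀ W) :
    ∃ y, A = chartMap e y ∧ y ∈ K₀ ∧ y ∉ interior K₀ ∧ (fpch e).j y ∈ W := by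
  obtain ⟨y, hy, rfl⟩ := hA
  have hS : chartMap e ⁻¹' projSet W = (fpch e).j ⁻¹' (W : Set (PV d)) := by
    ext z
    rw [mem_preimage, mem_preimage, fp_chartMap, fp_mk_mem_projSet]
    rfl
  rw [hS] at hy
  set S' := (fpch e).j ⁻¹' (W : Set (PV d)) ∩ K₀ with hS'
  have hcl : IsClosed S' :=
    (W.closed_of_finiteDimensional.preimage (fpch e).continuous_j).inter hk.isClosed
  have hyS : y ∈ S' := intrinsicFrontier_subset hcl hy
  refine ⟨y, rfl, hyS.2, ?_, hyS.1⟩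
  intro hyi
  obtain ⟨z, hz, rfl⟩ := hy
  apply hz.2
  have hspan : ∀ z ∈ affineSpan ℝ S', (fpch e).j z ∈ W := by
    intro z hz
    refine affineSpan_induction (p := fun z => (fpch e).j z ∈ W) hz ?_ ?_
    · exact fun x hx => hx.1
    · intro c u v w hu hv hw
      have : (fpch e).j (c • (u -ᵥ v) +ᵥ w) =
          c • ((fpch e).j u - (fpch e).j v) + (fpch e).j w := by
        simp only [FPChart.j, vsub_eq_sub, vadd_eq_add, map_add, map_smul, map_sub]
        module
      rw [this]
      exact W.add_mem (W.smul_mem _ (W.sub_mem hu hv)) hw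
  have hop : IsOpen ((fun z : affineSpan ℝ S' => (z : Fin d → ℝ)) ⁻¹' interior K₀) :=
    isOpen_interior.preimage continuous_subtype_val
  refine mem_interior.2 ⟨_, ?_, hop, hyi⟩
  intro z' hz'
  exact ⟨hspan _ z'.2, interior_subset hz'⟩

lemma fp_one {d : ℕ} (hd : 3 ≤ d) (e : PV d ≃ₗ[ℝ] PV d) {K₀ : Set (Fin d → ℝ)}
    (hS : Convex ℝ K₀) (hk : IsCompact K₀) {φ : PV d →ₗ[ℝ] ℝ}
    (hφ : ∀ y ∈ K₀, 0 < φ ((fpch e).j y)) {p q : PV d} (hp0 : p ≠ 0)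
    (hp : (fpch e).Cp (interior K₀) p)
    (hq : (fpch e).Cp (interior K₀) q) (hφp : φ p = 1) (hφq : φ q = 1) (hpq : p ≠ q)
    (hyp : (fpch e).Hyp K₀ φ p q) :
    IsFalsePole e K₀ (Projectivization.mk ℝ p hp0) (projSet (LinearMap.ker φ)) := by
  have hφ0 : φ ≠ 0 := by rintro rfl; simp at hφp
  have hker := fp_ker_finrank hφ0
  have hne : ∀ x, φ x = 1 → x ≠ 0 := by
    rintro x h rfl
    simp at h
  obtain ⟨⟨s, t, hs, ht, hst, ⟨hA, hA'⟩, ⟨hB, hB'⟩⟩, hsec⟩ :=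
    (fpch e).main_affine hS hk (by omega) hφ hp hq hφp hφq hpq hyp
  refine ⟨?_, ?_⟩
  · intro hpole
    set v := q - p with hv
    have hv0 : v ≠ 0 := sub_ne_zero.2 hpq.symm
    have hφv : φ v = 0 := by simp [hv, hφp, hφq]
    have hφA : φ (p - s • v) = 1 := by simp [hφp, hφv]
    have hφB : φ (p + t • v) = 1 := by simp [hφp, hφv]
    have hfr : ∀ x (hx : x ≠ 0), (fpch e).Cp K₀ x → ¬ (fpch e).Cp (interior K₀) x →
        Projectivization.mk ℝ x hx ∈ chartFrontier e K₀ := by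
      intro x hx h1 h2
      refine ⟨(fpch e).kap x, ?_, (fp_chartMap_kap e hx h1.1.ne').symm⟩
      exact ⟨subset_closure h1.2, fun h => h2 ⟨h1.1, h⟩⟩
    have hst0 : s + t ≠ 0 := by positivity
    have key := hpole (Projectivization.mk ℝ (p - s • v) (hne _ hφA))
      (Projectivization.mk ℝ (p + t • v) (hne _ hφB)) (Projectivization.mk ℝ v hv0)
      (hfr _ _ hA hA') (hfr _ _ hB hB') ?_ ?_ ?_ ?_
    · obtain ⟨a, b, ha, hb, hab, hab', h1, h2, h3, h4⟩ := key
      rw [eq_comm, Projectivization.mk_eq_mk_iff'] at h1 h2 h3 h4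
      obtain ⟨α, rfl⟩ := h1
      obtain ⟨β, rfl⟩ := h2
      obtain ⟨γ, h3⟩ := h3
      obtain ⟨δ, h4⟩ := h4
      have e4 := congrArg φ h4
      have e3 := congrArg φ h3
      simp only [map_sub, map_add, map_smul, hφp, hφv, smul_eq_mul] at e3 e4
      have hβ : β = α := by linarith
      have hγ : γ = 2 * α := by linarith
      have hα : α ≠ 0 := by rintro rfl; simp at ha
      rw [hβ, hγ] at h3
      have h5 : (α * (t - s)) • v = 0 := by
        have : (α * (t - s)) • v = (α • (p - s • v) + α • (p + t • v)) - (2 * α) • p := by module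
        rw [this, ← h3, sub_self]
      rcases smul_eq_zero.1 h5 with h | h
      · rcases mul_eq_zero.1 h with h | h
        · exact hα h
        · exact hst (by linarith)
      · exact hv0 h
    · intro h
      rw [Projectivization.mk_eq_mk_iff'] at h
      obtain ⟨a, ha⟩ := h
      have e1 := congrArg φ ha
      rw [map_smul, hφA, hφB, smul_eq_mul, mul_one] at e1
      rw [e1, one_smul] at ha
      have : (s + t) • v = 0 := by
        have h' : (s + t) • v = (p + t • v) - (p - s • v) := by module
        rw [h', ha, sub_self]
      exact (smul_ne_zero hst0 hv0) this
    · rw [fp_mk_mem_projLine]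
      refine ⟨t / (s + t), s / (s + t), ?_⟩
      have h1 : t / (s + t) + s / (s + t) = 1 := by field_simp; ring
      have h2 : s / (s + t) * t - t / (s + t) * s = 0 := by field_simp; ring
      have : (t / (s + t)) • (p - s • v) + (s / (s + t)) • (p + t • v) =
          (t / (s + t) + s / (s + t)) • p + (s / (s + t) * t - t / (s + t) * s) • v := by module
      rw [this, h1, h2]; simp
    · rw [fp_mk_mem_projLine]
      refine ⟨-(s + t)⁻¹, (s + t)⁻¹, ?_⟩
      have : (-(s + t)⁻¹) • (p - s • v) + ((s + t)⁻¹) • (p + t • v) =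
          ((s + t)⁻¹ * (s + t)) • v := by module
      rw [this, inv_mul_cancel₀ hst0, one_smul]
    · rw [fp_mk_mem_projSet]; exact hφv
  · intro W hW hpW
    have hpW' : p ∈ W := (fp_mk_mem_projSet W hp0).1 hpW
    obtain ⟨c, hcW, hφc, hc⟩ := hsec W hpW' (by omega)
    have hg1 : φ (p + c) = 1 := by simp [hφp, hφc]
    refine ⟨Projectivization.mk ℝ (p + c) (hne _ hg1),
      (fp_mk_mem_projSet W _).2 (W.add_mem hpW' hcW), ?_⟩
    have norm : ∀ A ∈ sectionFrontier e K₀ W, ∃ (a : PV d) (ha : a ≠ 0),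
        A = Projectivization.mk ℝ a ha ∧ φ a = 1 ∧ a ∈ W ∧ (fpch e).Cp K₀ a ∧
          ¬ (fpch e).Cp (interior K₀) a := by
      intro A hA
      obtain ⟨y, rfl, hyK, hyi, hyW⟩ := fp_section_frontier e hk W hA
      have hpos := hφ y hyK
      have h1 : φ ((φ ((fpch e).j y))⁻¹ • (fpch e).j y) = 1 := by
        rw [map_smul, smul_eq_mul, inv_mul_cancel₀ hpos.ne']
      refine ⟨(φ ((fpch e).j y))⁻¹ • (fpch e).j y, hne _ h1, ?_, h1, W.smul_mem _ hyW,
        (fpch e).Cp_smul (inv_pos.2 hpos) ((fpch e).Cp_j hyK), ?_⟩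
      · rw [fp_chartMap, eq_comm, Projectivization.mk_eq_mk_iff']
        exact ⟨_, rfl⟩
      · intro h
        have := h.2
        rw [(fpch e).kap_smul (inv_pos.2 hpos).ne', FPChart.kap_j] at this
        exact hyi this
    intro A B q' hA hB hAB hg hq' hqH
    obtain ⟨a, ha, rfl, hφa, haW, haK, hai⟩ := norm A hA
    obtain ⟨b, hb, rfl, hφb, hbW, hbK, hbi⟩ := norm B hB
    have hab : a ≠ b := by
      rintro rfl
      exact hAB rfl
    rw [fp_mk_mem_projLine] at hg
    obtain ⟨s', t', hst'⟩ := hg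
    have hsum := hc a b haW hbW hφa hφb haK hbK hai hbi hab ⟨s', t', hst'.symm⟩
    have hab1 : a + b ≠ 0 := by
      intro h
      have := congrArg φ h
      rw [map_add, hφa, hφb, map_zero] at this
      norm_num at this
    refine ⟨a, b, ha, hb, hab1, sub_ne_zero.2 hab, rfl, rfl, ?_, ?_⟩
    · rw [Projectivization.mk_eq_mk_iff']
      refine ⟨1 / 2, ?_⟩
      rw [hsum, smul_smul]; norm_num
    · induction q' using Projectivization.ind with
      | h u hu =>
        rw [fp_mk_mem_projLine] at hq'
        obtain ⟨x, y, hxy⟩ := hq'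
        have hφu : φ u = 0 := (fp_mk_mem_projSet _ hu).1 hqH.2
        have hy : y = -x := by
          rw [← hxy] at hφu
          simp only [map_add, map_smul, hφa, hφb, smul_eq_mul] at hφu
          linarith
        rw [Projectivization.mk_eq_mk_iff']
        refine ⟨x, ?_⟩
        rw [← hxy, hy]
        module

theorem false_pole_of_harmonic_homologies {d : ℕ} (hd : 3 ≤ d)
    -- `K` is a convex body lying in an affine chart of `ℝP^d`
    (e : PV d ≃ₗ[ℝ] PV d) (K₀ : Set (Fin d → ℝ))
    (hconv : Convex ℝ K₀) (hcpt : IsCompact K₀) (hint : (interior K₀).Nonempty)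
    (K : Set (RP d)) (hK : K = chartMap e '' K₀)
    -- `H` is a hyperplane of `ℝP^d` which is not a support hyperplane of `K`
    (H : Set (RP d)) (WH : Submodule ℝ (PV d)) (hWH : Module.finrank ℝ WH = d)
    (hH : H = projSet WH) (hsupp : ¬ IsSupportHyperplane e K₀ H)
    -- `p₁ ≠ p₂` are interior points of `K` not lying on `H`
    (p₁ p₂ : RP d) (hp₁ : p₁ ∈ chartMap e '' interior K₀)
    (hp₂ : p₂ ∈ chartMap e '' interior K₀) (hne : p₁ ≠ p₂)
    (hp₁H : p₁ ∉ H) (hp₂H : p₂ ∉ H)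
    -- for every `(d-2)`-dimensional projective plane `l ⊆ H` there is a harmonic
    -- homology with hyperplane `G ⊇ l` and center `τ ∈ H` mapping `aff{p₁,l} ∩ K`
    -- onto `aff{p₂,l} ∩ K`
    (hyp : ∀ Wl : Submodule ℝ (PV d), Module.finrank ℝ Wl = d - 1 → projSet Wl ⊆ H →
      ∃ (Φ : RP d → RP d) (G : Set (RP d)) (τ : RP d),
        IsHarmonicHomology Φ G τ ∧ projSet Wl ⊆ G ∧ τ ∈ H ∧
          Φ '' (projSpan p₁ Wl ∩ K) = projSpan p₂ Wl ∩ K) :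
    IsFalsePole e K₀ p₁ H ∧ IsFalsePole e K₀ p₂ H := by
  obtain ⟨y₁, hy₁, rfl⟩ := hp₁
  obtain ⟨y₂, hy₂, rfl⟩ := hp₂
  subst hK
  rw [fp_chartMap, hH, fp_mk_mem_projSet] at hp₁H hp₂H
  obtain ⟨f, hf, hWf⟩ := fp_eq_ker WH hWH hp₁H
  obtain ⟨φ, hφ₁, hWφ⟩ : ∃ φ : PV d →ₗ[ℝ] ℝ, φ ((fpch e).j y₁) = 1 ∧ WH = LinearMap.ker φ := by
    refine ⟨(f ((fpch e).j y₁))⁻¹ • f, by simp [hf], ?_⟩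
    rw [hWf, LinearMap.ker_smul _ _ (inv_ne_zero hf)]
  subst hWφ
  subst hH
  have hφ₂ : φ ((fpch e).j y₂) ≠ 0 := hp₂H
  set p := (fpch e).j y₁ with hp
  set q := (φ ((fpch e).j y₂))⁻¹ • (fpch e).j y₂ with hq
  have hφq : φ q = 1 := by rw [hq, map_smul, smul_eq_mul, inv_mul_cancel₀ hφ₂]
  have hp0 : p ≠ 0 := fpch_j_ne e y₁
  have hq0 : q ≠ 0 := smul_ne_zero (inv_ne_zero hφ₂) (fpch_j_ne e y₂)
  have ep : chartMap e y₁ = Projectivization.mk ℝ p hp0 := fp_chartMap e y₁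
  have eq' : chartMap e y₂ = Projectivization.mk ℝ q hq0 := by
    rw [fp_chartMap, eq_comm, Projectivization.mk_eq_mk_iff']
    exact ⟨_, rfl⟩
  rw [ep, eq'] at hyp ⊢
  have hpq : p ≠ q := by
    intro h
    apply hne
    rw [ep, eq']
    congr 1
  have hpC : (fpch e).Cp (interior K₀) p := (fpch e).Cp_j hy₁
  have hqK : (fpch e).Kc (interior K₀) q :=
    ((fpch e).Kc_smul (inv_ne_zero hφ₂) _).2 ((fpch e).Cp_j hy₂).Kc
  have hyp' : (fpch e).Hyp K₀ φ p q := fp_hyp e K₀ φ hp0 hq0 hφ₁ hφq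
    ((fpch e).Cp_j (interior_subset hy₁)).Kc hyp
  have hint0 : ∀ y ∈ interior K₀, φ ((fpch e).j y) ≠ 0 := fun y hy =>
    (fpch e).no_cross (by simp; omega) hconv hcpt hpC hqK hφ₁ hφq hpq hyp' hy
  have hK0 : ∀ y ∈ K₀, φ ((fpch e).j y) ≠ 0 := by
    intro y hy h0
    apply hsupp
    refine ⟨⟨chartMap e y, ?_, ⟨y, hy, rfl⟩⟩, ?_⟩
    · rw [fp_chartMap, fp_mk_mem_projSet]; exact h0
    · rw [Set.eq_empty_iff_forall_notMem]
      rintro _ ⟨h1, ⟨z, hz, rfl⟩⟩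
      rw [fp_chartMap, fp_mk_mem_projSet] at h1
      exact hint0 z hz h1
  have hpos : ∀ y ∈ K₀, 0 < φ ((fpch e).j y) := by
    intro y hy
    by_contra hcon
    push Not at hcon
    have cont : ContinuousOn (fun y => φ ((fpch e).j y)) K₀ :=
      (φ.continuous_of_finiteDimensional.comp (fpch e).continuous_j).continuousOn
    obtain ⟨z, hz, hz0⟩ := hconv.isPreconnected.intermediate_value hy (interior_subset hy₁) cont
      (show (0 : ℝ) ∈ Set.Icc _ _ from ⟨hcon, by show (0 : ℝ) ≤ φ p; rw [hφ₁]; norm_num⟩)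
    exact hK0 z hz hz0
  have hqC : (fpch e).Cp (interior K₀) q :=
    (fpch e).Cp_smul (inv_pos.2 (hpos _ (interior_subset hy₂))) ((fpch e).Cp_j hy₂)
  exact ⟨fp_one hd e hconv hcpt hpos hp0 hpC hqC hφ₁ hφq hpq hyp',
    fp_one hd e hconv hcpt hpos hq0 hqC hpC hφq hφ₁ hpq.symm hyp'.symm⟩
end
end
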